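/- arXiv:2003.02073 — 2 statements merged into one kernel-verified Lean document; each statement's English description precedes it below -/
import Mathlib

section
/- Let (σ_η², ν_η, γ_η) ≠ (0, 0, 0) and (σ_Ũ², ν_Ũ, γ_Ũ) be Lévy triplets with ν_Ũ concentrated on [−1,∞), let μ be an invariant probability measure for the generator A, and assume ∫_{[−1,1]} |y| ν_η(dy) < ∞, ∫_{[−1,1]} |y| ν_Ũ(dy) < ∞ and σ_η² + σ_Ũ² > 0. Set γ_η⁰ = γ_η − ∫_{[−1,1]} y ν_η(dy) and γ_Ũ⁰ = γ_Ũ − ∫_{[−1,1]} y ν_Ũ(dy). Then: (i) if σ_η² > 0, μ has a Lebesgue density f_μ which is continuously differentiable on ℝ ∖ {0}; (ii) if σ_Ũ² > 0 = σ_η² and in addition (ν_Ũ({−1}) = 0, or γ_η⁰ ≠ 0, or ν_η(ℝ) = ∞), then μ has a Lebesgue density f_μ on ℝ which is continuously differentiable on ℝ ∖ {0}; (iii) under (i) or (ii), for all z ∈ ℝ ∖ {0}: (σ_η²/2 + z² σ_Ũ²/2) f_μ'(z) + z σ_Ũ² f_μ(z) − (γ_η⁰ + z γ_Ũ⁰)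 f_μ(z) − B_η^{FV}(z) μ({0}) = (B_η^{FV}∗f_μ)(z) + 1_{z>0} ∫₀^∞ B_Ũ^{FV}(z/x) f_μ(x) dx − 1_{z<0} ∫_{−∞}^0 B_Ũ^{FV}(z/x) f_μ(x) dx; if σ_Ũ² > 0 = σ_η² but the additional assumption in (ii) fails, the restriction of μ to ℝ ∖ {0} has a density f_μ that is differentiable Lebesgue-a.e. and the displayed equation holds for Lebesgue-a.e. z. -/
open MeasureTheory Set Filter

noncomputable section

namespace KEF

def IsLevyMeasure (ν : Measure ℝ) : Prop :=
  ν {0} = 0 ∧ ∫⁻ y, ENNReal.ofReal (min 1 (y ^ 2)) ∂ν < ⊤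

/-- The generator `A` of the killed generalized OU process, expressed through the
Lévy triplets `(ση2, νη, γη)` of `η` and `(σU2, νU, γU)` of `Ũ`. -/
def levyGen (ση2 γη σU2 γU : ℝ) (νη νU : Measure ℝ) (f : ℝ → ℝ) (x : ℝ) : ℝ :=
  γη * deriv f x + ση2 / 2 * deriv (deriv f) x
    + (∫ y, (f (x + y) - f x - (if |y| ≤ 1 then y * deriv f x else 0)) ∂νη)
    + γU * (x * deriv f x) + σU2 / 2 * (x ^ 2 * deriv (deriv f) x)
    + ∫ y in Ici (-1 : ℝ), (f (x + x * y) - f x - (if |y| ≤ 1 then x * y * deriv f x else 0)) ∂νU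

/-- `μ` is invariant for the generator: `∫ Af dμ = 0` for all test functions `f`. -/
def Invariant (ση2 γη σU2 γU : ℝ) (νη νU : Measure ℝ) (μ : Measure ℝ) : Prop :=
  ∀ f : ℝ → ℝ, ContDiff ℝ (⊤ : ℕ∞) f → HasCompactSupport f →
    ∫ x, levyGen ση2 γη σU2 γU νη νU f x ∂μ = 0

def Bmap (ν : Measure ℝ) (z : ℝ) : ℝ :=
  if 0 < z then (ν (Ioi (max z 1))).toReal
  else if z < 0 then -((ν (Iio (min z (-1)))).toReal)
  else 0

def BUmap (ν : Measure ℝ) (z : ℝ) : ℝ :=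
  if 1 < z then (ν (Ioi (max (z - 1) 1))).toReal else 0

def Smap (ν : Measure ℝ) (z : ℝ) : ℝ :=
  if 0 < z then ∫ y in Ici z ∩ Icc (-1 : ℝ) 1, (y - z) ∂ν
  else if z < 0 then ∫ y in Iic z ∩ Icc (-1 : ℝ) 1, (z - y) ∂ν
  else 0

def SUmap (ν : Measure ℝ) (z : ℝ) : ℝ :=
  if 0 ≤ z ∧ z < 1 then ∫ y in Icc (-1 : ℝ) (z - 1), (z - 1 - y) ∂ν
  else if 1 < z then ∫ y in Ici (z - 1) ∩ Icc (-1 : ℝ) 1, (y - z + 1) ∂ν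
  else 0

/-- convolution of a function with a measure -/
def convM (g : ℝ → ℝ) (μ : Measure ℝ) (z : ℝ) : ℝ := ∫ x, g (z - x) ∂μ

def rmu (νU : Measure ℝ) (μ : Measure ℝ) (z : ℝ) : ℝ :=
  if 0 < z then ∫ x in Ioi (0 : ℝ), x * SUmap νU (z / x) ∂μ
  else if z < 0 then ∫ x in Iio (0 : ℝ), |x| * SUmap νU (z / x) ∂μ
  else 0

def kmu (νU : Measure ℝ) (μ : Measure ℝ) (t : ℝ) : ℝ :=
  if 0 < t then ∫ x in Ioc (0 : ℝ) t, BUmap νU (t / x) ∂μ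
  else if t < 0 then -∫ x in Ico t (0 : ℝ), BUmap νU (t / x) ∂μ
  else 0

def Dmu (γη γU : ℝ) (μ : Measure ℝ) (z : ℝ) : ℝ :=
  if 0 ≤ z then ∫ x in Ioc (0 : ℝ) z, (γη + x * γU) ∂μ
  else -∫ x in Ioc z (0 : ℝ), (γη + x * γU) ∂μ

end KEF

open KEF



def BmapFV (ν : Measure ℝ) (z : ℝ) : ℝ :=
  if 0 < z then (ν (Ioi z)).toReal
  else if z < 0 then -((ν (Iio z)).toReal)
  else 0

def BUmapFV (ν : Measure ℝ) (z : ℝ) : ℝ :=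
  if 0 ≤ z ∧ z < 1 then -((ν (Iio (z - 1))).toReal)
  else if 1 < z then (ν (Ioi (z - 1))).toReal
  else 0

/-- the density equation of Corollary 5.9(iii) at the point `z` -/
def densEqFV (ση2 σU2 γη0 γU0 : ℝ) (νη νU : Measure ℝ) (μ : Measure ℝ)
    (fμ : ℝ → ℝ) (z : ℝ) : Prop :=
  (ση2 / 2 + z ^ 2 * σU2 / 2) * deriv fμ z + z * σU2 * fμ z
      - (γη0 + z * γU0) * fμ z - BmapFV νη z * (μ {0}).toReal =
    (∫ x, BmapFV νη (z - x) * fμ x)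
      + (if 0 < z then ∫ x in Ioi (0 : ℝ), BUmapFV νU (z / x) * fμ x else 0)
      - (if z < 0 then ∫ x in Iio (0 : ℝ), BUmapFV νU (z / x) * fμ x else 0)

open scoped Topology ContDiff

namespace KEF

/-- A Lévy measure of finite variation. -/
structure IsFVLevy (ν : Measure ℝ) : Prop where
  zero : ν {0} = 0
  integrable : Integrable (fun y : ℝ => min 1 |y|) ν

lemma IsLevyMeasure.isFVLevy {ν : Measure ℝ} (h : IsLevyMeasure ν)
    (hFV : ∫⁻ y in Icc (-1 : ℝ) 1, ENNReal.ofReal |y| ∂ν < ⊤) : IsFVLevy ν := by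
  refine ⟨h.1, by fun_prop, ?_⟩
  rw [hasFiniteIntegral_iff_ofReal (ae_of_all _ fun y => by positivity),
    ← lintegral_add_compl _ (measurableSet_Icc : MeasurableSet (Icc (-1 : ℝ) 1))]
  refine ENNReal.add_lt_top.2 ⟨lt_of_le_of_lt (lintegral_mono fun y => ?_) hFV, ?_⟩
  · exact ENNReal.ofReal_le_ofReal (min_le_right _ _)
  · refine lt_of_le_of_lt ?_ h.2
    refine le_trans (setLIntegral_mono (by fun_prop) fun y hy => ?_) (setLIntegral_le_lintegral _ _)
    refine ENNReal.ofReal_le_ofReal (le_min (min_le_left _ _) ((min_le_left _ _).trans ?_))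
    by_contra! hlt
    exact hy (abs_le.1 ((sq_lt_one_iff_abs_lt_one y).1 hlt).le)

lemma IsFVLevy.integrable_of_le {ν : Measure ℝ} (h : IsFVLevy ν) {g : ℝ → ℝ}
    (hg : AEStronglyMeasurable g ν) (C : ℝ) (hC : ∀ y, |g y| ≤ C * min 1 |y|) : Integrable g ν :=
  (h.integrable.const_mul C).mono' hg (ae_of_all _ hC)

lemma IsFVLevy.abs_integral_le {ν : Measure ℝ} (h : IsFVLevy ν) {g : ℝ → ℝ}
    (C : ℝ) (hC : ∀ y, |g y| ≤ C * min 1 |y|) :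
    |∫ y, g y ∂ν| ≤ C * ∫ y, min 1 |y| ∂ν := by
  rw [← integral_const_mul]
  exact norm_integral_le_of_norm_le (f := g) (h.integrable.const_mul C) (ae_of_all _ hC)

lemma IsFVLevy.measure_lt_top {ν : Measure ℝ} (h : IsFVLevy ν) {s : Set ℝ} {δ : ℝ} (hδ : 0 < δ)
    (hs : ∀ y ∈ s, δ ≤ |y|) : ν s < ⊤ := by
  have h1 := h.integrable.measure_ge_lt_top (ε := min 1 δ) (by positivity)
  refine lt_of_le_of_lt (measure_mono fun y hy => ?_) h1
  simpa using min_le_min_left 1 (hs y hy)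

lemma IsFVLevy.sigmaFinite {ν : Measure ℝ} (h : IsFVLevy ν) : SigmaFinite ν := by
  let s : ℕ → Set ℝ := fun n => {0} ∪ {y | 1 / ((n : ℝ) + 1) ≤ |y|}
  have hs : ∀ n, ν (s n) < ⊤ := fun n =>
    (measure_union_le _ _).trans_lt (ENNReal.add_lt_top.2 ⟨by simp [h.zero],
      h.measure_lt_top (δ := 1 / ((n : ℝ) + 1)) (by positivity) fun y hy => hy⟩)
  refine Measure.sigmaFinite_of_countable (countable_range s) (by rintro _ ⟨n, rfl⟩; exact hs n) ?_
  refine eq_univ_of_forall fun y => ?_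
  by_cases hy : y = 0
  · exact ⟨s 0, mem_range_self 0, Or.inl hy⟩
  · obtain ⟨n, hn⟩ := exists_nat_one_div_lt (abs_pos.2 hy)
    exact ⟨s n, mem_range_self n, Or.inr hn.le⟩

/-- Smooth functions for which the generator is bounded by a multiple of `C`. -/
structure IsTame (f : ℝ → ℝ) (C : ℝ) : Prop where
  contDiff : ContDiff ℝ (⊤ : ℕ∞) f
  bound : ∀ x, |f x| ≤ C
  deriv_bound : ∀ x, |deriv f x| ≤ C
  deriv2_bound : ∀ x, |deriv (deriv f) x| ≤ C
  mul_deriv_bound : ∀ x, |x * deriv f x| ≤ C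
  mul_deriv2_bound : ∀ x, |x ^ 2 * deriv (deriv f) x| ≤ C

namespace IsTame

variable {f : ℝ → ℝ} {C : ℝ}

lemma nonneg (h : IsTame f C) : 0 ≤ C := (abs_nonneg _).trans (h.bound 0)

lemma contDiff_deriv (h : IsTame f C) : ContDiff ℝ (⊤ : ℕ∞) (deriv f) :=
  ((contDiff_infty_iff_deriv).1 h.contDiff).2

lemma continuous (h : IsTame f C) : Continuous f := h.contDiff.continuous

lemma continuous_deriv (h : IsTame f C) : Continuous (deriv f) := h.contDiff_deriv.continuous

lemma continuous_deriv2 (h : IsTame f C) : Continuous (deriv (deriv f)) :=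
  ((contDiff_infty_iff_deriv).1 h.contDiff_deriv).2.continuous

lemma differentiable (h : IsTame f C) : Differentiable ℝ f := h.contDiff.differentiable (by simp)

lemma abs_add_sub_le (h : IsTame f C) (x y : ℝ) : |f (x + y) - f x| ≤ 4 * C * min 1 |y| := by
  have hC := h.nonneg
  have h1 : |f (x + y) - f x| ≤ 2 * C := by
    linarith [abs_sub (f (x + y)) (f x), h.bound (x + y), h.bound x]
  have h2 : |f (x + y) - f x| ≤ C * |y| := by
    have := convex_univ.norm_image_sub_le_of_norm_deriv_le (f := f) (C := C) (x := x) (y := x + y)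
      (fun z _ => h.differentiable z) (fun z _ => h.deriv_bound z) trivial trivial
    simpa using this
  have := abs_nonneg y
  rcases le_total 1 |y| with hy | hy
  · rw [min_eq_left hy]; linarith
  · rw [min_eq_right hy]; nlinarith

lemma abs_mul_sub_le (h : IsTame f C) (x y : ℝ) : |f (x + x * y) - f x| ≤ 4 * C * min 1 |y| := by
  have hC := h.nonneg
  have h1 : |f (x + x * y) - f x| ≤ 2 * C := by
    linarith [abs_sub (f (x + x * y)) (f x), h.bound (x + x * y), h.bound x]
  have hy0 := abs_nonneg y
  rcases le_total (1 / 2) |y| with hy | hy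
  · have : 1 / 2 ≤ min 1 |y| := le_min (by norm_num) hy
    nlinarith
  · rw [min_eq_right (by linarith)]
    rcases eq_or_ne x 0 with rfl | hx
    · simp; positivity
    have hx' := abs_pos.2 hx
    have h2 := (convex_uIcc x (x + x * y)).norm_image_sub_le_of_norm_deriv_le (f := f)
      (C := 2 * C / |x|) (x := x) (y := x + x * y)
      (fun z _ => h.differentiable z) (fun z hz => ?_) left_mem_uIcc right_mem_uIcc
    · simp only [Real.norm_eq_abs, add_sub_cancel_left, abs_mul] at h2
      calc _ ≤ _ := h2
        _ = 2 * C * |y| := by field_simp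
        _ ≤ 4 * C * |y| := by nlinarith
    · have hz1 : |x - z| ≤ |x * y| := by
        have := abs_sub_left_of_mem_uIcc hz
        rw [abs_sub_comm] at this
        simpa using this
      have hz2 : |x| / 2 ≤ |z| := by
        rw [abs_mul] at hz1
        have := abs_sub_abs_le_abs_sub x z
        nlinarith
      have h3 := h.mul_deriv_bound z
      rw [abs_mul] at h3
      rw [Real.norm_eq_abs, le_div_iff₀ hx']
      nlinarith [abs_nonneg (deriv f z)]

lemma of_hasCompactSupport (hf : ContDiff ℝ (⊤ : ℕ∞) f) (hc : HasCompactSupport f) :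
    ∃ C, IsTame f C := by
  have hf1 : ContDiff ℝ (⊤ : ℕ∞) (deriv f) := ((contDiff_infty_iff_deriv).1 hf).2
  have hf2 : Continuous (deriv (deriv f)) := ((contDiff_infty_iff_deriv).1 hf1).2.continuous
  have key : ∀ g : ℝ → ℝ, Continuous g → HasCompactSupport g → ∃ C, ∀ x, |g x| ≤ C :=
    fun g hg hgc => hgc.exists_bound_of_continuous hg
  obtain ⟨C0, h0⟩ := key f hf.continuous hc
  obtain ⟨C1, h1⟩ := key _ hf1.continuous hc.deriv
  have hc1 : HasCompactSupport (deriv f) := hc.deriv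
  have hc2 : HasCompactSupport (deriv (deriv f)) := hc1.deriv
  have hc3 : HasCompactSupport (fun x => x * deriv f x) := hc1.mul_left (f := fun x => x)
  have hc4 : HasCompactSupport (fun x => x ^ 2 * deriv (deriv f) x) :=
    hc2.mul_left (f := fun x => x ^ 2)
  have hf1c := hf1.continuous
  have hf3 : Continuous (fun x => x * deriv f x) := by fun_prop
  have hf4 : Continuous (fun x => x ^ 2 * deriv (deriv f) x) := by fun_prop
  obtain ⟨C2, h2⟩ := key (deriv (deriv f)) hf2 hc2
  obtain ⟨C3, h3⟩ := key (fun x => x * deriv f x) hf3 hc3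
  obtain ⟨C4, h4⟩ := key (fun x => x ^ 2 * deriv (deriv f) x) hf4 hc4
  let C := max C0 (max C1 (max C2 (max C3 C4)))
  have e0 : C0 ≤ C := le_max_left _ _
  have e1 : C1 ≤ C := (le_max_left _ _).trans (le_max_right _ _)
  have e2 : C2 ≤ C := (le_max_left _ _).trans ((le_max_right _ _).trans (le_max_right _ _))
  have e3 : max C3 C4 ≤ C :=
    (le_max_right _ _).trans ((le_max_right _ _).trans (le_max_right _ _))
  exact ⟨C, { contDiff := hf
              bound := fun x => (h0 x).trans e0
              deriv_bound := fun x => (h1 x).trans e1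
              deriv2_bound := fun x => (h2 x).trans e2
              mul_deriv_bound := fun x => (h3 x).trans ((le_max_left _ _).trans e3)
              mul_deriv2_bound := fun x => (h4 x).trans ((le_max_right _ _).trans e3) }⟩

end IsTame

/-- The generator with uncompensated jumps. -/
def fvGen (ση2 γη0 σU2 γU0 : ℝ) (νη νU : Measure ℝ) (f : ℝ → ℝ) (x : ℝ) : ℝ :=
  (γη0 + γU0 * x) * deriv f x + (ση2 / 2 + σU2 / 2 * x ^ 2) * deriv (deriv f) x
    + (∫ y, (f (x + y) - f x) ∂νη) + ∫ y, (f (x + x * y) - f x) ∂νU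

lemma IsFVLevy.integrable_add_sub {ν : Measure ℝ} (hν : IsFVLevy ν) {f : ℝ → ℝ} {C : ℝ}
    (h : IsTame f C) (x : ℝ) : Integrable (fun y => f (x + y) - f x) ν :=
  hν.integrable_of_le (by have := h.continuous; fun_prop) (4 * C) (h.abs_add_sub_le x)

lemma IsFVLevy.integrable_mul_sub {ν : Measure ℝ} (hν : IsFVLevy ν) {f : ℝ → ℝ} {C : ℝ}
    (h : IsTame f C) (x : ℝ) : Integrable (fun y => f (x + x * y) - f x) ν :=
  hν.integrable_of_le (by have := h.continuous; fun_prop) (4 * C) (h.abs_mul_sub_le x)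

lemma IsFVLevy.integrable_indicator {ν : Measure ℝ} (hν : IsFVLevy ν) :
    Integrable (fun y : ℝ => if |y| ≤ 1 then y else 0) ν :=
  hν.integrable_of_le (Measurable.aestronglyMeasurable
    (Measurable.ite (measurableSet_le (by fun_prop) (by fun_prop)) measurable_id measurable_const))
    1 fun y => by
    split_ifs with hy
    · simp [hy]
    · simp

lemma integral_indicator_abs_le (ν : Measure ℝ) :
    ∫ y : ℝ, (if |y| ≤ 1 then y else 0) ∂ν = ∫ y in Icc (-1 : ℝ) 1, y ∂ν := by
  rw [← MeasureTheory.integral_indicator measurableSet_Icc]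
  congr 1 with y
  simp [indicator, abs_le]

lemma levyGen_eq_fvGen {ση2 γη σU2 γU γη0 γU0 : ℝ} {νη νU : Measure ℝ}
    (hη : IsFVLevy νη) (hU : IsFVLevy νU) (hconc : νU (Iio (-1 : ℝ)) = 0)
    (hγη0 : γη0 = γη - ∫ y in Icc (-1 : ℝ) 1, y ∂νη)
    (hγU0 : γU0 = γU - ∫ y in Icc (-1 : ℝ) 1, y ∂νU) {f : ℝ → ℝ} {C : ℝ} (h : IsTame f C) (x : ℝ) :
    levyGen ση2 γη σU2 γU νη νU f x = fvGen ση2 γη0 σU2 γU0 νη νU f x := by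
  have e1 : ∫ y, (f (x + y) - f x - (if |y| ≤ 1 then y * deriv f x else 0)) ∂νη
      = (∫ y, (f (x + y) - f x) ∂νη) - (∫ y in Icc (-1 : ℝ) 1, y ∂νη) * deriv f x := by
    rw [← integral_indicator_abs_le, ← integral_mul_const,
      ← integral_sub (hη.integrable_add_sub h x) (hη.integrable_indicator.mul_const _)]
    simp only [ite_mul, zero_mul]
  have e2 : ∫ y in Ici (-1 : ℝ),
        (f (x + x * y) - f x - (if |y| ≤ 1 then x * y * deriv f x else 0)) ∂νU
      = (∫ y, (f (x + x * y) - f x) ∂νU) - (∫ y in Icc (-1 : ℝ) 1, y ∂νU) * (x * deriv f x) := by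
    rw [Measure.restrict_eq_self_of_ae_mem, ← integral_indicator_abs_le, ← integral_mul_const,
      ← integral_sub (hU.integrable_mul_sub h x) (hU.integrable_indicator.mul_const _)]
    · congr 1 with y
      split_ifs <;> ring
    · rw [ae_iff]
      simpa [Iio_def] using hconc
  rw [levyGen, fvGen, e1, e2, hγη0, hγU0]
  ring

/-- A bound for `|fvGen f|` when `IsTame f C`, up to the factor `C`. -/
def genConst (ση2 γη0 σU2 γU0 : ℝ) (νη νU : Measure ℝ) : ℝ :=
  |γη0| + |γU0| + |ση2| / 2 + |σU2| / 2 + 4 * (∫ y, min 1 |y| ∂νη) + 4 * ∫ y, min 1 |y| ∂νU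

section
variable {ση2 γη0 σU2 γU0 : ℝ} {νη νU : Measure ℝ}

lemma abs_fvGen_le (hη : IsFVLevy νη) (hU : IsFVLevy νU) {f : ℝ → ℝ} {C : ℝ} (h : IsTame f C)
    (x : ℝ) :
    |fvGen ση2 γη0 σU2 γU0 νη νU f x| ≤ genConst ση2 γη0 σU2 γU0 νη νU * C := by
  have hI := hη.abs_integral_le _ (h.abs_add_sub_le x)
  have hJ := hU.abs_integral_le _ (h.abs_mul_sub_le x)
  have h1 : |(γη0 + γU0 * x) * deriv f x| ≤ |γη0| * C + |γU0| * C := by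
    rw [show (γη0 + γU0 * x) * deriv f x = γη0 * deriv f x + γU0 * (x * deriv f x) by ring]
    refine (abs_add_le _ _).trans (add_le_add ?_ ?_) <;> rw [abs_mul]
    · exact mul_le_mul_of_nonneg_left (h.deriv_bound x) (abs_nonneg _)
    · exact mul_le_mul_of_nonneg_left (h.mul_deriv_bound x) (abs_nonneg _)
  have h2 : |(ση2 / 2 + σU2 / 2 * x ^ 2) * deriv (deriv f) x|
      ≤ |ση2| / 2 * C + |σU2| / 2 * C := by
    rw [show (ση2 / 2 + σU2 / 2 * x ^ 2) * deriv (deriv f) x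
      = ση2 / 2 * deriv (deriv f) x + σU2 / 2 * (x ^ 2 * deriv (deriv f) x) by ring]
    refine (abs_add_le _ _).trans (add_le_add ?_ ?_) <;> rw [abs_mul, abs_div, abs_two]
    · exact mul_le_mul_of_nonneg_left (h.deriv2_bound x) (by positivity)
    · exact mul_le_mul_of_nonneg_left (h.mul_deriv2_bound x) (by positivity)
  rw [fvGen, genConst]
  refine (abs_add_le _ _).trans ((add_le_add_left (abs_add_le _ _) _).trans
    ((add_le_add_left (add_le_add_left (abs_add_le _ _) _) _).trans ?_))
  linarith

lemma measurable_integral_add_sub [SFinite νη] {f : ℝ → ℝ} (hf : Continuous f) :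
    StronglyMeasurable fun x => ∫ y, (f (x + y) - f x) ∂νη :=
  StronglyMeasurable.integral_prod_right
    (f := fun x y => f (x + y) - f x) (Continuous.stronglyMeasurable (by fun_prop))

lemma measurable_integral_mul_sub [SFinite νU] {f : ℝ → ℝ} (hf : Continuous f) :
    StronglyMeasurable fun x => ∫ y, (f (x + x * y) - f x) ∂νU :=
  StronglyMeasurable.integral_prod_right
    (f := fun x y => f (x + x * y) - f x) (Continuous.stronglyMeasurable (by fun_prop))

lemma measurable_fvGen (hη : IsFVLevy νη) (hU : IsFVLevy νU) {f : ℝ → ℝ} {C : ℝ}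
    (h : IsTame f C) : StronglyMeasurable (fvGen ση2 γη0 σU2 γU0 νη νU f) := by
  have := hη.sigmaFinite
  have := hU.sigmaFinite
  have h1 := h.continuous_deriv
  have h2 := h.continuous_deriv2
  exact ((Continuous.stronglyMeasurable (by fun_prop)).add
    (measurable_integral_add_sub h.continuous)).add (measurable_integral_mul_sub h.continuous)

end

lemma IsTame.mul {f g : ℝ → ℝ} {C D : ℝ} (hf : IsTame f C) (hg : IsTame g D) :
    IsTame (fun x => f x * g x) (4 * C * D) := by
  have hC := hf.nonneg
  have hD := hg.nonneg
  have hCD : 0 ≤ C * D := mul_nonneg hC hD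
  have hd : deriv (fun x => f x * g x) = fun x => deriv f x * g x + f x * deriv g x := by
    funext x
    exact deriv_fun_mul (hf.differentiable x) (hg.differentiable x)
  have df := hf.contDiff_deriv.differentiable (by simp)
  have dg := hg.contDiff_deriv.differentiable (by simp)
  have hd2 : deriv (deriv fun x => f x * g x) = fun x => deriv (deriv f) x * g x
      + 2 * (deriv f x * deriv g x) + f x * deriv (deriv g) x := by
    rw [hd]
    funext x
    have e := (((df x).hasDerivAt.mul (hg.differentiable x).hasDerivAt).add
      ((hf.differentiable x).hasDerivAt.mul (dg x).hasDerivAt)).deriv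
    refine Eq.trans e ?_
    ring
  have key : ∀ a b : ℝ, |a| ≤ C → |b| ≤ D → |a * b| ≤ C * D := fun a b ha hb => by
    rw [abs_mul]; exact mul_le_mul ha hb (abs_nonneg _) hC
  refine ⟨hf.contDiff.mul hg.contDiff, fun x => ?_, fun x => ?_, fun x => ?_, fun x => ?_,
    fun x => ?_⟩
  · linarith [key _ _ (hf.bound x) (hg.bound x)]
  · rw [hd]
    have h1 := key _ _ (hf.deriv_bound x) (hg.bound x)
    have h2 := key _ _ (hf.bound x) (hg.deriv_bound x)
    exact (abs_add_le _ _).trans (by linarith)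
  · rw [hd2]
    have h1 := key _ _ (hf.deriv2_bound x) (hg.bound x)
    have h2 := key _ _ (hf.bound x) (hg.deriv2_bound x)
    have h3 := key _ _ (hf.deriv_bound x) (hg.deriv_bound x)
    refine (abs_add_le _ _).trans ((add_le_add_left (abs_add_le _ _) _).trans ?_)
    rw [abs_mul 2, abs_two]
    linarith
  · rw [hd]
    have h1 := key _ _ (hf.mul_deriv_bound x) (hg.bound x)
    have h2 := key _ _ (hf.bound x) (hg.mul_deriv_bound x)
    simp only
    rw [show x * (deriv f x * g x + f x * deriv g x)
      = (x * deriv f x) * g x + f x * (x * deriv g x) by ring]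
    exact (abs_add_le _ _).trans (by linarith)
  · rw [hd2]
    have h1 := key _ _ (hf.mul_deriv2_bound x) (hg.bound x)
    have h2 := key _ _ (hf.bound x) (hg.mul_deriv2_bound x)
    have h3 := key _ _ (hf.mul_deriv_bound x) (hg.mul_deriv_bound x)
    simp only
    rw [show x ^ 2 * (deriv (deriv f) x * g x + 2 * (deriv f x * deriv g x)
        + f x * deriv (deriv g) x)
      = (x ^ 2 * deriv (deriv f) x) * g x + 2 * ((x * deriv f x) * (x * deriv g x))
        + f x * (x ^ 2 * deriv (deriv g) x) by ring]
    refine (abs_add_le _ _).trans ((add_le_add_left (abs_add_le _ _) _).trans ?_)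
    rw [abs_mul 2, abs_two]
    linarith

lemma IsTame.comp_mul_left {g : ℝ → ℝ} {D : ℝ} (hg : IsTame g D) {k : ℝ} (hk0 : 0 < k)
    (hk1 : k ≤ 1) : IsTame (fun x => g (k * x)) D := by
  have hd : ∀ h : ℝ → ℝ, deriv (fun x => h (k * x)) = fun x => k * deriv h (k * x) := fun h => by
    funext x
    simpa using deriv_comp_mul_left k h x
  have hd2 : deriv (deriv fun x => g (k * x)) = fun x => k ^ 2 * deriv (deriv g) (k * x) := by
    rw [hd]
    funext x
    rw [deriv_const_mul_field', hd]
    simp only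
    ring
  have hk := abs_of_pos hk0
  refine ⟨hg.contDiff.comp (by fun_prop), fun x => hg.bound _, fun x => ?_, fun x => ?_,
    fun x => ?_, fun x => ?_⟩
  · rw [hd, abs_mul, hk]
    nlinarith [hg.deriv_bound (k * x), abs_nonneg (deriv g (k * x))]
  · rw [hd2, abs_mul, abs_of_nonneg (by positivity)]
    have : k ^ 2 ≤ 1 := pow_le_one₀ hk0.le hk1
    nlinarith [hg.deriv2_bound (k * x), abs_nonneg (deriv (deriv g) (k * x))]
  · rw [hd]
    convert hg.mul_deriv_bound (k * x) using 2
    ring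
  · rw [hd2]
    convert hg.mul_deriv2_bound (k * x) using 2
    ring

section
variable {ση2 γη0 σU2 γU0 : ℝ} {νη νU μ : Measure ℝ} [IsProbabilityMeasure μ]

lemma integrable_fvGen (hη : IsFVLevy νη) (hU : IsFVLevy νU) {f : ℝ → ℝ} {C : ℝ}
    (h : IsTame f C) : Integrable (fvGen ση2 γη0 σU2 γU0 νη νU f) μ :=
  Integrable.of_bound (measurable_fvGen hη hU h).aestronglyMeasurable _
    (ae_of_all _ (abs_fvGen_le hη hU h))

lemma tendsto_fvGen (hη : IsFVLevy νη) (hU : IsFVLevy νU) {F : ℕ → ℝ → ℝ} {f : ℝ → ℝ} {C : ℝ}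
    (hF : ∀ n, IsTame (F n) C) (hlim : ∀ x, ∀ᶠ n in atTop, F n =ᶠ[𝓝 x] f) (x : ℝ) :
    Tendsto (fun n => fvGen ση2 γη0 σU2 γU0 νη νU (F n) x) atTop
      (𝓝 (fvGen ση2 γη0 σU2 γU0 νη νU f x)) := by
  have hpt : ∀ x, Tendsto (fun n => F n x) atTop (𝓝 (f x)) := fun x =>
    tendsto_const_nhds.congr' ((hlim x).mono fun n hn => hn.eq_of_nhds.symm)
  have h1 : Tendsto (fun n => deriv (F n) x) atTop (𝓝 (deriv f x)) :=
    tendsto_const_nhds.congr' ((hlim x).mono fun n hn => hn.deriv_eq.symm)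
  have h2 : Tendsto (fun n => deriv (deriv (F n)) x) atTop (𝓝 (deriv (deriv f) x)) :=
    tendsto_const_nhds.congr' ((hlim x).mono fun n hn => hn.deriv.deriv_eq.symm)
  refine (((h1.const_mul _).add (h2.const_mul _)).add ?_).add ?_
  · refine tendsto_integral_of_dominated_convergence (fun y => 4 * C * min 1 |y|)
      (fun n => (hη.integrable_add_sub (hF n) x).aestronglyMeasurable)
      (hη.integrable.const_mul _) (fun n => ae_of_all _ ((hF n).abs_add_sub_le x))
      (ae_of_all _ fun y => (hpt _).sub (hpt _))
  · refine tendsto_integral_of_dominated_convergence (fun y => 4 * C * min 1 |y|)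
      (fun n => (hU.integrable_mul_sub (hF n) x).aestronglyMeasurable)
      (hU.integrable.const_mul _) (fun n => ae_of_all _ ((hF n).abs_mul_sub_le x))
      (ae_of_all _ fun y => (hpt _).sub (hpt _))

/-- Invariance extends from test functions to all tame functions. -/
lemma integral_fvGen_eq_zero (hη : IsFVLevy νη) (hU : IsFVLevy νU)
    (hinv : ∀ f : ℝ → ℝ, ContDiff ℝ (⊤ : ℕ∞) f → HasCompactSupport f →
      ∫ x, fvGen ση2 γη0 σU2 γU0 νη νU f x ∂μ = 0)
    {f : ℝ → ℝ} {C : ℝ} (h : IsTame f C) :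
    ∫ x, fvGen ση2 γη0 σU2 γU0 νη νU f x ∂μ = 0 := by
  let χ : ContDiffBump (0 : ℝ) := ⟨1, 2, one_pos, one_lt_two⟩
  obtain ⟨D, hD⟩ := IsTame.of_hasCompactSupport χ.contDiff χ.hasCompactSupport
  let F : ℕ → ℝ → ℝ := fun n x => f x * χ (1 / ((n : ℝ) + 1) * x)
  have hk : ∀ n : ℕ, 0 < 1 / ((n : ℝ) + 1) := fun n => by positivity
  have hF : ∀ n, IsTame (F n) (4 * C * D) := fun n => h.mul (hD.comp_mul_left (hk n) (by
    rw [div_le_one (by positivity)]; linarith [n.cast_nonneg (α := ℝ)]))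
  have hlim : ∀ x, ∀ᶠ n in atTop, F n =ᶠ[𝓝 x] f := fun x => by
    obtain ⟨N, hN⟩ := exists_nat_gt (|x| + 1)
    filter_upwards [eventually_ge_atTop N] with n hn
    filter_upwards [Metric.ball_mem_nhds x one_pos] with y hy
    have hNn : (N : ℝ) ≤ n := by exact_mod_cast hn
    have hy' : |y| ≤ (n : ℝ) + 1 := by
      rw [Metric.mem_ball, Real.dist_eq] at hy
      linarith [abs_sub_abs_le_abs_sub y x]
    have : χ (1 / ((n : ℝ) + 1) * y) = 1 := χ.one_of_mem_closedBall (by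
      rw [mem_closedBall_zero_iff, Real.norm_eq_abs, abs_mul, abs_of_pos (hk n)]
      change _ ≤ (1 : ℝ)
      rw [one_div, inv_mul_le_iff₀ (by positivity)]
      linarith)
    simp only [F, this, mul_one]
  have hz : ∀ n, ∫ x, fvGen ση2 γη0 σU2 γU0 νη νU (F n) x ∂μ = 0 := fun n =>
    hinv _ (hF n).contDiff (HasCompactSupport.mul_left
      (χ.hasCompactSupport.comp_homeomorph (Homeomorph.mulLeft₀ _ (hk n).ne')))
  have := tendsto_integral_of_dominated_convergence (μ := μ)
    (F := fun n => fvGen ση2 γη0 σU2 γU0 νη νU (F n)) (f := fvGen ση2 γη0 σU2 γU0 νη νU f)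
    (fun _ => genConst ση2 γη0 σU2 γU0 νη νU * (4 * C * D))
    (fun n => (measurable_fvGen hη hU (hF n)).aestronglyMeasurable) (integrable_const _)
    (fun n => ae_of_all _ (abs_fvGen_le hη hU (hF n)))
    (ae_of_all _ (tendsto_fvGen hη hU hF hlim))
  simp only [hz] at this
  exact (tendsto_nhds_unique this tendsto_const_nhds)

end

/-- The signed indicator that a jump from `x` to `j` crosses the level `z`. -/
def crossing (x j z : ℝ) : ℝ :=
  if x < z ∧ z < j then 1 else if j < z ∧ z < x then -1 else 0

lemma measurable_crossing : Measurable fun p : ℝ × ℝ × ℝ => crossing p.1 p.2.1 p.2.2 := by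
  refine Measurable.ite ?_ measurable_const (Measurable.ite ?_ measurable_const measurable_const)
  · exact (measurableSet_lt measurable_fst measurable_snd.snd).inter
      (measurableSet_lt measurable_snd.snd measurable_snd.fst)
  · exact (measurableSet_lt measurable_snd.fst measurable_snd.snd).inter
      (measurableSet_lt measurable_snd.snd measurable_fst)

lemma abs_crossing_eq (x j z : ℝ) :
    |crossing x j z| = (Ioo (min x j) (max x j)).indicator (fun _ => (1 : ℝ)) z := by
  unfold crossing
  by_cases h1 : x < z ∧ z < j
  · have : z ∈ Ioo (min x j) (max x j) := ⟨(min_le_left _ _).trans_lt h1.1,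
      h1.2.trans_le (le_max_right _ _)⟩
    rw [if_pos h1, indicator_of_mem this, abs_one]
  · by_cases h2 : j < z ∧ z < x
    · have : z ∈ Ioo (min x j) (max x j) := ⟨(min_le_right _ _).trans_lt h2.1,
        h2.2.trans_le (le_max_left _ _)⟩
      rw [if_neg h1, if_pos h2, indicator_of_mem this, abs_neg, abs_one]
    · have : z ∉ Ioo (min x j) (max x j) := fun hz => by
        rcases le_total x j with h | h
        · rw [min_eq_left h, max_eq_right h] at hz; exact h1 hz
        · rw [min_eq_right h, max_eq_left h] at hz; exact h2 hz
      rw [if_neg h1, if_neg h2, indicator_of_notMem this, abs_zero]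

lemma abs_crossing_le_one (x j z : ℝ) : |crossing x j z| ≤ 1 := by
  rw [abs_crossing_eq, indicator_apply]
  split_ifs <;> norm_num

lemma sub_eq_integral_crossing {f φ : ℝ → ℝ} (hf : ∀ x, HasDerivAt f (φ x) x) (hφ : Continuous φ)
    (x j : ℝ) : f j - f x = ∫ z, φ z * crossing x j z := by
  have h1 : f j - f x = ∫ z in x..j, φ z :=
    (intervalIntegral.integral_eq_sub_of_hasDerivAt (fun z _ => hf z)
      (hφ.intervalIntegrable _ _)).symm
  rw [h1]
  rcases le_total x j with h | h
  · rw [intervalIntegral.integral_of_le h, integral_Ioc_eq_integral_Ioo,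
      ← integral_indicator measurableSet_Ioo]
    congr 1 with z
    unfold crossing
    by_cases h1 : x < z ∧ z < j
    · rw [if_pos h1, indicator_of_mem (show z ∈ Ioo x j from h1), mul_one]
    · rw [if_neg h1, if_neg (fun h2 => absurd (h2.1.trans h2.2) (not_lt.2 h)),
        indicator_of_notMem (show z ∉ Ioo x j from h1), mul_zero]
  · rw [intervalIntegral.integral_of_ge h, integral_Ioc_eq_integral_Ioo,
      ← integral_indicator measurableSet_Ioo, ← integral_neg]
    congr 1 with z
    unfold crossing
    by_cases h1 : j < z ∧ z < x
    · rw [if_neg (fun h2 => absurd (h2.1.trans h2.2) (not_lt.2 h)), if_pos h1,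
        indicator_of_mem (show z ∈ Ioo j x from h1)]
      ring
    · rw [if_neg (fun h2 => absurd (h2.1.trans h2.2) (not_lt.2 h)), if_neg h1,
        indicator_of_notMem (show z ∉ Ioo j x from h1)]
      ring

/-- A jump map `J` (the process at `x` jumps to `J x y` when the driving process jumps by `y`)
which crosses bounded windows at a rate controlled by `min 1 |y|`. -/
structure IsJump (J : ℝ → ℝ → ℝ) : Prop where
  measurable : Measurable fun p : ℝ × ℝ => J p.1 p.2
  volume_le : ∀ R : ℝ, 1 ≤ R → ∀ x y, volume (Ioo (min x (J x y)) (max x (J x y)) ∩ Icc (-R) R)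
    ≤ ENNReal.ofReal (4 * R * min 1 |y|)

lemma volume_inter_Icc_le (s : Set ℝ) {R : ℝ} :
    volume (s ∩ Icc (-R) R) ≤ ENNReal.ofReal (2 * R) := by
  refine (measure_mono inter_subset_right).trans ?_
  rw [Real.volume_Icc]
  exact ENNReal.ofReal_le_ofReal (by linarith)

lemma volume_Ioo_min_max (x j : ℝ) : volume (Ioo (min x j) (max x j)) = ENNReal.ofReal |j - x| := by
  rw [Real.volume_Ioo, max_sub_min_eq_abs]

lemma isJump_add : IsJump fun x y => x + y := by
  refine ⟨by fun_prop, fun R hR x y => ?_⟩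
  have h0 := abs_nonneg y
  rcases le_total 1 |y| with hy | hy
  · refine (volume_inter_Icc_le _).trans (ENNReal.ofReal_le_ofReal ?_)
    rw [min_eq_left hy]; linarith
  · refine (measure_mono inter_subset_left).trans ?_
    rw [volume_Ioo_min_max, min_eq_right hy, add_sub_cancel_left]
    exact ENNReal.ofReal_le_ofReal (by nlinarith)

lemma isJump_mul : IsJump fun x y => x + x * y := by
  refine ⟨by fun_prop, fun R hR x y => ?_⟩
  have h0 := abs_nonneg y
  rcases le_total (1 / 2) |y| with hy | hy
  · refine (volume_inter_Icc_le _).trans (ENNReal.ofReal_le_ofReal ?_)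
    have : 1 / 2 ≤ min 1 |y| := le_min (by norm_num) hy
    nlinarith
  · have hmin : min 1 |y| = |y| := min_eq_right (by linarith)
    rw [hmin]
    rcases (Ioo (min x (x + x * y)) (max x (x + x * y)) ∩ Icc (-R) R).eq_empty_or_nonempty
      with h | ⟨z, hz1, hz2⟩
    · simp [h]
    have hz3 : z ∈ uIcc x (x + x * y) := Ioo_subset_Icc_self hz1
    have hz4 : |x - z| ≤ |x| * |y| := by
      have := abs_sub_left_of_mem_uIcc hz3
      rw [abs_sub_comm] at this
      simpa [abs_mul] using this
    have hz5 : |z| ≤ R := abs_le.2 hz2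
    have hx : |x| ≤ 2 * R := by nlinarith [abs_sub_abs_le_abs_sub x z, abs_nonneg x]
    refine (measure_mono inter_subset_left).trans ?_
    rw [volume_Ioo_min_max, add_sub_cancel_left, abs_mul]
    exact ENNReal.ofReal_le_ofReal (by nlinarith)

/-- The signed rate at which the jump part moves a particle at `x` across the level `z`. -/
def fluxKernel (J : ℝ → ℝ → ℝ) (ν : Measure ℝ) (z x : ℝ) : ℝ := ∫ y, crossing x (J x y) z ∂ν

/-- The total jump flux of `μ` across the level `z`. -/
def flux (J : ℝ → ℝ → ℝ) (ν μ : Measure ℝ) (z : ℝ) : ℝ := ∫ x, fluxKernel J ν z x ∂μ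

section
variable {J : ℝ → ℝ → ℝ} {ν μ : Measure ℝ} [IsFiniteMeasure μ]

lemma IsJump.measurable_crossing (hJ : IsJump J) :
    Measurable fun p : (ℝ × ℝ) × ℝ => crossing p.1.1 (J p.1.1 p.1.2) p.2 := by
  have := hJ.measurable
  exact KEF.measurable_crossing.comp
    (g := fun p : ℝ × ℝ × ℝ => crossing p.1 p.2.1 p.2.2)
    (f := fun p : (ℝ × ℝ) × ℝ => (p.1.1, J p.1.1 p.1.2, p.2))
    (by fun_prop)

lemma IsJump.integrable_crossing (hJ : IsJump J) (hν : IsFVLevy ν) {R : ℝ} (hR : 1 ≤ R) :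
    Integrable (fun p : (ℝ × ℝ) × ℝ => crossing p.1.1 (J p.1.1 p.1.2) p.2)
      ((μ.prod ν).prod (volume.restrict (Icc (-R) R))) := by
  have := hν.sigmaFinite
  refine (integrable_prod_iff hJ.measurable_crossing.aestronglyMeasurable).2
    ⟨ae_of_all _ fun p => ?_, ?_⟩
  · refine Integrable.of_bound (Measurable.aestronglyMeasurable
      (hJ.measurable_crossing.comp measurable_prodMk_left)) 1
      (ae_of_all _ fun z => abs_crossing_le_one _ _ _)
  · have hint : Integrable (fun p : ℝ × ℝ => 4 * R * min 1 |p.2|) (μ.prod ν) :=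
      (hν.integrable.const_mul (4 * R)).comp_snd μ
    refine hint.mono' ?_ (ae_of_all _ fun p => ?_)
    · exact (StronglyMeasurable.integral_prod_right
        (f := fun (p : ℝ × ℝ) z => ‖crossing p.1 (J p.1 p.2) z‖)
        hJ.measurable_crossing.norm.stronglyMeasurable).aestronglyMeasurable
    · have hR0 : 0 ≤ 4 * R * min 1 |p.2| := by positivity
      simp only [Real.norm_eq_abs, abs_crossing_eq]
      rw [integral_indicator_const _ measurableSet_Ioo, smul_eq_mul, mul_one, abs_of_nonneg measureReal_nonneg,
        measureReal_restrict_apply measurableSet_Ioo]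
      exact ENNReal.toReal_le_of_le_ofReal hR0 (hJ.volume_le R hR p.1 p.2)

lemma IsJump.ae_integral_crossing (hJ : IsJump J) (hν : IsFVLevy ν) {R : ℝ} (hR : 1 ≤ R) :
    ∀ᵐ z ∂volume.restrict (Icc (-R) R),
      ∫ p, crossing p.1 (J p.1 p.2) z ∂(μ.prod ν) = flux J ν μ z := by
  have := hν.sigmaFinite
  filter_upwards [(hJ.integrable_crossing (μ := μ) hν hR).prod_left_ae] with z hz
  exact integral_prod _ hz

lemma IsJump.integrableOn_flux (hJ : IsJump J) (hν : IsFVLevy ν) {R : ℝ} (hR : 1 ≤ R) :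
    IntegrableOn (flux J ν μ) (Icc (-R) R) := by
  have := hν.sigmaFinite
  exact (hJ.integrable_crossing (μ := μ) hν hR).integral_prod_right.congr
    (hJ.ae_integral_crossing hν hR)

lemma IsJump.locallyIntegrable_flux (hJ : IsJump J) (hν : IsFVLevy ν) :
    LocallyIntegrable (flux J ν μ) := by
  intro x
  refine ⟨Icc (-(|x| + 1)) (|x| + 1), Icc_mem_nhds ?_ ?_,
    hJ.integrableOn_flux hν (by linarith [abs_nonneg x])⟩
  · linarith [neg_abs_le x]
  · linarith [le_abs_self x]

lemma IsJump.integral_jump_eq (hJ : IsJump J) (hν : IsFVLevy ν) {f φ : ℝ → ℝ}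
    (hf : ∀ x, HasDerivAt f (φ x) x) (hφ : Continuous φ) (hc : HasCompactSupport φ) :
    Integrable (fun x => ∫ y, (f (J x y) - f x) ∂ν) μ ∧
    ∫ x, ∫ y, (f (J x y) - f x) ∂ν ∂μ = ∫ z, φ z * flux J ν μ z := by
  have := hν.sigmaFinite
  obtain ⟨R0, hR0⟩ := hc.isCompact.isBounded.subset_closedBall 0
  obtain ⟨C, hC⟩ := hc.exists_bound_of_continuous hφ
  let R := max 1 R0
  have hR : 1 ≤ R := le_max_left _ _
  have hsupp : ∀ z, z ∉ Icc (-R) R → φ z = 0 := fun z hz => by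
    by_contra h
    have := hR0 (subset_tsupport φ h)
    rw [mem_closedBall_zero_iff, Real.norm_eq_abs] at this
    exact hz (abs_le.1 (this.trans (le_max_right _ _)))
  have hset : ∀ g : ℝ → ℝ, ∫ z in Icc (-R) R, φ z * g z = ∫ z, φ z * g z := fun g =>
    setIntegral_eq_integral_of_forall_compl_eq_zero fun z hz => by rw [hsupp z hz, zero_mul]
  have hint : Integrable (fun p : (ℝ × ℝ) × ℝ => φ p.2 * crossing p.1.1 (J p.1.1 p.1.2) p.2)
      ((μ.prod ν).prod (volume.restrict (Icc (-R) R))) :=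
    (hJ.integrable_crossing hν hR).bdd_mul (c := C)
      (hφ.comp continuous_snd).aestronglyMeasurable (ae_of_all _ fun p => hC p.2)
  have hinner : ∀ p : ℝ × ℝ, ∫ z in Icc (-R) R, φ z * crossing p.1 (J p.1 p.2) z
      = f (J p.1 p.2) - f p.1 := fun p => by
    rw [hset, sub_eq_integral_crossing hf hφ]
  have hint2 : Integrable (fun p : ℝ × ℝ => f (J p.1 p.2) - f p.1) (μ.prod ν) :=
    hint.integral_prod_left.congr (ae_of_all _ hinner)
  refine ⟨hint2.integral_prod_left, ?_⟩
  rw [← integral_prod _ hint2, ← hset, ← integral_congr_ae (ae_of_all _ hinner),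
    integral_integral_swap hint]
  refine integral_congr_ae ?_
  filter_upwards [hJ.ae_integral_crossing (μ := μ) hν hR] with z hz
  rw [integral_const_mul, hz]

end

/-- An antiderivative of a test function is tame. -/
lemma IsTame.exists_antideriv {φ : ℝ → ℝ} (hφ : ContDiff ℝ (⊤ : ℕ∞) φ) (hc : HasCompactSupport φ) :
    ∃ f C, IsTame f C ∧ ∀ x, HasDerivAt f (φ x) x := by
  have hφ' : ContDiff ℝ (⊤ : ℕ∞) (deriv φ) := ((contDiff_infty_iff_deriv).1 hφ).2
  have hc' : HasCompactSupport (deriv φ) := hc.deriv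
  have hd : ∀ x, HasDerivAt (fun x => ∫ t in (0 : ℝ)..x, φ t) (φ x) x := fun x =>
    (hφ.continuous.integral_hasStrictDerivAt 0 x).hasDerivAt
  have hderiv : deriv (fun x => ∫ t in (0 : ℝ)..x, φ t) = φ := funext fun x => (hd x).deriv
  obtain ⟨C1, h1⟩ := hc.exists_bound_of_continuous hφ.continuous
  obtain ⟨C2, h2⟩ := hc'.exists_bound_of_continuous hφ'.continuous
  obtain ⟨C3, h3⟩ := (hc.mul_left (f := fun x : ℝ => x)).exists_bound_of_continuous
    (continuous_id.mul hφ.continuous)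
  obtain ⟨C4, h4⟩ := (hc'.mul_left (f := fun x : ℝ => x ^ 2)).exists_bound_of_continuous
    ((continuous_pow 2).mul hφ'.continuous)
  have hint : Integrable (fun x => ‖φ x‖) := (hφ.continuous.integrable_of_hasCompactSupport hc).norm
  refine ⟨_, max (∫ x, ‖φ x‖) (max (max C1 C2) (max C3 C4)), ⟨?_, fun x => ?_, fun x => ?_,
    fun x => ?_, fun x => ?_, fun x => ?_⟩, hd⟩
  · exact contDiff_infty_iff_deriv.2 ⟨fun x => (hd x).differentiableAt, by rw [hderiv]; exact hφ⟩
  · refine le_max_of_le_left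
      ((intervalIntegral.norm_integral_le_integral_norm_uIoc (f := φ) (a := 0) (b := x)).trans ?_)
    exact setIntegral_le_integral hint (ae_of_all _ fun x => norm_nonneg _)
  · rw [hderiv]
    exact le_max_of_le_right (le_max_of_le_left (le_max_of_le_left (h1 x)))
  · rw [hderiv]
    exact le_max_of_le_right (le_max_of_le_left (le_max_of_le_right (h2 x)))
  · rw [hderiv]
    exact le_max_of_le_right (le_max_of_le_right (le_max_of_le_left (h3 x)))
  · rw [hderiv]
    exact le_max_of_le_right (le_max_of_le_right (le_max_of_le_right (h4 x)))

/-- Invariance of `μ` for the generator with jump measures of finite variation. -/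
structure IsFVInvariant (ση2 γη0 σU2 γU0 : ℝ) (νη νU μ : Measure ℝ) : Prop where
  ση_nonneg : 0 ≤ ση2
  σU_nonneg : 0 ≤ σU2
  levyη : IsFVLevy νη
  levyU : IsFVLevy νU
  conc : νU (Iio (-1 : ℝ)) = 0
  inv : ∀ f : ℝ → ℝ, ContDiff ℝ (⊤ : ℕ∞) f → HasCompactSupport f →
      ∫ x, fvGen ση2 γη0 σU2 γU0 νη νU f x ∂μ = 0

/-- The jump flux of both driving processes. -/
def jumpFlux (νη νU μ : Measure ℝ) (z : ℝ) : ℝ :=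
  flux (fun x y => x + y) νη μ z + flux (fun x y => x + x * y) νU μ z

/-- The diffusion coefficient. -/
def diffCoef (ση2 σU2 : ℝ) (x : ℝ) : ℝ := ση2 / 2 + σU2 / 2 * x ^ 2

/-- The drift coefficient. -/
def driftCoef (γη0 γU0 : ℝ) (x : ℝ) : ℝ := γη0 + γU0 * x

lemma continuous_diffCoef (a b : ℝ) : Continuous (diffCoef a b) := by
  unfold diffCoef; fun_prop

lemma continuous_driftCoef (a b : ℝ) : Continuous (driftCoef a b) := by
  unfold driftCoef; fun_prop

section
variable {ση2 γη0 σU2 γU0 : ℝ} {νη νU μ : Measure ℝ} [IsProbabilityMeasure μ]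

lemma IsFVInvariant.locallyIntegrable_jumpFlux
    (h : IsFVInvariant ση2 γη0 σU2 γU0 νη νU μ) : LocallyIntegrable (jumpFlux νη νU μ) :=
  (isJump_add.locallyIntegrable_flux h.levyη).add (isJump_mul.locallyIntegrable_flux h.levyU)

lemma integrable_mul_of_locallyIntegrable {F φ : ℝ → ℝ} (hF : LocallyIntegrable F)
    (hφ : Continuous φ) (hc : HasCompactSupport φ) : Integrable fun z => φ z * F z := by
  simpa using hF.integrable_smul_left_of_hasCompactSupport hφ hc

/-- The weak form of the stationary equation, integrated once. -/
lemma IsFVInvariant.weak (h : IsFVInvariant ση2 γη0 σU2 γU0 νη νU μ) {φ : ℝ → ℝ}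
    (hφ : ContDiff ℝ (⊤ : ℕ∞) φ) (hc : HasCompactSupport φ) :
    (∫ x, diffCoef ση2 σU2 x * deriv φ x ∂μ) + (∫ x, driftCoef γη0 γU0 x * φ x ∂μ)
      + ∫ z, φ z * jumpFlux νη νU μ z = 0 := by
  obtain ⟨f, C, hf, hd⟩ := IsTame.exists_antideriv hφ hc
  have hderiv : deriv f = φ := funext fun x => (hd x).deriv
  have hφ' : ContDiff ℝ (⊤ : ℕ∞) (deriv φ) := ((contDiff_infty_iff_deriv).1 hφ).2
  obtain ⟨i1, e1⟩ := isJump_add.integral_jump_eq (μ := μ) h.levyη hd hφ.continuous hc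
  obtain ⟨i2, e2⟩ := isJump_mul.integral_jump_eq (μ := μ) h.levyU hd hφ.continuous hc
  have i3 : Integrable (fun x => driftCoef γη0 γU0 x * φ x) μ :=
    ((continuous_driftCoef _ _).mul hφ.continuous).integrable_of_hasCompactSupport hc.mul_left
  have i4 : Integrable (fun x => diffCoef ση2 σU2 x * deriv φ x) μ :=
    ((continuous_diffCoef _ _).mul hφ'.continuous).integrable_of_hasCompactSupport
      hc.deriv.mul_left
  have h0 := integral_fvGen_eq_zero h.levyη h.levyU h.inv hf
  have e3 : ∀ x, fvGen ση2 γη0 σU2 γU0 νη νU f x = driftCoef γη0 γU0 x * φ x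
      + diffCoef ση2 σU2 x * deriv φ x + (∫ y, (f (x + y) - f x) ∂νη)
      + ∫ y, (f (x + x * y) - f x) ∂νU := fun x => by
    simp only [fvGen, hderiv, driftCoef, diffCoef]
  simp only [e3] at h0
  rw [integral_add ((i3.fun_add i4).fun_add i1) i2, integral_add (i3.fun_add i4) i1, integral_add i3 i4,
    e1, e2] at h0
  have e4 : ∫ z, φ z * jumpFlux νη νU μ z = (∫ z, φ z * flux (fun x y => x + y) νη μ z)
      + ∫ z, φ z * flux (fun x y => x + x * y) νU μ z := by
    rw [← integral_add]
    · simp only [jumpFlux, mul_add]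
    · exact integrable_mul_of_locallyIntegrable (isJump_add.locallyIntegrable_flux h.levyη)
        hφ.continuous hc
    · exact integrable_mul_of_locallyIntegrable (isJump_mul.locallyIntegrable_flux h.levyU)
        hφ.continuous hc
  rw [e4]
  linarith

end

lemma fluxKernel_add {ν : Measure ℝ} (z x : ℝ) :
    fluxKernel (fun x y => x + y) ν z x = BmapFV ν (z - x) := by
  unfold fluxKernel BmapFV crossing
  rcases lt_trichotomy x z with hx | hx | hx
  · rw [if_pos (by linarith)]
    have : (fun y => if x < z ∧ z < x + y then (1 : ℝ) else if x + y < z ∧ z < x then -1 else 0)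
        = (Ioi (z - x)).indicator 1 := by
      ext y
      rw [indicator_apply]
      have h1 : ¬(x + y < z ∧ z < x) := fun h => by linarith [h.2]
      have h2 : (x < z ∧ z < x + y) ↔ y ∈ Ioi (z - x) := by
        rw [mem_Ioi]; constructor
        · intro h; linarith [h.2]
        · intro h; exact ⟨hx, by linarith⟩
      simp only [h1, h2, if_false, Pi.one_apply]
    rw [this, integral_indicator_one measurableSet_Ioi]; rfl
  · subst hx
    simp
  · rw [if_neg (by linarith), if_pos (by linarith)]
    have : (fun y => if x < z ∧ z < x + y then (1 : ℝ) else if x + y < z ∧ z < x then -1 else 0)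
        = fun y => -(Iio (z - x)).indicator 1 y := by
      ext y
      rw [indicator_apply]
      have h1 : ¬(x < z ∧ z < x + y) := fun h => by linarith [h.1]
      have h2 : (x + y < z ∧ z < x) ↔ y ∈ Iio (z - x) := by
        rw [mem_Iio]; constructor
        · intro h; linarith [h.1]
        · intro h; exact ⟨by linarith, hx⟩
      simp only [h1, h2, if_false, Pi.one_apply]
      split_ifs <;> simp
    rw [this, integral_neg, integral_indicator_one measurableSet_Iio]; rfl

lemma fluxKernel_mul_zero {ν : Measure ℝ} (z : ℝ) :
    fluxKernel (fun x y => x + x * y) ν z 0 = 0 := by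
  unfold fluxKernel crossing
  have : ∀ y : ℝ, (if 0 < z ∧ z < 0 + 0 * y then (1 : ℝ) else
      if 0 + 0 * y < z ∧ z < 0 then -1 else 0) = 0 := fun y => by
    rw [if_neg (fun h => by linarith [h.1, h.2]), if_neg (fun h => by linarith [h.1, h.2])]
  simp only [this, integral_zero]

lemma crossing_neg (x j z : ℝ) : crossing (-x) (-j) (-z) = -crossing x j z := by
  unfold crossing
  simp only [neg_lt_neg_iff]
  split_ifs <;> first | (exfalso; grind) | simp

lemma fluxKernel_mul_neg {ν : Measure ℝ} (z x : ℝ) :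
    fluxKernel (fun x y => x + x * y) ν (-z) (-x) = -fluxKernel (fun x y => x + x * y) ν z x := by
  unfold fluxKernel
  rw [← integral_neg]
  congr 1 with y
  rw [← crossing_neg]
  congr 1; ring

lemma fluxKernel_mul_pos_pos {ν : Measure ℝ} {z x : ℝ} (hx : 0 < x) (hz : 0 < z) :
    fluxKernel (fun x y => x + x * y) ν z x = BUmapFV ν (z / x) := by
  have hzx : 0 ≤ z / x := by positivity
  unfold fluxKernel BUmapFV crossing
  have k1 : ∀ y, z < x + x * y ↔ z / x - 1 < y := fun y => by
    rw [sub_lt_iff_lt_add, div_lt_iff₀ hx]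
    constructor <;> intro h <;> linarith
  have k2 : ∀ y, x + x * y < z ↔ y < z / x - 1 := fun y => by
    rw [lt_sub_iff_add_lt, lt_div_iff₀ hx]
    constructor <;> intro h <;> linarith
  simp only [k1, k2]
  rcases lt_trichotomy x z with h | h | h
  · have h1 : 1 < z / x := (one_lt_div hx).2 h
    rw [if_neg (fun h => by linarith [h.2]), if_pos h1]
    have : (fun y => if x < z ∧ z / x - 1 < y then (1 : ℝ) else
        if y < z / x - 1 ∧ z < x then -1 else 0) = (Ioi (z / x - 1)).indicator 1 := by
      ext y
      rw [indicator_apply]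
      simp [h, h.not_gt]
    rw [this, integral_indicator_one measurableSet_Ioi]; rfl
  · subst h
    simp [div_self hx.ne']
  · have h1 : z / x < 1 := (div_lt_one hx).2 h
    rw [if_pos ⟨hzx, h1⟩]
    have : (fun y => if x < z ∧ z / x - 1 < y then (1 : ℝ) else
        if y < z / x - 1 ∧ z < x then -1 else 0) = fun y => -(Iio (z / x - 1)).indicator 1 y := by
      ext y
      rw [indicator_apply]
      simp only [h, h.not_gt, mem_Iio]
      split_ifs <;> simp_all
    rw [this, integral_neg, integral_indicator_one measurableSet_Iio]; rfl

lemma fluxKernel_mul_pos_neg {ν : Measure ℝ} (hν : ν (Iio (-1 : ℝ)) = 0) {z x : ℝ} (hx : 0 < x)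
    (hz : z < 0) : fluxKernel (fun x y => x + x * y) ν z x = 0 := by
  unfold fluxKernel
  refine integral_eq_zero_of_ae ?_
  have : ∀ᵐ y ∂ν, y ∉ Iio (-1 : ℝ) := measure_eq_zero_iff_ae_notMem.1 hν
  filter_upwards [this] with y hy
  have hy' : -1 ≤ y := by simpa using hy
  have h1 : 0 ≤ x + x * y := by nlinarith
  simp only [crossing, Pi.zero_apply]
  rw [if_neg (fun h => by linarith [h.1]), if_neg (fun h => by linarith [h.1])]

lemma HasCompactSupport.exists_Icc {φ : ℝ → ℝ} (hc : HasCompactSupport φ) :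
    ∃ R : ℝ, 1 ≤ R ∧ ∀ z, z ∉ Icc (-R) R → φ z = 0 := by
  obtain ⟨R0, hR0⟩ := hc.isCompact.isBounded.subset_closedBall 0
  refine ⟨max 1 R0, le_max_left _ _, fun z hz => ?_⟩
  by_contra h
  have := hR0 (subset_tsupport φ h)
  rw [mem_closedBall_zero_iff, Real.norm_eq_abs] at this
  exact hz (abs_le.1 (this.trans (le_max_right _ _)))

/-- The kernel of the primitive based at `0`. -/
def primKernel (x z : ℝ) : ℝ := if 0 < x ∧ x ≤ z then 1 else if z < x ∧ x ≤ 0 then -1 else 0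

lemma measurable_primKernel : Measurable fun p : ℝ × ℝ => primKernel p.1 p.2 := by
  refine Measurable.ite ?_ measurable_const (Measurable.ite ?_ measurable_const measurable_const)
  · exact (measurableSet_lt measurable_const measurable_fst).inter
      (measurableSet_le measurable_fst measurable_snd)
  · exact (measurableSet_lt measurable_snd measurable_fst).inter
      (measurableSet_le measurable_fst measurable_const)

lemma abs_primKernel_le_one (x z : ℝ) : |primKernel x z| ≤ 1 := by
  unfold primKernel; split_ifs <;> norm_num

lemma intervalIntegral_eq_primKernel (w : ℝ → ℝ) (lam : Measure ℝ) (z : ℝ) :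
    ∫ x in (0 : ℝ)..z, w x ∂lam = ∫ x, w x * primKernel x z ∂lam := by
  rcases le_total 0 z with h | h
  · rw [intervalIntegral.integral_of_le h, ← integral_indicator measurableSet_Ioc]
    congr 1 with x
    unfold primKernel
    by_cases h1 : 0 < x ∧ x ≤ z
    · rw [if_pos h1, indicator_of_mem (show x ∈ Ioc 0 z from h1), mul_one]
    · rw [if_neg h1, if_neg (fun h2 => by linarith [h2.1, h2.2]),
        indicator_of_notMem (show x ∉ Ioc 0 z from h1), mul_zero]
  · rw [intervalIntegral.integral_of_ge h, ← integral_indicator measurableSet_Ioc, ← integral_neg]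
    congr 1 with x
    unfold primKernel
    by_cases h1 : z < x ∧ x ≤ 0
    · rw [if_neg (fun h2 => by linarith [h2.1, h1.2]), if_pos h1,
        indicator_of_mem (show x ∈ Ioc z 0 from h1), mul_neg_one]
    · rw [if_neg (fun h2 => by linarith [h2.1, h2.2]), if_neg h1,
        indicator_of_notMem (show x ∉ Ioc z 0 from h1), mul_zero, neg_zero]

section
variable {w : ℝ → ℝ} {lam : Measure ℝ}

lemma integrable_primKernel (hw : LocallyIntegrable w lam) (R : ℝ) :
    Integrable (fun p : ℝ × ℝ => w p.1 * primKernel p.1 p.2)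
      ((lam.restrict (Icc (-R) R)).prod (volume.restrict (Icc (-R) R))) := by
  have h1 : Integrable w (lam.restrict (Icc (-R) R)) := hw.integrableOn_isCompact isCompact_Icc
  exact (h1.comp_fst (volume.restrict (Icc (-R) R))).mul_bdd (c := 1)
    measurable_primKernel.aestronglyMeasurable (ae_of_all _ fun p => abs_primKernel_le_one _ _)

lemma intervalIntegral_eq_primKernel_restrict {R z : ℝ} (hR : 1 ≤ R) (hz : z ∈ Icc (-R) R) :
    ∫ x in (0 : ℝ)..z, w x ∂lam = ∫ x in Icc (-R) R, w x * primKernel x z ∂lam := by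
  rw [intervalIntegral_eq_primKernel]
  refine (setIntegral_eq_integral_of_forall_compl_eq_zero fun x hx => ?_).symm
  have : primKernel x z = 0 := by
    unfold primKernel
    rw [if_neg, if_neg]
    · rintro ⟨h1, h2⟩; exact hx ⟨by linarith [hz.1], by linarith⟩
    · rintro ⟨h1, h2⟩; exact hx ⟨by linarith, by linarith [hz.2]⟩
  rw [this, mul_zero]

lemma integrableOn_primitive [SFinite lam] (hw : LocallyIntegrable w lam) {R : ℝ} (hR : 1 ≤ R) :
    IntegrableOn (fun z => ∫ x in (0 : ℝ)..z, w x ∂lam) (Icc (-R) R) := by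
  refine (integrable_primKernel hw R).integral_prod_right.congr ?_
  filter_upwards [ae_restrict_mem measurableSet_Icc] with z hz
  exact (intervalIntegral_eq_primKernel_restrict hR hz).symm

lemma locallyIntegrable_primitive [SFinite lam] (hw : LocallyIntegrable w lam) :
    LocallyIntegrable (fun z => ∫ x in (0 : ℝ)..z, w x ∂lam) := by
  intro x
  refine ⟨Icc (-(|x| + 1)) (|x| + 1), Icc_mem_nhds ?_ ?_,
    integrableOn_primitive hw (by linarith [abs_nonneg x])⟩
  · linarith [neg_abs_le x]
  · linarith [le_abs_self x]

lemma integral_deriv_mul_primKernel {φ : ℝ → ℝ} (hφ : ContDiff ℝ (⊤ : ℕ∞) φ)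
    (hc : HasCompactSupport φ) (x : ℝ) : ∫ z, deriv φ z * primKernel x z = -φ x := by
  have hd : ∀ z, HasDerivAt φ (deriv φ z) z := fun z =>
    (hφ.differentiable (by simp) z).hasDerivAt
  have hi : Integrable (deriv φ) :=
    (((contDiff_infty_iff_deriv).1 hφ).2.continuous).integrable_of_hasCompactSupport hc.deriv
  have htop : Tendsto φ atTop (𝓝 0) := by
    have := hc.is_zero_at_infty
    rw [cocompact_eq_atBot_atTop] at this
    exact this.mono_left le_sup_right
  have hbot : Tendsto φ atBot (𝓝 0) := by
    have := hc.is_zero_at_infty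
    rw [cocompact_eq_atBot_atTop] at this
    exact this.mono_left le_sup_left
  rcases lt_or_ge 0 x with h | h
  · have h1 := integral_Ioi_of_hasDerivAt_of_tendsto' (a := x) (fun z _ => hd z) hi.integrableOn htop
    rw [← integral_Ici_eq_integral_Ioi, ← integral_indicator measurableSet_Ici, zero_sub] at h1
    rw [← h1]
    congr 1 with z
    unfold primKernel
    by_cases hz : x ≤ z
    · rw [if_pos ⟨h, hz⟩, indicator_of_mem (show z ∈ Ici x from hz), mul_one]
    · rw [if_neg (fun h2 => hz h2.2), if_neg (fun h2 => by linarith [h2.2]),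
        indicator_of_notMem (show z ∉ Ici x from hz), mul_zero]
  · have h1 := integral_Iic_of_hasDerivAt_of_tendsto' (a := x) (fun z _ => hd z) hi.integrableOn hbot
    rw [integral_Iic_eq_integral_Iio, ← integral_indicator measurableSet_Iio, sub_zero] at h1
    rw [← h1, ← integral_neg]
    congr 1 with z
    unfold primKernel
    rw [if_neg (fun h2 => by linarith [h2.1])]
    by_cases hz : z < x
    · rw [if_pos ⟨hz, h⟩, indicator_of_mem (show z ∈ Iio x from hz), mul_neg_one]
    · rw [if_neg (fun h2 => hz h2.1), indicator_of_notMem (show z ∉ Iio x from hz), mul_zero,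
        neg_zero]

/-- Integration by parts against the primitive of a weighted measure. -/
lemma integral_deriv_mul_primitive [SFinite lam] (hw : LocallyIntegrable w lam) {φ : ℝ → ℝ}
    (hφ : ContDiff ℝ (⊤ : ℕ∞) φ) (hc : HasCompactSupport φ) :
    ∫ z, deriv φ z * (∫ x in (0 : ℝ)..z, w x ∂lam) = -∫ x, w x * φ x ∂lam := by
  obtain ⟨R, hR, hφ0⟩ := HasCompactSupport.exists_Icc hc
  obtain ⟨R', hR', hφ0'⟩ := HasCompactSupport.exists_Icc hc.deriv
  let S := max R R'
  have hS : 1 ≤ S := hR.trans (le_max_left _ _)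
  have h0 : ∀ z, z ∉ Icc (-S) S → φ z = 0 := fun z hz => hφ0 z fun h => hz
    ⟨(neg_le_neg (le_max_left _ _)).trans h.1, h.2.trans (le_max_left _ _)⟩
  have h0' : ∀ z, z ∉ Icc (-S) S → deriv φ z = 0 := fun z hz => hφ0' z fun h => hz
    ⟨(neg_le_neg (le_max_right _ _)).trans h.1, h.2.trans (le_max_right _ _)⟩
  have hcont : Continuous (deriv φ) := ((contDiff_infty_iff_deriv).1 hφ).2.continuous
  obtain ⟨C, hC⟩ := hc.deriv.exists_bound_of_continuous hcont
  have hint : Integrable (fun p : ℝ × ℝ => deriv φ p.2 * (w p.1 * primKernel p.1 p.2))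
      ((lam.restrict (Icc (-S) S)).prod (volume.restrict (Icc (-S) S))) :=
    (integrable_primKernel hw S).bdd_mul (c := C)
      (hcont.comp continuous_snd).aestronglyMeasurable (ae_of_all _ fun p => hC p.2)
  have hset : ∀ g : ℝ → ℝ, ∫ z in Icc (-S) S, deriv φ z * g z = ∫ z, deriv φ z * g z := fun g =>
    setIntegral_eq_integral_of_forall_compl_eq_zero fun z hz => by rw [h0' z hz, zero_mul]
  have hset' : ∫ x in Icc (-S) S, w x * φ x ∂lam = ∫ x, w x * φ x ∂lam :=
    setIntegral_eq_integral_of_forall_compl_eq_zero fun z hz => by rw [h0 z hz, mul_zero]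
  rw [← hset, ← hset', ← integral_neg]
  calc ∫ z in Icc (-S) S, deriv φ z * (∫ x in (0 : ℝ)..z, w x ∂lam)
      = ∫ z in Icc (-S) S, ∫ x in Icc (-S) S, deriv φ z * (w x * primKernel x z) ∂lam := by
        refine setIntegral_congr_fun measurableSet_Icc fun z hz => ?_
        rw [integral_const_mul, intervalIntegral_eq_primKernel_restrict hS hz]
    _ = ∫ x in Icc (-S) S, (∫ z in Icc (-S) S, deriv φ z * (w x * primKernel x z)) ∂lam :=
        (integral_integral_swap hint).symm
    _ = _ := by
        congr 1 with x
        rw [hset (fun z => w x * primKernel x z)]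
        have : ∀ z, deriv φ z * (w x * primKernel x z) = w x * (deriv φ z * primKernel x z) :=
          fun z => by ring
        simp only [this]
        rw [integral_const_mul, integral_deriv_mul_primKernel hφ hc]; ring

end

lemma exists_deriv_eq_of_integral_eq_zero {ψ : ℝ → ℝ} (hψ : ContDiff ℝ (⊤ : ℕ∞) ψ)
    (hc : HasCompactSupport ψ) (h0 : ∫ x, ψ x = 0) :
    ∃ φ : ℝ → ℝ, ContDiff ℝ (⊤ : ℕ∞) φ ∧ HasCompactSupport φ ∧ deriv φ = ψ := by
  obtain ⟨R, hR, hψ0⟩ := HasCompactSupport.exists_Icc hc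
  have hd : ∀ x, HasDerivAt (fun x => ∫ t in (-R)..x, ψ t) (ψ x) x := fun x =>
    (hψ.continuous.integral_hasStrictDerivAt (-R) x).hasDerivAt
  have hderiv : deriv (fun x => ∫ t in (-R)..x, ψ t) = ψ := funext fun x => (hd x).deriv
  refine ⟨_, contDiff_infty_iff_deriv.2 ⟨fun x => (hd x).differentiableAt, by rw [hderiv]; exact hψ⟩,
    ?_, hderiv⟩
  refine HasCompactSupport.intro (K := Icc (-R) R) isCompact_Icc fun x hx => ?_
  rcases lt_or_ge x (-R) with h | h
  · rw [intervalIntegral.integral_symm, neg_eq_zero]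
    refine intervalIntegral.integral_zero_ae ?_
    have hne : ∀ᵐ t : ℝ, t ≠ -R := by simp [ae_iff]
    filter_upwards [hne] with t ht hmem
    rw [uIoc_of_le h.le] at hmem
    exact hψ0 t fun h' => ht (le_antisymm hmem.2 h'.1)
  · have hx' : R < x := by
      by_contra h'
      exact hx ⟨h, not_lt.1 h'⟩
    rw [intervalIntegral.integral_of_le (by linarith), ← h0]
    have hne : ∀ᵐ t : ℝ, t ≠ -R := by simp [ae_iff]
    refine setIntegral_eq_integral_of_ae_compl_eq_zero ?_
    filter_upwards [hne] with t ht hmem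
    refine hψ0 t fun h' => hmem ⟨lt_of_le_of_ne h'.1 ht.symm, h'.2.trans hx'.le⟩

/-- Approximation of the indicator of a bounded open set by test functions. -/
lemma exists_contDiff_tendsto_indicator {s : Set ℝ} (hs : IsOpen s) (hb : Bornology.IsBounded s) :
    ∃ ψ : ℕ → ℝ → ℝ, (∀ n, ContDiff ℝ (⊤ : ℕ∞) (ψ n)) ∧ (∀ n, HasCompactSupport (ψ n)) ∧
      (∀ n x, ‖ψ n x‖ ≤ s.indicator 1 x) ∧
      ∀ x, Tendsto (fun n => ψ n x) atTop (𝓝 (s.indicator 1 x)) := by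
  obtain ⟨f, hf1, hf2, hf3⟩ := hs.exists_contDiff_support_eq (n := (⊤ : ℕ∞))
  have hz : ∀ n : ℕ, ∀ x, x ∉ s → Real.smoothTransition (n * f x) = 0 := fun n x hx => by
    have : f x = 0 := by
      by_contra h
      exact hx (hf1 ▸ h)
    rw [this, mul_zero, Real.smoothTransition.zero]
  refine ⟨fun n x => Real.smoothTransition (n * f x), fun n => ?_, fun n => ?_, fun n x => ?_,
    fun x => ?_⟩
  · exact Real.smoothTransition.contDiff.comp (contDiff_const.mul hf2)
  · refine HasCompactSupport.intro (K := closure s) hb.isCompact_closure fun x hx => ?_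
    exact hz n x fun h => hx (subset_closure h)
  · by_cases hx : x ∈ s
    · rw [indicator_of_mem hx, Real.norm_of_nonneg (Real.smoothTransition.nonneg _)]
      exact Real.smoothTransition.le_one _
    · simp only [hz n x hx, indicator_of_notMem hx, norm_zero, le_refl]
  · by_cases hx : x ∈ s
    · rw [indicator_of_mem hx]
      have hpos : 0 < f x := lt_of_le_of_ne (hf3 (mem_range_self x)).1 fun h => by
        rw [← hf1] at hx; exact hx h.symm
      obtain ⟨N, hN⟩ := exists_nat_gt (1 / f x)
      refine tendsto_const_nhds.congr' ?_
      filter_upwards [eventually_ge_atTop N] with n hn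
      refine (Real.smoothTransition.one_of_one_le ?_).symm
      have : (N : ℝ) ≤ n := by exact_mod_cast hn
      rw [div_lt_iff₀ hpos] at hN
      nlinarith
    · rw [indicator_of_notMem hx]
      simp only [hz _ x hx]
      exact tendsto_const_nhds

/-- If a measure and a function have the same distributional derivative, they agree up to
Lebesgue measure. -/
lemma exists_density_of_weak {ν : Measure ℝ} [IsLocallyFiniteMeasure ν] {P : ℝ → ℝ}
    (hP : LocallyIntegrable P)
    (H : ∀ φ : ℝ → ℝ, ContDiff ℝ (⊤ : ℕ∞) φ → HasCompactSupport φ →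
      ∫ x, deriv φ x ∂ν = ∫ x, deriv φ x * P x) :
    ∃ C : ℝ, (∀ᵐ x, 0 ≤ P x + C) ∧ ν = volume.withDensity fun x => ENNReal.ofReal (P x + C) := by
  let χ : ContDiffBump (0 : ℝ) := ⟨1, 2, one_pos, one_lt_two⟩
  let ψ0 : ℝ → ℝ := χ.normed volume
  have h0s : ContDiff ℝ (⊤ : ℕ∞) ψ0 := χ.contDiff_normed
  have h0c : HasCompactSupport ψ0 := χ.hasCompactSupport_normed
  have h0i : ∫ x, ψ0 x = 1 := χ.integral_normed
  let C : ℝ := (∫ x, ψ0 x ∂ν) - ∫ x, ψ0 x * P x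
  have key : ∀ ψ : ℝ → ℝ, ContDiff ℝ (⊤ : ℕ∞) ψ → HasCompactSupport ψ →
      ∫ x, ψ x ∂ν = ∫ x, ψ x * (P x + C) := by
    intro ψ hs hc
    have i1 : Integrable ψ := hs.continuous.integrable_of_hasCompactSupport hc
    have i0 : Integrable ψ0 := h0s.continuous.integrable_of_hasCompactSupport h0c
    have i1' : Integrable ψ ν := hs.continuous.integrable_of_hasCompactSupport hc
    have i0' : Integrable ψ0 ν := h0s.continuous.integrable_of_hasCompactSupport h0c
    have j1 := integrable_mul_of_locallyIntegrable hP hs.continuous hc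
    have j0 := integrable_mul_of_locallyIntegrable hP h0s.continuous h0c
    let a := ∫ x, ψ x
    obtain ⟨φ, hφ, hφc, hφd⟩ := exists_deriv_eq_of_integral_eq_zero
      (ψ := fun x => ψ x - a * ψ0 x) (hs.sub (contDiff_const.mul h0s))
      (hc.sub (h0c.mul_left (f := fun _ => a))) (by
        rw [integral_sub i1 (i0.const_mul a), integral_const_mul, h0i, mul_one, sub_self])
    have h := H φ hφ hφc
    rw [hφd, integral_sub i1' (i0'.const_mul a), integral_const_mul] at h
    have e : ∀ x, (ψ x - a * ψ0 x) * P x = ψ x * P x - a * (ψ0 x * P x) := fun x => by ring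
    simp only [e] at h
    rw [integral_sub j1 (j0.const_mul a), integral_const_mul] at h
    have e2 : ∀ x, ψ x * (P x + C) = ψ x * P x + ψ x * C := fun x => by ring
    simp only [e2]
    rw [integral_add j1 (i1.mul_const C), integral_mul_const]
    change _ = _ + a * C
    have : a * C = a * (∫ x, ψ0 x ∂ν) - a * ∫ x, ψ0 x * P x := mul_sub _ _ _
    linarith
  have hPC : LocallyIntegrable fun x => P x + C := hP.add (locallyIntegrable_const C)
  have hopen : ∀ s : Set ℝ, IsOpen s → Bornology.IsBounded s →
      ν.real s = ∫ x in s, (P x + C) := by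
    intro s hs hb
    obtain ⟨ψ, h1, h2, h3, h4⟩ := exists_contDiff_tendsto_indicator hs hb
    have hms := hs.measurableSet
    have hν : ν s < ⊤ := hb.measure_lt_top
    have hPs : IntegrableOn (fun x => P x + C) s :=
      (hPC.integrableOn_isCompact hb.isCompact_closure).mono_set subset_closure
    have l1 : Tendsto (fun n => ∫ x, ψ n x ∂ν) atTop (𝓝 (∫ x, s.indicator 1 x ∂ν)) := by
      refine tendsto_integral_of_dominated_convergence (s.indicator 1)
        (fun n => (h1 n).continuous.aestronglyMeasurable) ?_ (fun n => ae_of_all _ (h3 n))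
        (ae_of_all _ h4)
      exact (integrable_indicator_iff hms).2 (integrableOn_const hν.ne)
    have l2 : Tendsto (fun n => ∫ x, ψ n x * (P x + C)) atTop
        (𝓝 (∫ x, s.indicator 1 x * (P x + C))) := by
      refine tendsto_integral_of_dominated_convergence (s.indicator fun x => ‖P x + C‖)
        (fun n => (h1 n).continuous.aestronglyMeasurable.mul hPC.aestronglyMeasurable) ?_
        (fun n => ae_of_all _ fun x => ?_) (ae_of_all _ fun x => (h4 x).mul_const _)
      · exact (integrable_indicator_iff hms).2 hPs.norm
      · rw [norm_mul]
        refine (mul_le_mul_of_nonneg_right (h3 n x) (norm_nonneg _)).trans ?_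
        by_cases hx : x ∈ s <;> simp [hx]
    simp only [fun n => key (ψ n) (h1 n) (h2 n)] at l1
    have := tendsto_nhds_unique l1 l2
    rw [integral_indicator_one hms] at this
    rw [this, ← integral_indicator hms]
    congr 1 with x
    by_cases hx : x ∈ s <;> simp [hx]
  let A := volume.withDensity fun x => ENNReal.ofReal (P x + C)
  let B := volume.withDensity fun x => ENNReal.ofReal (-(P x + C))
  have hmA : AEMeasurable (fun x => ENNReal.ofReal (P x + C)) :=
    hPC.aestronglyMeasurable.aemeasurable.ennreal_ofReal
  have hlfA : IsLocallyFiniteMeasure A := ⟨fun x => ⟨Ioo (x - 1) (x + 1),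
    Ioo_mem_nhds (by linarith) (by linarith), by
      rw [withDensity_apply _ measurableSet_Ioo]
      exact ((hPC.integrableOn_isCompact isCompact_Icc).mono_set Ioo_subset_Icc_self
        ).lintegral_lt_top⟩⟩
  have hlfB : IsLocallyFiniteMeasure B := ⟨fun x => ⟨Ioo (x - 1) (x + 1),
    Ioo_mem_nhds (by linarith) (by linarith), by
      rw [withDensity_apply _ measurableSet_Ioo]
      exact ((hPC.integrableOn_isCompact isCompact_Icc).mono_set Ioo_subset_Icc_self
        ).neg.lintegral_lt_top⟩⟩
  have hlf : IsLocallyFiniteMeasure (ν + B) := ⟨fun x => ⟨Ioo (x - 1) (x + 1),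
    Ioo_mem_nhds (by linarith) (by linarith), by
      rw [Measure.add_apply]
      exact ENNReal.add_lt_top.2 ⟨(Metric.isBounded_Ioo _ _).measure_lt_top,
        (Metric.isBounded_Ioo _ _).measure_lt_top⟩⟩⟩
  have heq : ν + B = A := by
    refine Real.measure_ext_Ioo_rat fun a b => ?_
    have h1 := hopen (Ioo a b) isOpen_Ioo (Metric.isBounded_Ioo _ _)
    have hPs : IntegrableOn (fun x => P x + C) (Ioo a b) :=
      (hPC.integrableOn_isCompact isCompact_Icc).mono_set Ioo_subset_Icc_self
    rw [integral_eq_lintegral_pos_part_sub_lintegral_neg_part hPs] at h1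
    rw [Measure.add_apply, withDensity_apply _ measurableSet_Ioo,
      withDensity_apply _ measurableSet_Ioo]
    have hν : ν (Ioo a b) < ⊤ := (Metric.isBounded_Ioo _ _).measure_lt_top
    have hA := hPs.lintegral_lt_top
    have hB : ∫⁻ x in Ioo (a : ℝ) b, ENNReal.ofReal (-(P x + C)) < ⊤ := hPs.neg.lintegral_lt_top
    rw [← ENNReal.toReal_eq_toReal_iff' (ENNReal.add_ne_top.2 ⟨hν.ne, hB.ne⟩) hA.ne,
      ENNReal.toReal_add hν.ne hB.ne]
    rw [measureReal_def] at h1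
    linarith
  have hB0 : ∀ᵐ x, 0 ≤ P x + C := by
    let N := {x | ENNReal.ofReal (P x + C) = 0}
    have hN : NullMeasurableSet N := hmA.nullMeasurable (measurableSet_singleton 0)
    have hAN : A N = 0 := by
      rw [withDensity_apply₀ _ hN]
      refine (lintegral_congr_ae (g := fun _ => 0) ?_).trans lintegral_zero
      filter_upwards [ae_restrict_mem₀ hN] with x hx using hx
    have hBN : B N = 0 := by
      have : (ν + B) N = 0 := by rw [heq, hAN]
      rw [Measure.add_apply] at this
      exact (add_eq_zero.1 this).2
    rw [withDensity_apply₀ _ hN, lintegral_eq_zero_iff'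
      (show AEMeasurable (fun x => ENNReal.ofReal (-(P x + C))) (volume.restrict N) from
        hPC.aestronglyMeasurable.aemeasurable.neg.ennreal_ofReal.restrict)] at hBN
    rw [EventuallyEq, ae_restrict_iff'₀ hN] at hBN
    filter_upwards [hBN] with x hx
    by_contra hlt
    push Not at hlt
    have h1 := hx (ENNReal.ofReal_of_nonpos hlt.le)
    simp only [Pi.zero_apply, ENNReal.ofReal_eq_zero] at h1
    linarith
  refine ⟨C, hB0, ?_⟩
  have hBz : B = 0 := by
    have : (fun x => ENNReal.ofReal (-(P x + C))) =ᵐ[volume] 0 := by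
      filter_upwards [hB0] with x hx
      exact ENNReal.ofReal_of_nonpos (by linarith)
    rw [show B = _ from withDensity_congr_ae this, withDensity_zero]
  rw [hBz, add_zero] at heq
  exact heq

lemma continuousAt_crossing {x j z : ℝ} (hx : z ≠ x) (hj : z ≠ j) :
    ContinuousAt (crossing x j) z := by
  have h : ∀ a : ℝ, z ≠ a → ∀ᶠ w in 𝓝 z, (w < a ↔ z < a) ∧ (a < w ↔ a < z) := fun a ha => by
    rcases lt_or_gt_of_ne ha with h | h
    · filter_upwards [eventually_lt_nhds h] with w hw
      exact ⟨by simp [h, hw], by simp [h.not_gt, hw.not_gt]⟩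
    · filter_upwards [eventually_gt_nhds h] with w hw
      exact ⟨by simp [h.not_gt, hw.not_gt], by simp [h, hw]⟩
  refine (continuousAt_const (y := crossing x j z)).congr ?_
  filter_upwards [h x hx, h j hj] with w h1 h2
  simp only [crossing, h1.1, h1.2, h2.1, h2.2]

lemma IsJump.continuousAt_flux {J : ℝ → ℝ → ℝ} {ν μ : Measure ℝ} [IsProbabilityMeasure μ]
    [NullSingletonClass μ] (hJ : IsJump J) (hν : IsFVLevy ν) {z₀ L δ K : ℝ}
    (hsub : ∀ y, {x | J x y = z₀}.Subsingleton) (hL0 : 0 < L)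
    (hL : ∀ z, |z - z₀| ≤ 1 → ∀ x y, |y| ≤ 1 / 2 → crossing x (J x y) z ≠ 0 → |x - z| ≤ L * |y|)
    (hδ : 0 < δ)
    (hK : ∀ a b, z₀ - δ ≤ a → a ≤ b → b ≤ z₀ + δ → μ.real (Icc a b) ≤ K * (b - a)) :
    ContinuousAt (flux J ν μ) z₀ := by
  have := hν.sigmaFinite
  let c := min (1 / 2) (δ / (2 * L))
  have hc : 0 < c := by positivity
  let M := max (2 * K * L) (1 / c)
  have hmeas : ∀ z, Measurable fun p : ℝ × ℝ => crossing p.1 (J p.1 p.2) z := fun z =>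
    hJ.measurable_crossing.comp (measurable_id.prodMk measurable_const)
  have hmx : ∀ z y, Measurable fun x => crossing x (J x y) z := fun z y =>
    (hmeas z).comp (measurable_id.prodMk measurable_const)
  have hmy : ∀ z x, Measurable fun y => crossing x (J x y) z := fun z x =>
    (hmeas z).comp (measurable_const.prodMk measurable_id)
  have hint : ∀ z y, Integrable (fun x => crossing x (J x y) z) μ := fun z y =>
    Integrable.of_bound (hmx z y).aestronglyMeasurable 1
      (ae_of_all _ fun x => abs_crossing_le_one _ _ _)
  have hbound : ∀ z, |z - z₀| ≤ min 1 (δ / 2) → ∀ y,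
      ∫ x, ‖crossing x (J x y) z‖ ∂μ ≤ M * min 1 |y| := by
    intro z hz y
    have hz1 : |z - z₀| ≤ 1 := hz.trans (min_le_left _ _)
    have hz2 := abs_le.1 (hz.trans (min_le_right _ _))
    have hy0 := abs_nonneg y
    rcases le_total |y| c with hy | hy
    · have hy1 : |y| ≤ 1 / 2 := hy.trans (min_le_left _ _)
      have hy2 : L * |y| ≤ δ / 2 := by
        have := hy.trans (min_le_right _ _)
        rw [le_div_iff₀ (by positivity)] at this
        linarith
      have hmin : min 1 |y| = |y| := min_eq_right (by linarith)
      have h1 : ∫ x, ‖crossing x (J x y) z‖ ∂μ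
          ≤ ∫ x, (Icc (z - L * |y|) (z + L * |y|)).indicator 1 x ∂μ := by
        refine integral_mono (hint z y).norm
          ((integrable_indicator_iff measurableSet_Icc).2 (integrableOn_const (by finiteness)))
          fun x => ?_
        by_cases hx : crossing x (J x y) z = 0
        · simp only [hx, norm_zero]
          exact indicator_nonneg (fun _ _ => zero_le_one) x
        · have h2 := abs_le.1 (hL z hz1 x y hy1 hx)
          rw [indicator_of_mem (show x ∈ Icc (z - L * |y|) (z + L * |y|) from
            ⟨by linarith, by linarith⟩)]
          exact abs_crossing_le_one _ _ _
      rw [integral_indicator_one measurableSet_Icc] at h1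
      have h2 := hK (z - L * |y|) (z + L * |y|) (by linarith) (by nlinarith) (by linarith)
      rw [hmin]
      have h3 : 2 * K * L ≤ M := le_max_left _ _
      nlinarith
    · have h1 : ∫ x, ‖crossing x (J x y) z‖ ∂μ ≤ 1 := by
        have := integral_mono (μ := μ) (hint z y).norm (integrable_const 1)
          fun x => abs_crossing_le_one x (J x y) z
        simpa using this
      have h2 : c ≤ min 1 |y| := le_min ((min_le_left _ _).trans (by norm_num)) hy
      have h3 : 1 / c ≤ M := le_max_right _ _
      have h4 : 1 = 1 / c * c := by field_simp
      calc _ ≤ 1 / c * c := by rw [← h4]; exact h1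
        _ ≤ M * min 1 |y| := by
          have : 0 ≤ 1 / c := by positivity
          exact mul_le_mul h3 h2 hc.le (this.trans h3)
  have hswap : ∀ z, |z - z₀| ≤ min 1 (δ / 2) →
      flux J ν μ z = ∫ y, ∫ x, crossing x (J x y) z ∂μ ∂ν := by
    intro z hz
    refine integral_integral_swap (f := fun x y => crossing x (J x y) z) ?_
    refine (integrable_prod_iff' (hmeas z).aestronglyMeasurable).2 ⟨ae_of_all _ (hint z), ?_⟩
    refine (hν.integrable.const_mul M).mono' ?_ (ae_of_all _ fun y => ?_)
    · exact (StronglyMeasurable.integral_prod_left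
        (f := fun x y => ‖crossing x (J x y) z‖)
        (hmeas z).norm.stronglyMeasurable).aestronglyMeasurable
    · rw [Real.norm_of_nonneg (integral_nonneg fun x => norm_nonneg _)]
      exact hbound z hz y
  have hev : ∀ᶠ z in 𝓝 z₀, |z - z₀| ≤ min 1 (δ / 2) := by
    filter_upwards [Metric.closedBall_mem_nhds z₀ (show 0 < min 1 (δ / 2) by positivity)] with z hz
    exact hz
  have hcont : ContinuousAt (fun z => ∫ y, ∫ x, crossing x (J x y) z ∂μ ∂ν) z₀ := by
    refine continuousAt_of_dominated (bound := fun y => M * min 1 |y|)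
      (Eventually.of_forall fun z => ?_) ?_ (hν.integrable.const_mul M) (ae_of_all _ fun y => ?_)
    · exact (StronglyMeasurable.integral_prod_left
        (f := fun x y => crossing x (J x y) z)
        (hmeas z).stronglyMeasurable).aestronglyMeasurable
    · filter_upwards [hev] with z hz
      exact ae_of_all _ fun y => (norm_integral_le_integral_norm _).trans (hbound z hz y)
    · refine continuousAt_of_dominated (bound := fun _ => 1)
        (Eventually.of_forall fun z => (hmx z y).aestronglyMeasurable)
        (Eventually.of_forall fun z => ae_of_all _ fun x => abs_crossing_le_one _ _ _)
        (integrable_const 1) ?_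
      have h1 : ∀ᵐ x ∂μ, x ∉ ({z₀} : Set ℝ) := measure_eq_zero_iff_ae_notMem.1 (measure_singleton _)
      have h2 : ∀ᵐ x ∂μ, x ∉ {x | J x y = z₀} :=
        measure_eq_zero_iff_ae_notMem.1 ((hsub y).measure_zero μ)
      filter_upwards [h1, h2] with x hx1 hx2
      exact continuousAt_crossing (fun h => hx1 h.symm) (fun h => hx2 h.symm)
  refine hcont.congr ?_
  filter_upwards [hev] with z hz
  exact (hswap z hz).symm

section
variable {ση2 γη0 σU2 γU0 : ℝ} {νη νU μ : Measure ℝ}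

lemma mem_uIcc_of_crossing_ne_zero {x j z : ℝ} (h : crossing x j z ≠ 0) : |x - z| ≤ |x - j| := by
  have h1 : z ∈ Ioo (min x j) (max x j) := by
    by_contra hz
    have := abs_crossing_eq x j z
    rw [indicator_of_notMem hz, abs_eq_zero] at this
    exact h this
  have h2 : z ∈ uIcc x j := Ioo_subset_Icc_self h1
  have := abs_sub_left_of_mem_uIcc h2
  rwa [abs_sub_comm x z, abs_sub_comm x j]

lemma continuousAt_jumpFlux [IsProbabilityMeasure μ] [NullSingletonClass μ] (hη : IsFVLevy νη)
    (hU : IsFVLevy νU) {z₀ δ K : ℝ} (hz₀ : z₀ ≠ 0) (hδ : 0 < δ)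
    (hK : ∀ a b, z₀ - δ ≤ a → a ≤ b → b ≤ z₀ + δ → μ.real (Icc a b) ≤ K * (b - a)) :
    ContinuousAt (jumpFlux νη νU μ) z₀ := by
  refine ContinuousAt.add ?_ ?_
  · refine isJump_add.continuousAt_flux hη (L := 1) (fun y x hx x' hx' => ?_) one_pos
      (fun z hz x y hy h => ?_) hδ hK
    · simp only [mem_ofPred_eq] at hx hx'; linarith
    · simpa using mem_uIcc_of_crossing_ne_zero h
  · refine isJump_mul.continuousAt_flux hU (L := 2 * (|z₀| + 1)) (fun y x hx x' hx' => ?_)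
      (by positivity) (fun z hz x y hy h => ?_) hδ hK
    · simp only [mem_ofPred_eq] at hx hx'
      have h1 : (1 + y) ≠ 0 := fun h => hz₀ (by rw [← hx]; linear_combination x * h)
      exact mul_right_cancel₀ h1 (by linarith)
    · have h1 := mem_uIcc_of_crossing_ne_zero h
      simp only [sub_add_cancel_left, abs_neg, abs_mul] at h1
      have h2 : |x| ≤ 2 * |z| := by
        nlinarith [abs_sub_abs_le_abs_sub x z, abs_nonneg x]
      have h3 : |z| ≤ |z₀| + 1 := by linarith [abs_sub_abs_le_abs_sub z z₀]
      nlinarith [abs_nonneg y]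

/-- The primitive of drift and jump flux. -/
def primFun (γη0 γU0 : ℝ) (νη νU μ : Measure ℝ) (z : ℝ) : ℝ :=
  (∫ x in (0 : ℝ)..z, driftCoef γη0 γU0 x ∂μ) + ∫ x in (0 : ℝ)..z, jumpFlux νη νU μ x

variable [IsProbabilityMeasure μ]

lemma IsFVInvariant.locallyIntegrable_primFun (h : IsFVInvariant ση2 γη0 σU2 γU0 νη νU μ) :
    LocallyIntegrable (primFun γη0 γU0 νη νU μ) :=
  (locallyIntegrable_primitive (continuous_driftCoef _ _).locallyIntegrable).add
    (locallyIntegrable_primitive h.locallyIntegrable_jumpFlux)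

lemma diffCoef_nonneg (h1 : 0 ≤ ση2) (h2 : 0 ≤ σU2) (x : ℝ) : 0 ≤ diffCoef ση2 σU2 x := by
  unfold diffCoef; positivity

lemma diffCoef_pos (h1 : 0 ≤ ση2) (h2 : 0 ≤ σU2) (h : 0 < ση2 + σU2) {x : ℝ} (hx : x ≠ 0) :
    0 < diffCoef ση2 σU2 x := by
  unfold diffCoef
  have : 0 < x ^ 2 := by positivity
  rcases h1.eq_or_lt with h' | h'
  · have : 0 < σU2 := by linarith
    positivity
  · positivity

lemma IsFVInvariant.exists_withDensity_eq (h : IsFVInvariant ση2 γη0 σU2 γU0 νη νU μ) :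
    ∃ C : ℝ, (∀ᵐ x, 0 ≤ primFun γη0 γU0 νη νU μ x + C) ∧
      μ.withDensity (fun x => ENNReal.ofReal (diffCoef ση2 σU2 x))
        = volume.withDensity fun x => ENNReal.ofReal (primFun γη0 γU0 νη νU μ x + C) := by
  have hg := continuous_diffCoef ση2 σU2
  have hgm : Measurable fun x => (diffCoef ση2 σU2 x).toNNReal := hg.measurable.real_toNNReal
  have : IsLocallyFiniteMeasure (μ.withDensity fun x => ENNReal.ofReal (diffCoef ση2 σU2 x)) :=
    IsLocallyFiniteMeasure.withDensity_ofReal hg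
  refine exists_density_of_weak h.locallyIntegrable_primFun fun φ hφ hc => ?_
  have h1 := h.weak hφ hc
  have e1 : ∫ x, deriv φ x ∂(μ.withDensity fun x => ENNReal.ofReal (diffCoef ση2 σU2 x))
      = ∫ x, diffCoef ση2 σU2 x * deriv φ x ∂μ := by
    refine (integral_withDensity_eq_integral_smul hgm (deriv φ)).trans ?_
    congr 1 with x
    rw [NNReal.smul_def, Real.coe_toNNReal _ (diffCoef_nonneg h.ση_nonneg h.σU_nonneg x),
      smul_eq_mul]
  have hφ' : Continuous (deriv φ) := ((contDiff_infty_iff_deriv).1 hφ).2.continuous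
  have hd : LocallyIntegrable (driftCoef γη0 γU0) μ := (continuous_driftCoef _ _).locallyIntegrable
  have e2 := integral_deriv_mul_primitive hd hφ hc
  have e3 := integral_deriv_mul_primitive h.locallyIntegrable_jumpFlux hφ hc
  have i2 := integrable_mul_of_locallyIntegrable (locallyIntegrable_primitive hd) hφ' hc.deriv
  have i3 := integrable_mul_of_locallyIntegrable
    (locallyIntegrable_primitive h.locallyIntegrable_jumpFlux) hφ' hc.deriv
  rw [e1]
  simp only [primFun, mul_add]
  rw [integral_add i2 i3, e2, e3]
  simp only [mul_comm (φ _) (jumpFlux νη νU μ _)] at h1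
  linarith

end

/-- `f` is the stationary density of `μ` away from `0`, given by the integrated equation. -/
structure IsStatDensity (ση2 γη0 σU2 γU0 : ℝ) (νη νU μ : Measure ℝ) (f : ℝ → ℝ) : Prop where
  invariant : IsFVInvariant ση2 γη0 σU2 γU0 νη νU μ
  σ_pos : 0 < ση2 + σU2
  ae_nonneg : ∀ᵐ x, 0 ≤ f x
  restrict_eq : μ.restrict {0}ᶜ = volume.withDensity fun x => ENNReal.ofReal (f x)
  exists_eq : ∃ C : ℝ, ∀ z, z ≠ 0 → diffCoef ση2 σU2 z * f z = primFun γη0 γU0 νη νU μ z + C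
  aestronglyMeasurable : AEStronglyMeasurable f

lemma intervalIntegrable_of_locallyIntegrable {F : ℝ → ℝ} (hF : LocallyIntegrable F) {a b : ℝ} :
    IntervalIntegrable F volume a b :=
  intervalIntegrable_iff.2 ((hF.integrableOn_isCompact isCompact_uIcc).mono_set uIoc_subset_uIcc)

section
variable {ση2 γη0 σU2 γU0 : ℝ} {νη νU μ : Measure ℝ} [IsProbabilityMeasure μ] {f : ℝ → ℝ}

lemma IsFVInvariant.exists_isStatDensity (h : IsFVInvariant ση2 γη0 σU2 γU0 νη νU μ)
    (hσ : 0 < ση2 + σU2) : ∃ f, IsStatDensity ση2 γη0 σU2 γU0 νη νU μ f := by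
  obtain ⟨C, hC0, hC⟩ := h.exists_withDensity_eq
  have hg := continuous_diffCoef ση2 σU2
  have hpos : ∀ {x : ℝ}, x ≠ 0 → 0 < diffCoef ση2 σU2 x := diffCoef_pos h.ση_nonneg h.σU_nonneg hσ
  have hP : AEMeasurable fun x => primFun γη0 γU0 νη νU μ x + C :=
    h.locallyIntegrable_primFun.aestronglyMeasurable.aemeasurable.add_const C
  have hne : ∀ᵐ x : ℝ, x ≠ 0 := by simp [ae_iff]
  have hf : AEMeasurable fun x => (primFun γη0 γU0 νη νU μ x + C) / diffCoef ση2 σU2 x :=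
    hP.div hg.measurable.aemeasurable
  refine ⟨fun x => (primFun γη0 γU0 νη νU μ x + C) / diffCoef ση2 σU2 x, h, hσ, ?_, ?_,
    ⟨C, fun z hz => by rw [mul_div_cancel₀ _ (hpos hz).ne']⟩, hf.aestronglyMeasurable⟩
  · filter_upwards [hC0] with x hx
    exact div_nonneg hx (diffCoef_nonneg h.ση_nonneg h.σU_nonneg x)
  · have hms : MeasurableSet ({0}ᶜ : Set ℝ) := (measurableSet_singleton 0).compl
    have hGm : Measurable fun x => ENNReal.ofReal (diffCoef ση2 σU2 x) :=
      hg.measurable.ennreal_ofReal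
    have e1 := withDensity_inv_same (μ := μ.restrict {0}ᶜ) hGm (by
      filter_upwards [ae_restrict_mem hms] with x hx
      exact (ENNReal.ofReal_pos.2 (hpos hx)).ne') (ae_of_all _ fun x => ENNReal.ofReal_ne_top)
    rw [← restrict_withDensity hms, hC, restrict_withDensity hms,
      Measure.restrict_eq_self_of_ae_mem (μ := (volume : Measure ℝ)) (s := {0}ᶜ) hne,
      ← withDensity_mul₀ hP.ennreal_ofReal
        (show AEMeasurable (fun x => (ENNReal.ofReal (diffCoef ση2 σU2 x))⁻¹) _ from
          hGm.inv.aemeasurable)] at e1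
    rw [← e1]
    refine withDensity_congr_ae ?_
    filter_upwards [hne, hC0] with x hx h0
    rw [Pi.mul_apply, ENNReal.ofReal_div_of_pos (hpos hx), div_eq_mul_inv]

lemma IsFVInvariant.measure_zero_of_pos (h : IsFVInvariant ση2 γη0 σU2 γU0 νη νU μ)
    (hσ : 0 < ση2) : μ {0} = 0 := by
  obtain ⟨C, hC0, hC⟩ := h.exists_withDensity_eq
  have h1 := congrArg (fun m : Measure ℝ => m {0}) hC
  simp only [withDensity_apply _ (measurableSet_singleton (0 : ℝ)), lintegral_singleton,
    Real.volume_singleton, mul_zero, mul_eq_zero] at h1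
  refine h1.resolve_left (ENNReal.ofReal_pos.2 ?_).ne'
  have := h.σU_nonneg
  unfold diffCoef; positivity

namespace IsStatDensity

lemma integral_restrict (hf : IsStatDensity ση2 γη0 σU2 γU0 νη νU μ f) (F : ℝ → ℝ) :
    ∫ x in {0}ᶜ, F x ∂μ = ∫ x, F x * f x := by
  rw [hf.restrict_eq, integral_withDensity_eq_integral_toReal_smul₀
    hf.aestronglyMeasurable.aemeasurable.ennreal_ofReal (ae_of_all _ fun x => ENNReal.ofReal_lt_top)]
  refine integral_congr_ae ?_
  filter_upwards [hf.ae_nonneg] with x hx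
  rw [ENNReal.toReal_ofReal hx, smul_eq_mul, mul_comm]

lemma integral_eq (hf : IsStatDensity ση2 γη0 σU2 γU0 νη νU μ f) {F : ℝ → ℝ}
    (hF : Integrable F μ ∨ μ {0} = 0) :
    ∫ x, F x ∂μ = (μ {0}).toReal * F 0 + ∫ x, F x * f x := by
  rw [← hf.integral_restrict]
  rcases hF with hF | hF
  · rw [← integral_add_compl (measurableSet_singleton (0 : ℝ)) hF, integral_singleton]; rfl
  · have hr : μ.restrict {0}ᶜ = μ :=
      Measure.restrict_eq_self_of_ae_mem (measure_eq_zero_iff_ae_notMem.1 hF)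
    rw [hr, hF]
    simp

lemma integrable (hf : IsStatDensity ση2 γη0 σU2 γU0 νη νU μ f) : Integrable f := by
  refine ⟨hf.aestronglyMeasurable, ?_⟩
  rw [hasFiniteIntegral_iff_ofReal hf.ae_nonneg]
  have : (volume.withDensity fun x => ENNReal.ofReal (f x)) univ < ⊤ := by
    rw [← hf.restrict_eq]; exact measure_lt_top _ _
  rwa [withDensity_apply _ MeasurableSet.univ, Measure.restrict_univ] at this

/-- The right-hand side of the differentiated equation. -/
lemma locallyIntegrable_rhs (hf : IsStatDensity ση2 γη0 σU2 γU0 νη νU μ f) :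
    LocallyIntegrable fun z => driftCoef γη0 γU0 z * f z + jumpFlux νη νU μ z :=
  (hf.integrable.locallyIntegrable.continuous_mul (continuous_driftCoef _ _)).add
    hf.invariant.locallyIntegrable_jumpFlux

lemma setIntegral_eq (hf : IsStatDensity ση2 γη0 σU2 γU0 νη νU μ f) (F : ℝ → ℝ) {s : Set ℝ}
    (hs : MeasurableSet s) (h0 : (0 : ℝ) ∉ s) : ∫ x in s, F x ∂μ = ∫ x in s, F x * f x := by
  have hsub : s ⊆ {0}ᶜ := fun x hx h => h0 ((show x = 0 from h) ▸ hx)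
  have h1 := hf.integral_restrict (s.indicator F)
  rw [integral_indicator hs, Measure.restrict_restrict hs,
    inter_eq_left.2 hsub] at h1
  rw [h1, ← integral_indicator hs]
  congr 1 with x
  by_cases hx : x ∈ s <;> simp [hx]

lemma intervalIntegral_eq (hf : IsStatDensity ση2 γη0 σU2 γU0 νη νU μ f) (F : ℝ → ℝ) {a b : ℝ}
    (h : 0 < a * b) : ∫ x in a..b, F x ∂μ = ∫ x in a..b, F x * f x := by
  have h1 : (0 : ℝ) ∉ Ioc a b := fun h' => by nlinarith [h'.1, h'.2]
  have h2 : (0 : ℝ) ∉ Ioc b a := fun h' => by nlinarith [h'.1, h'.2]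
  rw [intervalIntegral, intervalIntegral, hf.setIntegral_eq F measurableSet_Ioc h1,
    hf.setIntegral_eq F measurableSet_Ioc h2]

lemma primFun_sub (hf : IsStatDensity ση2 γη0 σU2 γU0 νη νU μ f) {a b : ℝ} (h : 0 < a * b) :
    primFun γη0 γU0 νη νU μ b - primFun γη0 γU0 νη νU μ a
      = ∫ z in a..b, (driftCoef γη0 γU0 z * f z + jumpFlux νη νU μ z) := by
  have i1 : ∀ a b, IntervalIntegrable (driftCoef γη0 γU0) μ a b := fun a b =>
    (continuous_driftCoef _ _).intervalIntegrable _ _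
  have i2 : ∀ a b, IntervalIntegrable (jumpFlux νη νU μ) volume a b := fun a b =>
    intervalIntegrable_of_locallyIntegrable hf.invariant.locallyIntegrable_jumpFlux
  have i3 : ∀ a b, IntervalIntegrable (fun z => driftCoef γη0 γU0 z * f z) volume a b := fun a b =>
    intervalIntegrable_of_locallyIntegrable (hf.integrable.locallyIntegrable.continuous_mul
      (continuous_driftCoef γη0 γU0))
  rw [intervalIntegral.integral_add (i3 _ _) (i2 _ _), ← hf.intervalIntegral_eq _ h,
    ← intervalIntegral.integral_interval_sub_left (i1 0 b) (i1 0 a),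
    ← intervalIntegral.integral_interval_sub_left (i2 0 b) (i2 0 a)]
  unfold primFun
  ring

lemma eq_near (hf : IsStatDensity ση2 γη0 σU2 γU0 νη νU μ f) {a b : ℝ} (h : 0 < a * b) :
    diffCoef ση2 σU2 b * f b = diffCoef ση2 σU2 a * f a
      + ∫ z in a..b, (driftCoef γη0 γU0 z * f z + jumpFlux νη νU μ z) := by
  obtain ⟨C, hC⟩ := hf.exists_eq
  rw [← hf.primFun_sub h, hC a (by rintro rfl; simp at h), hC b (by rintro rfl; simp at h)]
  ring

lemma eventually_mul_pos {z : ℝ} (hz : z ≠ 0) : ∀ᶠ w in 𝓝 z, 0 < z * w := by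
  have : ContinuousAt (fun w => z * w) z := by fun_prop
  exact this.eventually (eventually_gt_nhds (mul_self_pos.2 hz))

lemma pos (hf : IsStatDensity ση2 γη0 σU2 γU0 νη νU μ f) {z : ℝ} (hz : z ≠ 0) :
    0 < diffCoef ση2 σU2 z :=
  diffCoef_pos hf.invariant.ση_nonneg hf.invariant.σU_nonneg hf.σ_pos hz

lemma eventually_eq (hf : IsStatDensity ση2 γη0 σU2 γU0 νη νU μ f) {z : ℝ} (hz : z ≠ 0) :
    f =ᶠ[𝓝 z] fun w => (diffCoef ση2 σU2 z * f z
      + ∫ t in z..w, (driftCoef γη0 γU0 t * f t + jumpFlux νη νU μ t)) / diffCoef ση2 σU2 w := by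
  filter_upwards [eventually_mul_pos hz, eventually_ne_nhds hz] with w hw hw0
  rw [← hf.eq_near hw, mul_div_cancel_left₀ _ (hf.pos hw0).ne']

lemma continuousAt (hf : IsStatDensity ση2 γη0 σU2 γU0 νη νU μ f) {z : ℝ} (hz : z ≠ 0) :
    ContinuousAt f z := by
  refine ContinuousAt.congr ?_ (hf.eventually_eq hz).symm
  refine ContinuousAt.div (continuousAt_const.add ?_) (continuous_diffCoef _ _).continuousAt
    (hf.pos hz).ne'
  exact (intervalIntegral.continuous_primitive
    (fun a b => intervalIntegrable_of_locallyIntegrable hf.locallyIntegrable_rhs) z).continuousAt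

lemma hasDerivAt (hf : IsStatDensity ση2 γη0 σU2 γU0 νη νU μ f) {z : ℝ} (hz : z ≠ 0)
    (h : HasDerivAt (fun w => ∫ t in z..w, (driftCoef γη0 γU0 t * f t + jumpFlux νη νU μ t))
      (driftCoef γη0 γU0 z * f z + jumpFlux νη νU μ z) z) :
    HasDerivAt f ((driftCoef γη0 γU0 z * f z + jumpFlux νη νU μ z - σU2 * z * f z)
      / diffCoef ση2 σU2 z) z := by
  have hg : HasDerivAt (diffCoef ση2 σU2) (σU2 * z) z := by
    refine (((hasDerivAt_pow 2 z).const_mul (σU2 / 2)).const_add (ση2 / 2)).congr_deriv ?_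
    norm_num
    ring
  have hne := (hf.pos hz).ne'
  have h1 := (h.const_add (diffCoef ση2 σU2 z * f z)).fun_div hg hne
  refine HasDerivAt.congr_of_eventuallyEq ?_ (hf.eventually_eq hz)
  refine h1.congr_deriv ?_
  rw [intervalIntegral.integral_same]
  field_simp
  ring

lemma ae_hasDerivAt (hf : IsStatDensity ση2 γη0 σU2 γU0 νη νU μ f) : ∀ᵐ z,
    HasDerivAt f ((driftCoef γη0 γU0 z * f z + jumpFlux νη νU μ z - σU2 * z * f z)
      / diffCoef ση2 σU2 z) z := by
  have hne : ∀ᵐ x : ℝ, x ≠ 0 := by simp [ae_iff]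
  filter_upwards [hne, LocallyIntegrable.ae_hasDerivAt_integral hf.locallyIntegrable_rhs] with z hz h
  exact hf.hasDerivAt hz (h z)

lemma eq_withDensity (hf : IsStatDensity ση2 γη0 σU2 γU0 νη νU μ f) (h0 : μ {0} = 0) :
    μ = volume.withDensity fun x => ENNReal.ofReal (f x) := by
  have hr : μ.restrict {0}ᶜ = μ :=
    Measure.restrict_eq_self_of_ae_mem (measure_eq_zero_iff_ae_notMem.1 h0)
  rw [← hf.restrict_eq, hr]

lemma continuousAt_jumpFlux (hf : IsStatDensity ση2 γη0 σU2 γU0 νη νU μ f) (h0 : μ {0} = 0)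
    {z : ℝ} (hz : z ≠ 0) : ContinuousAt (jumpFlux νη νU μ) z := by
  have hμ := hf.eq_withDensity h0
  have : NullSingletonClass μ := by rw [hμ]; infer_instance
  have hev : ∀ᶠ w in 𝓝 z, f w ≤ f z + 1 :=
    (hf.continuousAt hz).eventually (eventually_le_nhds (by linarith))
  obtain ⟨δ, hδ, hball⟩ := Metric.eventually_nhds_iff.1 hev
  have hK : ∀ w, |w - z| ≤ δ / 2 → f w ≤ max (f z + 1) 0 := fun w hw =>
    (hball (show dist w z < δ by rw [Real.dist_eq]; linarith)).trans (le_max_left _ _)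
  refine KEF.continuousAt_jumpFlux hf.invariant.levyη hf.invariant.levyU hz (δ := δ / 2)
    (K := max (f z + 1) 0) (by positivity) fun a b ha hab hb => ?_
  have hnn : 0 ≤ max (f z + 1) 0 * (b - a) := mul_nonneg (le_max_right _ _) (by linarith)
  rw [measureReal_def]
  refine ENNReal.toReal_le_of_le_ofReal hnn ?_
  rw [hμ, withDensity_apply _ measurableSet_Icc]
  calc ∫⁻ x in Icc a b, ENNReal.ofReal (f x)
      ≤ ∫⁻ x in Icc a b, ENNReal.ofReal (max (f z + 1) 0) :=
        setLIntegral_mono measurable_const fun x hx => ENNReal.ofReal_le_ofReal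
          (hK x (abs_le.2 ⟨by linarith [hx.1], by linarith [hx.2]⟩))
    _ = _ := by
        rw [setLIntegral_const, Real.volume_Icc, ENNReal.ofReal_mul (le_max_right _ _)]

lemma hasDerivAt_of_measure_zero (hf : IsStatDensity ση2 γη0 σU2 γU0 νη νU μ f) (h0 : μ {0} = 0)
    {z : ℝ} (hz : z ≠ 0) :
    HasDerivAt f ((driftCoef γη0 γU0 z * f z + jumpFlux νη νU μ z - σU2 * z * f z)
      / diffCoef ση2 σU2 z) z := by
  refine hf.hasDerivAt hz (intervalIntegral.integral_hasDerivAt_right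
    (intervalIntegrable_of_locallyIntegrable hf.locallyIntegrable_rhs)
    (hf.locallyIntegrable_rhs.aestronglyMeasurable.stronglyMeasurableAtFilter) ?_)
  exact ((continuous_driftCoef _ _).continuousAt.mul (hf.continuousAt hz)).add
    (hf.continuousAt_jumpFlux h0 hz)

lemma contDiffOn (hf : IsStatDensity ση2 γη0 σU2 γU0 νη νU μ f) (h0 : μ {0} = 0) :
    ContDiffOn ℝ 1 f {0}ᶜ := by
  have hopen : IsOpen ({0}ᶜ : Set ℝ) := isOpen_compl_singleton
  rw [contDiffOn_one_iff_derivWithin hopen.uniqueDiffOn]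
  refine ⟨fun z hz => (hf.hasDerivAt_of_measure_zero h0
    hz).differentiableAt.differentiableWithinAt, fun z hz => ?_⟩
  have hev : ∀ w ∈ ({0}ᶜ : Set ℝ), derivWithin f {0}ᶜ w =
      (driftCoef γη0 γU0 w * f w + jumpFlux νη νU μ w - σU2 * w * f w) / diffCoef ση2 σU2 w :=
    fun w hw => by
      rw [derivWithin_of_isOpen hopen hw, (hf.hasDerivAt_of_measure_zero h0 hw).deriv]
  refine ContinuousWithinAt.congr (ContinuousAt.continuousWithinAt ?_) hev (hev z hz)
  have h1 := hf.continuousAt hz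
  exact ((((continuous_driftCoef _ _).continuousAt.mul h1).add
    (hf.continuousAt_jumpFlux h0 hz)).sub
    ((continuousAt_const.mul continuousAt_id).mul h1)).div
    (continuous_diffCoef _ _).continuousAt (hf.pos hz).ne'

lemma integral_fluxKernel_mul (hν : νU (Iio (-1 : ℝ)) = 0) {z : ℝ} (hz : z ≠ 0) :
    ∫ x, fluxKernel (fun x y => x + x * y) νU z x * f x
      = (if 0 < z then ∫ x in Ioi (0 : ℝ), BUmapFV νU (z / x) * f x else 0)
      - (if z < 0 then ∫ x in Iio (0 : ℝ), BUmapFV νU (z / x) * f x else 0) := by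
  rcases lt_or_gt_of_ne hz with h | h
  · rw [if_neg h.not_gt, if_pos h, zero_sub, ← integral_indicator measurableSet_Iio,
      ← integral_neg]
    congr 1 with x
    rcases lt_trichotomy x 0 with hx | hx | hx
    · rw [indicator_of_mem (show x ∈ Iio 0 from hx)]
      have := fluxKernel_mul_neg (ν := νU) (-z) (-x)
      rw [neg_neg, neg_neg, fluxKernel_mul_pos_pos (x := -x) (z := -z) (by linarith) (by linarith),
        neg_div_neg_eq]
        at this
      rw [this]; ring
    · subst hx
      rw [fluxKernel_mul_zero]; simp
    · rw [fluxKernel_mul_pos_neg hν hx h, indicator_of_notMem (by simpa using hx.le)]; simp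
  · rw [if_pos h, if_neg h.not_gt, sub_zero, ← integral_indicator measurableSet_Ioi]
    congr 1 with x
    rcases lt_trichotomy x 0 with hx | hx | hx
    · have := fluxKernel_mul_neg (ν := νU) (-z) (-x)
      rw [neg_neg, neg_neg, fluxKernel_mul_pos_neg (x := -x) (z := -z) hν (by linarith)
        (by linarith)] at this
      rw [this, indicator_of_notMem (by simpa using hx.le)]; simp
    · subst hx
      rw [fluxKernel_mul_zero]; simp
    · rw [indicator_of_mem (show x ∈ Ioi 0 from hx), fluxKernel_mul_pos_pos hx h]

lemma densEq (hf : IsStatDensity ση2 γη0 σU2 γU0 νη νU μ f) {z : ℝ} (hz : z ≠ 0)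
    (hd : HasDerivAt f ((driftCoef γη0 γU0 z * f z + jumpFlux νη νU μ z - σU2 * z * f z)
      / diffCoef ση2 σU2 z) z)
    (h1 : Integrable (fluxKernel (fun x y => x + y) νη z) μ ∨ μ {0} = 0)
    (h2 : Integrable (fluxKernel (fun x y => x + x * y) νU z) μ ∨ μ {0} = 0) :
    densEqFV ση2 σU2 γη0 γU0 νη νU μ f z := by
  have e1 := hf.integral_eq h1
  have e2 := hf.integral_eq h2
  rw [integral_fluxKernel_mul hf.invariant.conc hz, fluxKernel_mul_zero] at e2
  simp only [fluxKernel_add, sub_zero] at e1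
  have hj : jumpFlux νη νU μ z = (∫ x, BmapFV νη (z - x) ∂μ)
      + ∫ x, fluxKernel (fun x y => x + x * y) νU z x ∂μ := by
    simp only [jumpFlux, flux, fluxKernel_add]
  rw [e1, e2] at hj
  have hne := (hf.pos hz).ne'
  unfold densEqFV
  have e3 : (ση2 / 2 + z ^ 2 * σU2 / 2) * deriv f z
      = driftCoef γη0 γU0 z * f z + jumpFlux νη νU μ z - σU2 * z * f z := by
    rw [hd.deriv, show ση2 / 2 + z ^ 2 * σU2 / 2 = diffCoef ση2 σU2 z by unfold diffCoef; ring,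
      mul_div_cancel₀ _ hne]
  rw [e3, hj]
  unfold driftCoef
  ring

end IsStatDensity

lemma IsJump.ae_integrable_fluxKernel {J : ℝ → ℝ → ℝ} {ν : Measure ℝ} (hJ : IsJump J)
    (hν : IsFVLevy ν) : ∀ᵐ z, Integrable (fluxKernel J ν z) μ := by
  have := hν.sigmaFinite
  have h : ∀ n : ℕ, ∀ᵐ z : ℝ, z ∈ Icc (-((n : ℝ) + 1)) (n + 1) →
      Integrable (fluxKernel J ν z) μ := fun n => by
    rw [← ae_restrict_iff' measurableSet_Icc]
    filter_upwards [(hJ.integrable_crossing (μ := μ) hν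
      (R := n + 1) (by linarith [n.cast_nonneg (α := ℝ)])).prod_left_ae] with z hz
    exact hz.integral_prod_left
  filter_upwards [ae_all_iff.2 h] with z hz
  obtain ⟨n, hn⟩ := exists_nat_ge |z|
  have := abs_le.1 hn
  exact hz n ⟨by linarith, by linarith⟩

lemma IsStatDensity.ae_densEq (hf : IsStatDensity ση2 γη0 σU2 γU0 νη νU μ f) :
    ∀ᵐ z, densEqFV ση2 σU2 γη0 γU0 νη νU μ f z := by
  have hne : ∀ᵐ x : ℝ, x ≠ 0 := by simp [ae_iff]
  filter_upwards [hne, hf.ae_hasDerivAt,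
    isJump_add.ae_integrable_fluxKernel (μ := μ) hf.invariant.levyη,
    isJump_mul.ae_integrable_fluxKernel (μ := μ) hf.invariant.levyU] with z hz h1 h2 h3
  exact hf.densEq hz h1 (Or.inl h2) (Or.inl h3)

end

/-- A smooth approximation of `exp (-k * |x|)`. -/
def smoothPeak (k δ x : ℝ) : ℝ := Real.exp (-(k * √(x ^ 2 + δ ^ 2)))

section
variable {k δ : ℝ}

lemma abs_le_sqrt_add_sq (x δ : ℝ) : |x| ≤ √(x ^ 2 + δ ^ 2) :=
  Real.abs_le_sqrt (by nlinarith [sq_nonneg δ])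

lemma smoothPeak_nonneg (k δ x : ℝ) : 0 ≤ smoothPeak k δ x := (Real.exp_pos _).le

lemma smoothPeak_le (hk : 0 ≤ k) (x : ℝ) : smoothPeak k δ x ≤ Real.exp (-(k * |x|)) :=
  Real.exp_le_exp.2 (neg_le_neg (mul_le_mul_of_nonneg_left (abs_le_sqrt_add_sq x δ) hk))

lemma sqrt_add_sq_pos (hδ : 0 < δ) (x : ℝ) : 0 < √(x ^ 2 + δ ^ 2) :=
  Real.sqrt_pos.2 (by positivity)

lemma hasDerivAt_sqrt_add_sq (hδ : 0 < δ) (x : ℝ) :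
    HasDerivAt (fun x => √(x ^ 2 + δ ^ 2)) (x / √(x ^ 2 + δ ^ 2)) x := by
  have h0 : x ^ 2 + δ ^ 2 ≠ 0 := by positivity
  refine (((hasDerivAt_pow 2 x).add_const (δ ^ 2)).sqrt h0).congr_deriv ?_
  have := (sqrt_add_sq_pos hδ x).ne'
  field_simp
  norm_num

lemma contDiff_smoothPeak (hδ : 0 < δ) : ContDiff ℝ (⊤ : ℕ∞) (smoothPeak k δ) := by
  have h1 : ContDiff ℝ (⊤ : ℕ∞) fun x : ℝ => √(x ^ 2 + δ ^ 2) :=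
    ContDiff.sqrt (by fun_prop) fun x => by positivity
  exact (contDiff_const.mul h1).neg.exp

lemma hasDerivAt_smoothPeak (hδ : 0 < δ) (x : ℝ) :
    HasDerivAt (smoothPeak k δ) (-(k * (x / √(x ^ 2 + δ ^ 2))) * smoothPeak k δ x) x := by
  refine (((hasDerivAt_sqrt_add_sq hδ x).const_mul k).fun_neg.exp).congr_deriv ?_
  unfold smoothPeak
  ring

lemma deriv_smoothPeak (hδ : 0 < δ) :
    deriv (smoothPeak k δ) = fun x => -(k * (x / √(x ^ 2 + δ ^ 2))) * smoothPeak k δ x :=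
  funext fun x => (hasDerivAt_smoothPeak hδ x).deriv

lemma deriv_deriv_smoothPeak (hδ : 0 < δ) (x : ℝ) :
    deriv (deriv (smoothPeak k δ)) x = (k ^ 2 * (x ^ 2 / √(x ^ 2 + δ ^ 2) ^ 2)
      - k * (δ ^ 2 / √(x ^ 2 + δ ^ 2) ^ 3)) * smoothPeak k δ x := by
  rw [deriv_smoothPeak hδ]
  have hr := (sqrt_add_sq_pos hδ x)
  have hr2 : √(x ^ 2 + δ ^ 2) ^ 2 = x ^ 2 + δ ^ 2 := Real.sq_sqrt (by positivity)
  have h := ((((hasDerivAt_id' x).fun_div (hasDerivAt_sqrt_add_sq hδ x) hr.ne').const_mul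
    k).fun_neg).fun_mul (hasDerivAt_smoothPeak (k := k) hδ x)
  rw [h.deriv]
  set r := √(x ^ 2 + δ ^ 2)
  have hne := hr.ne'
  have : δ ^ 2 = r ^ 2 - x ^ 2 := by linarith
  rw [this]
  field_simp
  ring

lemma mul_exp_neg_le (u : ℝ) : u * Real.exp (-u) ≤ 1 := by
  have h := Real.add_one_le_exp u
  rw [Real.exp_neg, ← div_eq_mul_inv, div_le_one (Real.exp_pos _)]
  linarith

lemma sq_mul_exp_neg_le {u : ℝ} (hu : 0 ≤ u) : u ^ 2 * Real.exp (-u) ≤ 2 := by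
  have h := Real.quadratic_le_exp_of_nonneg hu
  rw [Real.exp_neg, ← div_eq_mul_inv, div_le_iff₀ (Real.exp_pos _)]
  linarith

lemma abs_mul_deriv_smoothPeak_le (hk : 0 ≤ k) (hδ : 0 < δ) (x : ℝ) :
    |x * deriv (smoothPeak k δ) x| ≤ k * |x| * Real.exp (-(k * |x|)) := by
  rw [deriv_smoothPeak hδ]
  have hr := sqrt_add_sq_pos hδ x
  have h1 := smoothPeak_le (δ := δ) hk x
  have h0 := smoothPeak_nonneg k δ x
  have h2 : |x| / √(x ^ 2 + δ ^ 2) ≤ 1 := (div_le_one hr).2 (abs_le_sqrt_add_sq x δ)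
  rw [abs_mul, abs_mul, abs_neg, abs_mul, abs_div, abs_of_nonneg hk, abs_of_pos hr, abs_of_nonneg h0]
  calc |x| * (k * (|x| / √(x ^ 2 + δ ^ 2)) * smoothPeak k δ x)
      ≤ |x| * (k * 1 * Real.exp (-(k * |x|))) := by gcongr
    _ = _ := by ring

lemma abs_deriv_deriv_smoothPeak_le (hk : 0 ≤ k) (hδ : 0 < δ) (x : ℝ) :
    |deriv (deriv (smoothPeak k δ)) x| ≤ k ^ 2 + k / δ := by
  rw [deriv_deriv_smoothPeak hδ]
  have hr := sqrt_add_sq_pos hδ x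
  have hx : |x| ≤ √(x ^ 2 + δ ^ 2) := abs_le_sqrt_add_sq x δ
  have hd : δ ≤ √(x ^ 2 + δ ^ 2) := Real.le_sqrt_of_sq_le (by nlinarith [sq_nonneg x])
  have h0 := smoothPeak_nonneg k δ x
  have h1 : smoothPeak k δ x ≤ 1 := Real.exp_le_one_iff.2 (by
    have := mul_nonneg hk hr.le; linarith)
  set r := √(x ^ 2 + δ ^ 2)
  have e1 : x ^ 2 / r ^ 2 ≤ 1 := by
    rw [div_le_one (by positivity), ← sq_abs x]; gcongr
  have e2 : δ ^ 2 / r ^ 3 ≤ 1 / δ := by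
    rw [div_le_div_iff₀ (by positivity) hδ]
    calc δ ^ 2 * δ = δ ^ 3 := by ring
      _ ≤ r ^ 3 := by gcongr
      _ = _ := by ring
  rw [abs_mul, abs_of_nonneg h0]
  calc |k ^ 2 * (x ^ 2 / r ^ 2) - k * (δ ^ 2 / r ^ 3)| * smoothPeak k δ x
      ≤ (k ^ 2 * 1 + k * (1 / δ)) * 1 := by
        refine mul_le_mul ((abs_sub _ _).trans ?_) h1 h0 (by positivity)
        rw [abs_of_nonneg (by positivity), abs_of_nonneg (by positivity)]
        gcongr
    _ = _ := by ring

lemma abs_sq_mul_deriv_deriv_smoothPeak_le (hk : 0 ≤ k) (hδ : 0 < δ) (x : ℝ) :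
    |x ^ 2 * deriv (deriv (smoothPeak k δ)) x|
      ≤ ((k * |x|) ^ 2 + k * |x|) * Real.exp (-(k * |x|)) := by
  rw [deriv_deriv_smoothPeak hδ]
  have hr := sqrt_add_sq_pos hδ x
  have hx : |x| ≤ √(x ^ 2 + δ ^ 2) := abs_le_sqrt_add_sq x δ
  have hd : δ ≤ √(x ^ 2 + δ ^ 2) := Real.le_sqrt_of_sq_le (by nlinarith [sq_nonneg x])
  have h0 := smoothPeak_nonneg k δ x
  have h1 := smoothPeak_le (δ := δ) hk x
  set r := √(x ^ 2 + δ ^ 2)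
  have e1 : x ^ 2 / r ^ 2 ≤ 1 := by
    rw [div_le_one (by positivity), ← sq_abs x]; gcongr
  have e2 : x ^ 2 * (δ ^ 2 / r ^ 3) ≤ |x| := by
    rw [← mul_div_assoc, div_le_iff₀ (by positivity), ← sq_abs x]
    calc |x| ^ 2 * δ ^ 2 = |x| * (|x| * δ ^ 2) := by ring
      _ ≤ |x| * (r * r ^ 2) := by gcongr
      _ = _ := by ring
  rw [abs_mul, abs_mul, abs_of_nonneg h0, abs_of_nonneg (sq_nonneg x), ← mul_assoc]
  refine mul_le_mul ?_ h1 h0 (by positivity)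
  calc x ^ 2 * |k ^ 2 * (x ^ 2 / r ^ 2) - k * (δ ^ 2 / r ^ 3)|
      ≤ x ^ 2 * (k ^ 2 * (x ^ 2 / r ^ 2) + k * (δ ^ 2 / r ^ 3)) := by
        gcongr
        refine (abs_sub _ _).trans ?_
        rw [abs_of_nonneg (by positivity), abs_of_nonneg (by positivity)]
    _ = k ^ 2 * x ^ 2 * (x ^ 2 / r ^ 2) + k * (x ^ 2 * (δ ^ 2 / r ^ 3)) := by ring
    _ ≤ k ^ 2 * x ^ 2 * 1 + k * |x| := by gcongr
    _ = _ := by rw [mul_pow, sq_abs]; ring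

lemma isTame_smoothPeak (hk : 0 ≤ k) (hδ : 0 < δ) :
    IsTame (smoothPeak k δ) (k ^ 2 + k / δ + k + 4) := by
  have hnn : 0 ≤ k / δ := by positivity
  have hb : ∀ x, |smoothPeak k δ x| ≤ 1 := fun x => by
    rw [abs_of_nonneg (smoothPeak_nonneg _ _ _)]
    exact Real.exp_le_one_iff.2 (by
      have := mul_nonneg hk (sqrt_add_sq_pos hδ x).le; linarith)
  refine ⟨contDiff_smoothPeak hδ, fun x => (hb x).trans (by nlinarith), fun x => ?_,
    fun x => (abs_deriv_deriv_smoothPeak_le hk hδ x).trans (by linarith),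
    fun x => (abs_mul_deriv_smoothPeak_le hk hδ x).trans ((mul_exp_neg_le _).trans (by nlinarith)),
    fun x => (abs_sq_mul_deriv_deriv_smoothPeak_le hk hδ x).trans ?_⟩
  · rw [deriv_smoothPeak hδ]
    have hr := sqrt_add_sq_pos hδ x
    have h2 : |x| / √(x ^ 2 + δ ^ 2) ≤ 1 := (div_le_one hr).2 (abs_le_sqrt_add_sq x δ)
    rw [abs_mul, abs_neg, abs_mul, abs_div, abs_of_nonneg hk, abs_of_pos hr]
    have : k * (|x| / √(x ^ 2 + δ ^ 2)) * |smoothPeak k δ x| ≤ k * 1 * 1 := by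
      gcongr
      exact hb x
    nlinarith
  · have h1 := mul_exp_neg_le (k * |x|)
    have h2 := sq_mul_exp_neg_le (u := k * |x|) (by positivity)
    rw [add_mul]
    nlinarith

lemma sqrt_add_sq_sub_le (a b δ : ℝ) : √(b ^ 2 + δ ^ 2) - √(a ^ 2 + δ ^ 2) ≤ |b - a| := by
  rw [sub_le_iff_le_add']
  refine Real.sqrt_le_iff.2 ⟨by positivity, ?_⟩
  have h1 : √(a ^ 2 + δ ^ 2) ^ 2 = a ^ 2 + δ ^ 2 := Real.sq_sqrt (by positivity)
  have h2 := mul_le_mul_of_nonneg_right (abs_le_sqrt_add_sq a δ) (abs_nonneg (b - a))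
  have h3 : a * (b - a) ≤ |a| * |b - a| := by rw [← abs_mul]; exact le_abs_self _
  nlinarith [sq_abs (b - a)]

lemma abs_smoothPeak_sub_le (hk : 0 ≤ k) (a b : ℝ) :
    |smoothPeak k δ a - smoothPeak k δ b|
      ≤ min 1 (k * |a - b|) * (Real.exp (-(k * |a|)) + Real.exp (-(k * |b|))) := by
  wlog h : √(a ^ 2 + δ ^ 2) ≤ √(b ^ 2 + δ ^ 2) generalizing a b
  · have := this b a (le_of_not_ge h)
    rwa [abs_sub_comm, abs_sub_comm a b, add_comm (Real.exp _)]
  have hs := mul_le_mul_of_nonneg_left h hk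
  have hd := mul_le_mul_of_nonneg_left (sqrt_add_sq_sub_le a b δ) hk
  have hpos : 0 ≤ min 1 (k * |a - b|) := by positivity
  have e : smoothPeak k δ a - smoothPeak k δ b = smoothPeak k δ a
      * (1 - Real.exp (-(k * (√(b ^ 2 + δ ^ 2) - √(a ^ 2 + δ ^ 2))))) := by
    rw [mul_sub, mul_one]
    unfold smoothPeak
    rw [← Real.exp_add]
    congr 2
    ring
  have h1 : 1 - Real.exp (-(k * (√(b ^ 2 + δ ^ 2) - √(a ^ 2 + δ ^ 2)))) ≤ min 1 (k * |a - b|) := by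
    refine le_min (by linarith [Real.exp_pos (-(k * (√(b ^ 2 + δ ^ 2) - √(a ^ 2 + δ ^ 2))))]) ?_
    have := Real.one_sub_le_exp_neg (k * (√(b ^ 2 + δ ^ 2) - √(a ^ 2 + δ ^ 2)))
    rw [abs_sub_comm]
    linarith
  have h2 : 0 ≤ 1 - Real.exp (-(k * (√(b ^ 2 + δ ^ 2) - √(a ^ 2 + δ ^ 2)))) := by
    have : Real.exp (-(k * (√(b ^ 2 + δ ^ 2) - √(a ^ 2 + δ ^ 2)))) ≤ 1 :=
      Real.exp_le_one_iff.2 (by linarith)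
    linarith
  rw [e, abs_of_nonneg (mul_nonneg (smoothPeak_nonneg _ _ _) h2), mul_comm]
  refine mul_le_mul h1 ?_ (smoothPeak_nonneg _ _ _) hpos
  linarith [smoothPeak_le (δ := δ) hk a, Real.exp_pos (-(k * |b|))]

end

lemma integrable_exp_neg_abs : Integrable fun x : ℝ => Real.exp (-|x|) := by
  refine (integrable_inv_one_add_sq.const_mul 3).mono' (by fun_prop) (ae_of_all _ fun x => ?_)
  have h1 := sq_mul_exp_neg_le (abs_nonneg x)
  have h2 : Real.exp (-|x|) ≤ 1 := Real.exp_le_one_iff.2 (by simp)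
  rw [sq_abs] at h1
  rw [Real.norm_eq_abs, abs_of_pos (Real.exp_pos _), ← div_eq_mul_inv, le_div_iff₀ (by positivity)]
  linarith

/-- An integrable function charges small neighbourhoods uniformly little. -/
lemma eventually_integral_exp_mul_le {f : ℝ → ℝ} (hf : Integrable f) {ε : ℝ} (hε : 0 < ε) :
    ∀ᶠ n : ℕ in atTop, ∀ y, ∫ x, Real.exp (-((n + 1) * |x + y|)) * |f x| ≤ ε := by
  obtain ⟨g, hgc, hg, hgcont, hgi⟩ := hf.exists_hasCompactSupport_integral_sub_le (half_pos hε)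
  obtain ⟨K, hK⟩ := hgcont.bounded_above_of_compact_support hgc
  have hK0 : 0 ≤ K := (norm_nonneg _).trans (hK 0)
  set J := ∫ x : ℝ, Real.exp (-|x|)
  have hlim : Tendsto (fun n : ℕ => K * (((n : ℝ) + 1)⁻¹ * J)) atTop (𝓝 (K * (0 * J))) :=
    ((tendsto_inv_atTop_zero.comp (tendsto_atTop_add_const_right _ _
      tendsto_natCast_atTop_atTop)).mul_const J).const_mul K
  filter_upwards [hlim.eventually (eventually_le_nhds
    (show K * (0 * J) < ε / 2 by simpa using half_pos hε))] with n hn y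
  have hn0 : (0 : ℝ) < n + 1 := by positivity
  have e : ∀ x : ℝ, Real.exp (-(((n : ℝ) + 1) * |x + y|)) = Real.exp (-|(n + 1) * (x + y)|) :=
    fun x => by rw [abs_mul, abs_of_pos hn0]
  have hi0 : Integrable fun x : ℝ => Real.exp (-|((n : ℝ) + 1) * x|) :=
    integrable_exp_neg_abs.comp_mul_left' hn0.ne'
  have hi : Integrable fun x => Real.exp (-(((n : ℝ) + 1) * |x + y|)) := by
    simp only [e]
    exact hi0.comp_add_right y
  have hval : ∫ x, Real.exp (-(((n : ℝ) + 1) * |x + y|)) = ((n : ℝ) + 1)⁻¹ * J := by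
    simp only [e]
    rw [integral_add_right_eq_self (fun x => Real.exp (-|((n : ℝ) + 1) * x|)) y,
      Measure.integral_comp_mul_left (fun x => Real.exp (-|x|)), abs_of_pos (by positivity),
      smul_eq_mul]
  have hle : ∀ x, Real.exp (-(((n : ℝ) + 1) * |x + y|)) ≤ 1 := fun x =>
    Real.exp_le_one_iff.2 (by have := abs_nonneg (x + y); nlinarith)
  calc ∫ x, Real.exp (-((n + 1) * |x + y|)) * |f x|
      ≤ ∫ x, (‖f x - g x‖ + K * Real.exp (-((n + 1) * |x + y|))) := by
        refine integral_mono_of_nonneg (ae_of_all _ fun x => by positivity)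
          ((hf.sub hgi).norm.add (hi.const_mul K)) (ae_of_all _ fun x => ?_)
        have h1 : |f x| ≤ ‖f x - g x‖ + K := by
          have h2 := hK x
          rw [Real.norm_eq_abs] at h2 ⊢
          have := abs_add_le (f x - g x) (g x)
          rw [sub_add_cancel] at this
          linarith
        have h3 := hle x
        have h4 := Real.exp_pos (-(((n : ℝ) + 1) * |x + y|))
        have h5 := norm_nonneg (f x - g x)
        simp only
        nlinarith [mul_le_mul_of_nonneg_left h1 h4.le]
    _ = (∫ x, ‖f x - g x‖) + K * (((n : ℝ) + 1)⁻¹ * J) := by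
        rw [integral_add (f := fun x => ‖f x - g x‖) (hf.sub hgi).norm (hi.const_mul K),
          integral_const_mul, hval]
    _ ≤ ε := by linarith

lemma half_min_le_one_sub_exp {u : ℝ} (hu : 0 ≤ u) : min 1 u ≤ 2 * (1 - Real.exp (-u)) := by
  have h1 : 1 + u ≤ Real.exp u := by linarith [Real.add_one_le_exp u]
  have h2 : Real.exp (-u) ≤ (1 + u)⁻¹ := by
    rw [Real.exp_neg]; exact inv_anti₀ (by linarith) h1
  have h3 : (1 + u) * (1 + u)⁻¹ = 1 := mul_inv_cancel₀ (by linarith)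
  have h4 : 0 < (1 + u)⁻¹ := by positivity
  rcases le_total 1 u with h | h
  · rw [min_eq_left h]; nlinarith
  · rw [min_eq_right h]; nlinarith

lemma one_sub_exp_le_min (u : ℝ) : 1 - Real.exp (-u) ≤ min 1 u :=
  le_min (by linarith [Real.exp_pos (-u)]) (by linarith [Real.one_sub_le_exp_neg u])

lemma min_one_mul_le {k : ℝ} (hk : 1 ≤ k) (y : ℝ) : min 1 (k * |y|) ≤ k * min 1 |y| := by
  rw [mul_min_of_nonneg _ _ (by linarith)]
  exact min_le_min (by linarith) le_rfl

lemma IsFVLevy.integrable_min_mul {ν : Measure ℝ} (hν : IsFVLevy ν) {k : ℝ} (hk : 1 ≤ k) :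
    Integrable (fun y => min 1 (k * |y|)) ν :=
  hν.integrable_of_le (by fun_prop) k fun y => by
    rw [abs_of_nonneg (by positivity)]; exact min_one_mul_le hk y

lemma IsFVLevy.integrable_one_sub_exp {ν : Measure ℝ} (hν : IsFVLevy ν) {k : ℝ} (hk : 1 ≤ k) :
    Integrable (fun y => 1 - Real.exp (-(k * |y|))) ν :=
  (hν.integrable_min_mul hk).mono' (by fun_prop) (ae_of_all _ fun y => by
    have : Real.exp (-(k * |y|)) ≤ 1 := Real.exp_le_one_iff.2 (by
      have := abs_nonneg y; nlinarith)
    rw [Real.norm_eq_abs, abs_of_nonneg (by linarith)]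
    exact one_sub_exp_le_min _)

lemma IsFVLevy.measure_univ_le {ν : Measure ℝ} (hν : IsFVLevy ν) {c : ℕ → ℝ} {l : ℝ}
    (hL : ∀ᶠ n : ℕ in atTop, ∫ y, (1 - Real.exp (-((n + 1) * |y|))) ∂ν ≤ c n)
    (hc : Tendsto c atTop (𝓝 l)) : ν univ ≤ ENNReal.ofReal l := by
  have hk : ∀ n : ℕ, (1 : ℝ) ≤ n + 1 := fun n => by linarith [n.cast_nonneg (α := ℝ)]
  have h1 : ν univ ≤ ∫⁻ y, liminf (fun n : ℕ => ENNReal.ofReal (1 - Real.exp (-((n + 1) * |y|))))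
      atTop ∂ν := by
    rw [← setLIntegral_one, Measure.restrict_univ]
    refine lintegral_mono_ae ?_
    filter_upwards [measure_eq_zero_iff_ae_notMem.1 hν.zero] with y hy
    have hy' : 0 < |y| := abs_pos.2 hy
    have ht : Tendsto (fun n : ℕ => ((n : ℝ) + 1) * |y|) atTop atTop :=
      (tendsto_atTop_add_const_right _ _ tendsto_natCast_atTop_atTop).atTop_mul_const hy'
    have h2 : Tendsto (fun n : ℕ => ENNReal.ofReal (1 - Real.exp (-((n + 1) * |y|)))) atTop
        (𝓝 (ENNReal.ofReal (1 - 0))) :=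
      (ENNReal.continuous_ofReal.tendsto _).comp
        ((Real.tendsto_exp_neg_atTop_nhds_zero.comp ht).const_sub 1)
    rw [h2.liminf_eq]; simp
  refine h1.trans ((lintegral_liminf_le fun n => by fun_prop).trans ?_)
  have h3 : Tendsto (fun n => ENNReal.ofReal (c n)) atTop (𝓝 (ENNReal.ofReal l)) :=
    (ENNReal.continuous_ofReal.tendsto _).comp hc
  rw [← h3.liminf_eq]
  refine liminf_le_liminf ?_
  filter_upwards [hL] with n hn
  rw [← ofReal_integral_eq_lintegral_ofReal (hν.integrable_one_sub_exp (hk n))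
    (ae_of_all _ fun y => ?_)]
  · exact ENNReal.ofReal_le_ofReal hn
  · have : Real.exp (-(((n : ℝ) + 1) * |y|)) ≤ 1 := Real.exp_le_one_iff.2 (by
      have := abs_nonneg y; nlinarith [hk n])
    simp only [Pi.zero_apply]; linarith

/-- A bound for the increments of the smooth peaks under multiplicative jumps. -/
def mulJumpBound (k x y : ℝ) : ℝ :=
  min 1 (k * |x * y|) * (Real.exp (-(k * |x + x * y|)) + Real.exp (-(k * |x|)))

/-- A bound for the part of the generator driven by the multiplicative process on smooth peaks. -/
def peakBound (σU2 γU0 : ℝ) (νU : Measure ℝ) (k x : ℝ) : ℝ :=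
  |γU0| * (k * |x| * Real.exp (-(k * |x|)))
    + σU2 / 2 * (((k * |x|) ^ 2 + k * |x|) * Real.exp (-(k * |x|)))
    + ∫ y, mulJumpBound k x y ∂νU

lemma continuous_mulJumpBound (k : ℝ) : Continuous fun p : ℝ × ℝ => mulJumpBound k p.1 p.2 := by
  unfold mulJumpBound; fun_prop

section
variable {k : ℝ}

lemma mulJumpBound_nonneg (hk : 0 ≤ k) (x y : ℝ) : 0 ≤ mulJumpBound k x y := by
  unfold mulJumpBound; positivity

lemma mulJumpBound_le (hk : 0 ≤ k) (x y : ℝ) : mulJumpBound k x y ≤ 4 * min 1 |y| := by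
  unfold mulJumpBound
  have hu : 0 ≤ k * |x| := by positivity
  have e1 : Real.exp (-(k * |x|)) ≤ 1 := Real.exp_le_one_iff.2 (by linarith)
  have e2 : Real.exp (-(k * |x + x * y|)) ≤ 1 := Real.exp_le_one_iff.2 (by
    have : 0 ≤ k * |x + x * y| := by positivity
    linarith)
  rcases le_or_gt |y| (1 / 2) with hy | hy
  · rw [min_eq_right (show |y| ≤ 1 by linarith)]
    have h1 : k * |x| / 2 ≤ k * |x + x * y| := by
      have : |x| / 2 ≤ |x + x * y| := by
        rw [show x + x * y = x * (1 + y) by ring, abs_mul]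
        have : 1 / 2 ≤ |1 + y| := by
          have := abs_le.1 hy
          rw [abs_of_pos (by linarith)]; linarith
        nlinarith [abs_nonneg x]
      calc k * |x| / 2 = k * (|x| / 2) := by ring
        _ ≤ _ := by gcongr
    have h2 : Real.exp (-(k * |x + x * y|)) ≤ Real.exp (-(k * |x| / 2)) :=
      Real.exp_le_exp.2 (by linarith)
    have h3 : Real.exp (-(k * |x|)) ≤ Real.exp (-(k * |x| / 2)) := Real.exp_le_exp.2 (by linarith)
    have h4 := mul_exp_neg_le (k * |x| / 2)
    calc min 1 (k * |x * y|) * (Real.exp (-(k * |x + x * y|)) + Real.exp (-(k * |x|)))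
        ≤ (k * |x * y|) * (Real.exp (-(k * |x| / 2)) + Real.exp (-(k * |x| / 2))) := by
          gcongr
          exact min_le_right _ _
      _ = 4 * |y| * (k * |x| / 2 * Real.exp (-(k * |x| / 2))) := by rw [abs_mul]; ring
      _ ≤ 4 * |y| * 1 := by gcongr
      _ = _ := by ring
  · have h1 : 1 / 2 ≤ min 1 |y| := le_min (by norm_num) hy.le
    calc min 1 (k * |x * y|) * (Real.exp (-(k * |x + x * y|)) + Real.exp (-(k * |x|)))
        ≤ 1 * (1 + 1) := by
          gcongr
          exact min_le_left _ _
      _ ≤ _ := by linarith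

lemma IsFVLevy.integrable_mulJumpBound {ν : Measure ℝ} (hν : IsFVLevy ν) (hk : 0 ≤ k) (x : ℝ) :
    Integrable (mulJumpBound k x) ν :=
  hν.integrable_of_le (by
    have := (continuous_mulJumpBound k).comp (Continuous.prodMk_right x)
    exact this.aestronglyMeasurable) 4 fun y => by
    rw [abs_of_nonneg (mulJumpBound_nonneg hk x y)]; exact mulJumpBound_le hk x y

variable {σU2 γU0 : ℝ} {νη νU μ : Measure ℝ}

lemma stronglyMeasurable_peakBound (hU : IsFVLevy νU) :
    StronglyMeasurable (peakBound σU2 γU0 νU k) := by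
  have := hU.sigmaFinite
  refine StronglyMeasurable.add (Continuous.stronglyMeasurable (by fun_prop)) ?_
  exact StronglyMeasurable.integral_prod_right (f := fun x y => mulJumpBound k x y)
    (continuous_mulJumpBound k).stronglyMeasurable

lemma abs_peakBound_le (hσ : 0 ≤ σU2) (hU : IsFVLevy νU) (hk : 0 ≤ k) (x : ℝ) :
    |peakBound σU2 γU0 νU k x| ≤ |γU0| + σU2 / 2 * 3 + 4 * ∫ y, min 1 |y| ∂νU := by
  have h1 := mul_exp_neg_le (k * |x|)
  have h2 := sq_mul_exp_neg_le (u := k * |x|) (by positivity)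
  have h3 : ((k * |x|) ^ 2 + k * |x|) * Real.exp (-(k * |x|)) ≤ 3 := by rw [add_mul]; linarith
  have h4 := hU.abs_integral_le (g := mulJumpBound k x) 4 fun y => by
    rw [abs_of_nonneg (mulJumpBound_nonneg hk x y)]; exact mulJumpBound_le hk x y
  have h5 : 0 ≤ ∫ y, mulJumpBound k x y ∂νU := integral_nonneg fun y => mulJumpBound_nonneg hk x y
  rw [abs_of_nonneg h5] at h4
  unfold peakBound
  rw [abs_of_nonneg (by positivity)]
  calc _ ≤ |γU0| * 1 + σU2 / 2 * 3 + 4 * ∫ y, min 1 |y| ∂νU := by gcongr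
    _ = _ := by ring

lemma abs_mul_part_le (hσ : 0 ≤ σU2) (hU : IsFVLevy νU) (hk : 0 ≤ k) {δ : ℝ} (hδ : 0 < δ) (x : ℝ) :
    |γU0 * x * deriv (smoothPeak k δ) x + σU2 / 2 * x ^ 2 * deriv (deriv (smoothPeak k δ)) x
      + ∫ y, (smoothPeak k δ (x + x * y) - smoothPeak k δ x) ∂νU| ≤ peakBound σU2 γU0 νU k x := by
  refine (abs_add_le _ _).trans (add_le_add ((abs_add_le _ _).trans (add_le_add ?_ ?_)) ?_)
  · rw [mul_assoc, abs_mul]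
    gcongr
    exact abs_mul_deriv_smoothPeak_le hk hδ x
  · rw [mul_assoc, abs_mul, abs_of_nonneg (by positivity : 0 ≤ σU2 / 2)]
    gcongr
    exact abs_sq_mul_deriv_deriv_smoothPeak_le hk hδ x
  · rw [← Real.norm_eq_abs]
    refine norm_integral_le_of_norm_le (hU.integrable_mulJumpBound hk x) (ae_of_all _ fun y => ?_)
    have := abs_smoothPeak_sub_le (δ := δ) hk (x + x * y) x
    rwa [add_sub_cancel_left] at this

lemma tendsto_mul_exp (x : ℝ) : Tendsto (fun n : ℕ => (((n : ℝ) + 1) * |x|)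
    * Real.exp (-(((n : ℝ) + 1) * |x|))) atTop (𝓝 0) ∧
    Tendsto (fun n : ℕ => (((n : ℝ) + 1) * |x|) ^ 2
    * Real.exp (-(((n : ℝ) + 1) * |x|))) atTop (𝓝 0) := by
  by_cases hx : x = 0
  · simp [hx]
  have ht : Tendsto (fun n : ℕ => ((n : ℝ) + 1) * |x|) atTop atTop :=
    (tendsto_atTop_add_const_right _ _ tendsto_natCast_atTop_atTop).atTop_mul_const (abs_pos.2 hx)
  have h1 := (Real.tendsto_pow_mul_exp_neg_atTop_nhds_zero 1).comp ht
  have h2 := (Real.tendsto_pow_mul_exp_neg_atTop_nhds_zero 2).comp ht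
  simp only [pow_one] at h1
  exact ⟨h1, h2⟩

lemma tendsto_mulJumpBound (x : ℝ) {y : ℝ} (hy : y ≠ -1) :
    Tendsto (fun n : ℕ => mulJumpBound ((n : ℝ) + 1) x y) atTop (𝓝 0) := by
  by_cases hx : x = 0
  · simp [hx, mulJumpBound]
  have ht : ∀ {w : ℝ}, w ≠ 0 →
      Tendsto (fun n : ℕ => Real.exp (-(((n : ℝ) + 1) * |w|))) atTop (𝓝 0) := fun hw =>
    Real.tendsto_exp_neg_atTop_nhds_zero.comp ((tendsto_atTop_add_const_right _ _
      tendsto_natCast_atTop_atTop).atTop_mul_const (abs_pos.2 hw))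
  have hxy : x + x * y ≠ 0 := by
    rw [show x + x * y = x * (y - -1) by ring]
    exact mul_ne_zero hx (sub_ne_zero.2 hy)
  have h1 := (ht hxy).add (ht hx)
  rw [add_zero] at h1
  refine squeeze_zero (fun n => mulJumpBound_nonneg (by positivity) x y) (fun n => ?_) h1
  unfold mulJumpBound
  exact mul_le_of_le_one_left (by positivity) (min_le_left _ _)

lemma tendsto_integral_peakBound [IsProbabilityMeasure μ] (hσ : 0 ≤ σU2) (hU : IsFVLevy νU)
    (hp : νU {-1} = 0) :
    Tendsto (fun n : ℕ => ∫ x, peakBound σU2 γU0 νU ((n : ℝ) + 1) x ∂μ) atTop (𝓝 0) := by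
  have hlim : ∀ x, Tendsto (fun n : ℕ => peakBound σU2 γU0 νU ((n : ℝ) + 1) x) atTop (𝓝 0) := by
    intro x
    obtain ⟨h1, h2⟩ := tendsto_mul_exp x
    have h3 : Tendsto (fun n : ℕ => ∫ y, mulJumpBound ((n : ℝ) + 1) x y ∂νU) atTop
        (𝓝 (∫ y, 0 ∂νU)) := by
      refine tendsto_integral_of_dominated_convergence (fun y => 4 * min 1 |y|)
        (fun n => (hU.integrable_mulJumpBound (by positivity) x).aestronglyMeasurable)
        (hU.integrable.const_mul _) (fun n => ae_of_all _ fun y => ?_) ?_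
      · rw [Real.norm_eq_abs, abs_of_nonneg (mulJumpBound_nonneg (by positivity) x y)]
        exact mulJumpBound_le (by positivity) x y
      · filter_upwards [measure_eq_zero_iff_ae_notMem.1 hp] with y hy
        exact tendsto_mulJumpBound x hy
    have h4 := ((h1.const_mul |γU0|).add ((h2.add h1).const_mul (σU2 / 2))).add h3
    simp only [integral_zero, add_zero, mul_zero, ← add_mul] at h4
    exact h4
  have h := tendsto_integral_of_dominated_convergence (μ := μ)
    (F := fun (n : ℕ) x => peakBound σU2 γU0 νU ((n : ℝ) + 1) x) (f := fun _ => 0)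
    (fun _ => |γU0| + σU2 / 2 * 3 + 4 * ∫ y, min 1 |y| ∂νU)
    (fun n => (stronglyMeasurable_peakBound hU).aestronglyMeasurable) (integrable_const _)
    (fun n => ae_of_all _ fun x => abs_peakBound_le hσ hU (by positivity) x) (ae_of_all _ hlim)
  simpa using h

lemma tendsto_smoothPeak (k y : ℝ) : Tendsto (fun n : ℕ => smoothPeak k (1 / ((n : ℝ) + 1)) y)
    atTop (𝓝 (Real.exp (-(k * |y|)))) := by
  have hc : Continuous fun δ => smoothPeak k δ y := by unfold smoothPeak; fun_prop
  have h := (hc.tendsto 0).comp tendsto_one_div_add_atTop_nhds_zero_nat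
  simp only [smoothPeak, ne_eq, OfNat.ofNat_ne_zero, not_false_eq_true, zero_pow, add_zero,
    Real.sqrt_sq_eq_abs] at h
  exact h

end

section
variable {γη0 σU2 γU0 : ℝ} {νη νU μ : Measure ℝ} [IsProbabilityMeasure μ] {f : ℝ → ℝ}

lemma IsStatDensity.abs_integral_increments_le (hf : IsStatDensity 0 γη0 σU2 γU0 νη νU μ f)
    {k κ δ : ℝ} (hk : 1 ≤ k) (hδ : 0 < δ) (hκ : ∀ y, ∫ x, Real.exp (-(k * |x + y|)) * |f x| ≤ κ) :
    |∫ x, (∫ y, (smoothPeak k δ (x + y) - smoothPeak k δ x) ∂νη) * f x|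
      ≤ 2 * κ * ∫ y, min 1 (k * |y|) ∂νη := by
  have hη := hf.invariant.levyη
  have := hη.sigmaFinite
  have hk0 : 0 ≤ k := by linarith
  have ht := isTame_smoothPeak hk0 hδ
  have hcont := ht.continuous
  set C := k ^ 2 + k / δ + k + 4
  have hint : Integrable (Function.uncurry fun x y =>
      (smoothPeak k δ (x + y) - smoothPeak k δ x) * f x) (volume.prod νη) := by
    have hdom := hf.integrable.norm.mul_prod (hη.integrable.const_mul (4 * C))
    refine hdom.mono' ?_ (ae_of_all _ fun p => ?_)
    · exact (Continuous.aestronglyMeasurable (by fun_prop)).mul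
        hf.aestronglyMeasurable.comp_fst
    · simp only [Function.uncurry, norm_mul, Real.norm_eq_abs]
      rw [mul_comm]
      exact mul_le_mul_of_nonneg_left (ht.abs_add_sub_le _ _) (abs_nonneg _)
  simp only [← integral_mul_const]
  rw [integral_integral_swap hint, ← integral_const_mul]
  rw [← Real.norm_eq_abs]
  refine norm_integral_le_of_norm_le ((hη.integrable_min_mul hk).const_mul _)
    (ae_of_all _ fun y => ?_)
  have hi : ∀ y, Integrable fun x => Real.exp (-(k * |x + y|)) * |f x| := fun y =>
    hf.integrable.norm.mono' ((Continuous.aestronglyMeasurable (by fun_prop)).mul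
      hf.aestronglyMeasurable.norm) (ae_of_all _ fun x => by
        rw [norm_mul, Real.norm_eq_abs |f x|, abs_abs, Real.norm_eq_abs, abs_of_pos (Real.exp_pos _),
          Real.norm_eq_abs (f x)]
        refine mul_le_of_le_one_left (abs_nonneg _) (Real.exp_le_one_iff.2 ?_)
        have : 0 ≤ k * |x + y| := by positivity
        linarith)
  have h0 := hi 0
  have hκ0 := hκ 0
  simp only [add_zero] at h0 hκ0
  calc ‖∫ x, (smoothPeak k δ (x + y) - smoothPeak k δ x) * f x‖
      ≤ ∫ x, min 1 (k * |y|) * (Real.exp (-(k * |x + y|)) * |f x|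
        + Real.exp (-(k * |x|)) * |f x|) := by
        refine norm_integral_le_of_norm_le (((hi y).add h0).const_mul _) (ae_of_all _ fun x => ?_)
        rw [norm_mul, Real.norm_eq_abs, Real.norm_eq_abs, ← add_mul, ← mul_assoc]
        gcongr
        have := abs_smoothPeak_sub_le (δ := δ) hk0 (x + y) x
        rwa [add_sub_cancel_left] at this
    _ = min 1 (k * |y|) * ((∫ x, Real.exp (-(k * |x + y|)) * |f x|)
        + ∫ x, Real.exp (-(k * |x|)) * |f x|) := by
        rw [integral_const_mul, integral_add (hi y) h0]
    _ ≤ min 1 (k * |y|) * (κ + κ) := by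
        gcongr
        exact hκ y
    _ = _ := by ring

lemma IsStatDensity.atom_le_smooth (hf : IsStatDensity 0 0 σU2 γU0 νη νU μ f)
    {k κ δ : ℝ} (hk : 1 ≤ k) (hδ : 0 < δ) (hκ : ∀ y, ∫ x, Real.exp (-(k * |x + y|)) * |f x| ≤ κ) :
    (μ {0}).toReal * ∫ y, (smoothPeak k δ 0 - smoothPeak k δ y) ∂νη
      ≤ (∫ x, peakBound σU2 γU0 νU k x ∂μ) + 2 * κ * ∫ y, min 1 (k * |y|) ∂νη := by
  have hη := hf.invariant.levyη
  have hU := hf.invariant.levyU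
  have hσ := hf.invariant.σU_nonneg
  have := hη.sigmaFinite
  have hk0 : 0 ≤ k := by linarith
  have ht := isTame_smoothPeak hk0 hδ
  have hzero := integral_fvGen_eq_zero hη hU hf.invariant.inv ht
  have hgen := integrable_fvGen (μ := μ) (ση2 := 0) (γη0 := 0) (σU2 := σU2) (γU0 := γU0) hη hU ht
  have hB : Integrable (fun x => ∫ y, (smoothPeak k δ (x + y) - smoothPeak k δ x) ∂νη) μ :=
    Integrable.of_bound (measurable_integral_add_sub ht.continuous).aestronglyMeasurable _
      (ae_of_all _ fun x => hη.abs_integral_le _ (ht.abs_add_sub_le x))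
  have hA := hgen.sub hB
  have hP : Integrable (peakBound σU2 γU0 νU k) μ :=
    Integrable.of_bound (stronglyMeasurable_peakBound hU).aestronglyMeasurable _
      (ae_of_all _ fun x => abs_peakBound_le hσ hU hk0 x)
  have h1 := integral_sub hgen hB
  rw [hzero, zero_sub, hf.integral_eq (Or.inl hB)] at h1
  have h2 := hf.abs_integral_increments_le hk hδ hκ
  have h3 : |∫ x, (fvGen 0 0 σU2 γU0 νη νU (smoothPeak k δ) x
      - ∫ y, (smoothPeak k δ (x + y) - smoothPeak k δ x) ∂νη) ∂μ|
      ≤ ∫ x, peakBound σU2 γU0 νU k x ∂μ := by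
    rw [← Real.norm_eq_abs]
    refine norm_integral_le_of_norm_le hP (ae_of_all _ fun x => ?_)
    refine le_trans (le_of_eq ?_) (abs_mul_part_le (γU0 := γU0) hσ hU hk0 hδ x)
    rw [Real.norm_eq_abs]
    congr 1
    unfold fvGen
    ring
  rw [h1] at h3
  have h4 := (abs_le.1 h2).2
  have h5 := (abs_le.1 h3).2
  have h6 : ∫ y, (smoothPeak k δ (0 + y) - smoothPeak k δ 0) ∂νη
      = -∫ y, (smoothPeak k δ 0 - smoothPeak k δ y) ∂νη := by
    rw [← integral_neg]; simp
  rw [h6] at h5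
  linarith

lemma IsStatDensity.atom_le (hf : IsStatDensity 0 0 σU2 γU0 νη νU μ f)
    {k κ : ℝ} (hk : 1 ≤ k) (hκ : ∀ y, ∫ x, Real.exp (-(k * |x + y|)) * |f x| ≤ κ) :
    (μ {0}).toReal * ∫ y, (1 - Real.exp (-(k * |y|))) ∂νη
      ≤ (∫ x, peakBound σU2 γU0 νU k x ∂μ) + 2 * κ * ∫ y, min 1 (k * |y|) ∂νη := by
  have hη := hf.invariant.levyη
  have hk0 : 0 ≤ k := by linarith
  have hlim : Tendsto (fun n : ℕ => ∫ y, (smoothPeak k (1 / ((n : ℝ) + 1)) 0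
      - smoothPeak k (1 / ((n : ℝ) + 1)) y) ∂νη) atTop
      (𝓝 (∫ y, (1 - Real.exp (-(k * |y|))) ∂νη)) := by
    refine tendsto_integral_of_dominated_convergence (fun y => 2 * min 1 (k * |y|)) (fun n => ?_)
      ((hη.integrable_min_mul hk).const_mul 2) (fun n => ae_of_all _ fun y => ?_)
      (ae_of_all _ fun y => ?_)
    · have := (isTame_smoothPeak hk0 (δ := 1 / ((n : ℝ) + 1)) (by positivity)).continuous
      exact Continuous.aestronglyMeasurable (by fun_prop)
    · have h1 := abs_smoothPeak_sub_le (δ := 1 / ((n : ℝ) + 1)) hk0 0 y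
      have h2 : Real.exp (-(k * |y|)) ≤ 1 := Real.exp_le_one_iff.2 (by
        have : 0 ≤ k * |y| := by positivity
        linarith)
      rw [zero_sub, abs_neg, abs_zero, mul_zero, neg_zero, Real.exp_zero] at h1
      refine h1.trans ?_
      rw [mul_comm 2]
      gcongr
      linarith
    · have h := (tendsto_smoothPeak k 0).sub (tendsto_smoothPeak k y)
      simpa using h
  exact le_of_tendsto' (hlim.const_mul _) fun n => hf.atom_le_smooth hk (by positivity) hκ

/-- The mass balance at `0`: a stationary law charging `0` compensates the total jump intensity. -/
lemma IsStatDensity.eventually_atom_le (hf : IsStatDensity 0 0 σU2 γU0 νη νU μ f)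
    (h0 : μ {0} ≠ 0) : ∀ᶠ n : ℕ in atTop, ∫ y, (1 - Real.exp (-((n + 1) * |y|))) ∂νη
      ≤ 2 / (μ {0}).toReal * ∫ x, peakBound σU2 γU0 νU ((n : ℝ) + 1) x ∂μ := by
  have hη := hf.invariant.levyη
  have hm : 0 < (μ {0}).toReal := ENNReal.toReal_pos h0 (measure_ne_top _ _)
  filter_upwards [eventually_integral_exp_mul_le hf.integrable
    (show 0 < (μ {0}).toReal / 8 by positivity)] with n hn
  have hk : (1 : ℝ) ≤ n + 1 := by linarith [n.cast_nonneg (α := ℝ)]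
  have h1 := hf.atom_le hk hn
  have h2 : ∫ y, min 1 (((n : ℝ) + 1) * |y|) ∂νη
      ≤ 2 * ∫ y, (1 - Real.exp (-(((n : ℝ) + 1) * |y|))) ∂νη := by
    rw [← integral_const_mul]
    exact integral_mono (hη.integrable_min_mul hk) ((hη.integrable_one_sub_exp hk).const_mul 2)
      fun y => half_min_le_one_sub_exp (by positivity)
  rw [div_mul_eq_mul_div, le_div_iff₀ hm]
  nlinarith [mul_le_mul_of_nonneg_left h2 hm.le]

lemma IsStatDensity.measure_univ_lt_top (hf : IsStatDensity 0 0 σU2 γU0 νη νU μ f)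
    (h0 : μ {0} ≠ 0) : νη univ < ⊤ := by
  refine (hf.invariant.levyη.measure_univ_le ?_ (tendsto_const_nhds (x := 2 / (μ {0}).toReal
    * (|γU0| + σU2 / 2 * 3 + 4 * ∫ y, min 1 |y| ∂νU)))).trans_lt ENNReal.ofReal_lt_top
  filter_upwards [hf.eventually_atom_le h0] with n hn
  refine hn.trans (mul_le_mul_of_nonneg_left ?_ (by positivity))
  have h := norm_integral_le_of_norm_le_const (μ := μ)
    (f := peakBound σU2 γU0 νU ((n : ℝ) + 1)) (ae_of_all _ fun x => abs_peakBound_le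
    (γU0 := γU0) hf.invariant.σU_nonneg hf.invariant.levyU (k := (n : ℝ) + 1) (by positivity) x)
  simpa using (le_abs_self _).trans h

lemma IsStatDensity.eq_zero_of_atom (hf : IsStatDensity 0 0 σU2 γU0 νη νU μ f)
    (h0 : μ {0} ≠ 0) (hp : νU {-1} = 0) : νη = 0 := by
  have h := hf.invariant.levyη.measure_univ_le (hf.eventually_atom_le h0)
    ((tendsto_integral_peakBound hf.invariant.σU_nonneg hf.invariant.levyU hp).const_mul _)
  simpa using h

/-- The drift at an atom in `0` vanishes. -/
lemma IsFVInvariant.drift_mul_atom (h : IsFVInvariant 0 γη0 σU2 γU0 νη νU μ) :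
    γη0 * (μ {0}).toReal = 0 := by
  let χ : ContDiffBump (0 : ℝ) := ⟨1, 2, one_pos, one_lt_two⟩
  have hχ : ContDiff ℝ (⊤ : ℕ∞) χ := χ.contDiff
  have hχ' : Continuous (deriv χ) := hχ.continuous_deriv (by simp)
  have hc := χ.hasCompactSupport
  obtain ⟨M, hM⟩ := (show Continuous fun u => u ^ 2 * deriv χ u by
    fun_prop).bounded_above_of_compact_support hc.deriv.mul_left
  obtain ⟨N, hN⟩ := (show Continuous fun u => u * χ u by
    have := hχ.continuous; fun_prop).bounded_above_of_compact_support hc.mul_left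
  have hk : ∀ n : ℕ, (0 : ℝ) < n + 1 := fun n => by positivity
  have hk1 : ∀ n : ℕ, (1 : ℝ) ≤ n + 1 := fun n => by linarith [n.cast_nonneg (α := ℝ)]
  have hinv : Tendsto (fun n : ℕ => σU2 / 2 * M * (1 / ((n : ℝ) + 1))) atTop (𝓝 0) := by
    simpa using tendsto_one_div_add_atTop_nhds_zero_nat.const_mul (σU2 / 2 * M)
  have hpt : ∀ x : ℝ, x ≠ 0 → Tendsto (fun n : ℕ => χ (((n : ℝ) + 1) * x)) atTop (𝓝 0) := by
    intro x hx
    have ht : Tendsto (fun n : ℕ => ((n : ℝ) + 1) * |x|) atTop atTop :=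
      (tendsto_atTop_add_const_right _ _ tendsto_natCast_atTop_atTop).atTop_mul_const
        (abs_pos.2 hx)
    refine tendsto_const_nhds.congr' ?_
    filter_upwards [ht.eventually_ge_atTop 2] with n hn
    refine (χ.zero_of_le_dist ?_).symm
    rw [Real.dist_eq, sub_zero, abs_mul, abs_of_pos (hk n)]
    exact hn
  have hsm : ∀ n : ℕ, ContDiff ℝ (⊤ : ℕ∞) fun x => χ (((n : ℝ) + 1) * x) := fun n =>
    hχ.comp (contDiff_const.mul contDiff_id)
  have hcs : ∀ n : ℕ, HasCompactSupport fun x => χ (((n : ℝ) + 1) * x) := fun n =>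
    hc.comp_homeomorph (Homeomorph.mulLeft₀ _ (hk n).ne')
  have t1 : Tendsto (fun n : ℕ => ∫ x, diffCoef 0 σU2 x
      * deriv (fun x => χ (((n : ℝ) + 1) * x)) x ∂μ) atTop (𝓝 0) := by
    refine squeeze_zero_norm (fun n => ?_) hinv
    refine (norm_integral_le_of_norm_le_const (C := σU2 / 2 * M * (1 / ((n : ℝ) + 1)))
      (ae_of_all _ fun x => ?_)).trans (by simp)
    have e : deriv (fun x => χ (((n : ℝ) + 1) * x)) x
        = ((n : ℝ) + 1) * deriv χ (((n : ℝ) + 1) * x) := deriv_comp_mul_left _ χ x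
    have e2 : diffCoef 0 σU2 x * (((n : ℝ) + 1) * deriv χ (((n : ℝ) + 1) * x)) = σU2 / 2
        * ((((n : ℝ) + 1) * x) ^ 2 * deriv χ (((n : ℝ) + 1) * x)) * (1 / ((n : ℝ) + 1)) := by
      unfold diffCoef
      have := (hk n).ne'
      field_simp
      ring
    have hσ := h.σU_nonneg
    rw [e, e2, norm_mul, norm_mul, Real.norm_of_nonneg (by positivity : 0 ≤ σU2 / 2),
      Real.norm_of_nonneg (by positivity : 0 ≤ 1 / ((n : ℝ) + 1))]
    gcongr
    exact hM _
  have t2 : Tendsto (fun n : ℕ => ∫ x, driftCoef γη0 γU0 x * χ (((n : ℝ) + 1) * x) ∂μ) atTop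
      (𝓝 (∫ x, ({0} : Set ℝ).indicator (fun _ => γη0) x ∂μ)) := by
    refine tendsto_integral_of_dominated_convergence (fun _ => |γη0| + |γU0| * N)
      (fun n => (((continuous_driftCoef _ _).mul (hsm n).continuous)).aestronglyMeasurable)
      (integrable_const _) (fun n => ae_of_all _ fun x => ?_) (ae_of_all _ fun x => ?_)
    · have h1 : |x * χ (((n : ℝ) + 1) * x)| ≤ N := by
        refine le_trans ?_ (hN (((n : ℝ) + 1) * x))
        rw [norm_mul, Real.norm_eq_abs, Real.norm_eq_abs, abs_mul, abs_mul, abs_of_pos (hk n)]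
        refine mul_le_mul_of_nonneg_right ?_ (abs_nonneg _)
        nlinarith [hk1 n, abs_nonneg x]
      have h2 : |χ (((n : ℝ) + 1) * x)| ≤ 1 := by
        rw [abs_of_nonneg χ.nonneg]; exact χ.le_one
      have e : driftCoef γη0 γU0 x * χ (((n : ℝ) + 1) * x)
          = γη0 * χ (((n : ℝ) + 1) * x) + γU0 * (x * χ (((n : ℝ) + 1) * x)) := by
        unfold driftCoef; ring
      rw [e]
      refine (abs_add_le _ _).trans ?_
      rw [abs_mul, abs_mul γU0]
      refine add_le_add (mul_le_of_le_one_right (abs_nonneg _) h2) ?_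
      gcongr
    · by_cases hx : x = 0
      · subst hx
        have : χ (0 : ℝ) = 1 :=
          χ.one_of_mem_closedBall (Metric.mem_closedBall_self χ.rIn_pos.le)
        simp [driftCoef, this]
      · have := (hpt x hx).const_mul (driftCoef γη0 γU0 x)
        rw [mul_zero] at this
        rwa [indicator_of_notMem (by simpa using hx)]
  have t3 : Tendsto (fun n : ℕ => ∫ z, χ (((n : ℝ) + 1) * z) * jumpFlux νη νU μ z) atTop
      (𝓝 (∫ _ : ℝ, (0 : ℝ))) := by
    have hH := h.locallyIntegrable_jumpFlux
    refine tendsto_integral_of_dominated_convergence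
      ((Icc (-2 : ℝ) 2).indicator fun z => ‖jumpFlux νη νU μ z‖)
      (fun n => (hsm n).continuous.aestronglyMeasurable.mul hH.aestronglyMeasurable)
      ((integrable_indicator_iff measurableSet_Icc).2
        (hH.integrableOn_isCompact isCompact_Icc).norm)
      (fun n => ae_of_all _ fun z => ?_) ?_
    · rw [norm_mul]
      by_cases hz : z ∈ Icc (-2 : ℝ) 2
      · rw [indicator_of_mem hz, Real.norm_of_nonneg χ.nonneg]
        exact mul_le_of_le_one_left (norm_nonneg _) χ.le_one
      · have h2 : 2 < |z| := by
          by_contra! hle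
          exact hz (abs_le.1 hle)
        rw [indicator_of_notMem hz, χ.zero_of_le_dist, norm_zero, zero_mul]
        rw [Real.dist_eq, sub_zero, abs_mul, abs_of_pos (hk n)]
        change (2 : ℝ) ≤ _
        nlinarith [hk1 n]
    · have hne : ∀ᵐ x : ℝ, x ≠ 0 := by simp [ae_iff]
      filter_upwards [hne] with z hz
      simpa using (hpt z hz).mul_const (jumpFlux νη νU μ z)
  have hsum := (t1.add t2).add t3
  have hz : ∀ n : ℕ, _ = (0 : ℝ) := fun n => h.weak (hsm n) (hcs n)
  have heq := tendsto_nhds_unique hsum (tendsto_const_nhds.congr fun n => (hz n).symm)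
  rw [integral_indicator_const _ (measurableSet_singleton 0)] at heq
  simpa [measureReal_def, mul_comm] using heq

/-- The law has no atom in `0` under the non-degeneracy conditions. -/
lemma IsStatDensity.measure_zero (hf : IsStatDensity 0 γη0 σU2 γU0 νη νU μ f)
    (hnz : ¬(νη = 0 ∧ γη0 = 0)) (h : νU {-1} = 0 ∨ γη0 ≠ 0 ∨ νη univ = ⊤) : μ {0} = 0 := by
  by_contra h0
  have hm : (μ {0}).toReal ≠ 0 := ENNReal.toReal_ne_zero.2 ⟨h0, measure_ne_top _ _⟩
  obtain rfl : γη0 = 0 := (mul_eq_zero.1 hf.invariant.drift_mul_atom).resolve_right hm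
  rcases h with h | h | h
  · exact hnz ⟨hf.eq_zero_of_atom h0 h, rfl⟩
  · exact h rfl
  · exact (hf.measure_univ_lt_top h0).ne h

end

end KEF

theorem stmt10 (ση2 γη σU2 γU : ℝ) (νη νU : Measure ℝ)
    (hση : 0 ≤ ση2) (hσU : 0 ≤ σU2)
    (hνη : IsLevyMeasure νη) (hνU : IsLevyMeasure νU)
    (hconc : νU (Iio (-1 : ℝ)) = 0)
    (hnz : ¬(ση2 = 0 ∧ νη = 0 ∧ γη = 0))
    (μ : Measure ℝ) [IsProbabilityMeasure μ]
    (hinv : Invariant ση2 γη σU2 γU νη νU μ)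
    (hFVη : ∫⁻ y in Icc (-1 : ℝ) 1, ENNReal.ofReal |y| ∂νη < ⊤)
    (hFVU : ∫⁻ y in Icc (-1 : ℝ) 1, ENNReal.ofReal |y| ∂νU < ⊤)
    (hσ : 0 < ση2 + σU2)
    (γη0 γU0 : ℝ)
    (hγη0 : γη0 = γη - ∫ y in Icc (-1 : ℝ) 1, y ∂νη)
    (hγU0 : γU0 = γU - ∫ y in Icc (-1 : ℝ) 1, y ∂νU) :
    ∃ fμ : ℝ → ℝ,
      (0 < ση2 →
        μ = volume.withDensity (fun z => ENNReal.ofReal (fμ z)) ∧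
        ContDiffOn ℝ 1 fμ (({0} : Set ℝ)ᶜ)) ∧
      (0 < σU2 ∧ ση2 = 0 ∧ (νU {(-1 : ℝ)} = 0 ∨ γη0 ≠ 0 ∨ νη Set.univ = ⊤) →
        μ = volume.withDensity (fun z => ENNReal.ofReal (fμ z)) ∧
        ContDiffOn ℝ 1 fμ (({0} : Set ℝ)ᶜ)) ∧
      ((0 < ση2 ∨ (0 < σU2 ∧ ση2 = 0 ∧ (νU {(-1 : ℝ)} = 0 ∨ γη0 ≠ 0 ∨ νη Set.univ = ⊤))) →
        ∀ z : ℝ, z ≠ 0 → densEqFV ση2 σU2 γη0 γU0 νη νU μ fμ z) ∧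
      (0 < σU2 ∧ ση2 = 0 ∧ ¬(νU {(-1 : ℝ)} = 0 ∨ γη0 ≠ 0 ∨ νη Set.univ = ⊤) →
        μ.restrict (({0} : Set ℝ)ᶜ) = volume.withDensity (fun z => ENNReal.ofReal (fμ z)) ∧
        (∀ᵐ z : ℝ ∂volume, DifferentiableAt ℝ fμ z) ∧
        ∀ᵐ z : ℝ ∂volume, densEqFV ση2 σU2 γη0 γU0 νη νU μ fμ z) := by
  have h : IsFVInvariant ση2 γη0 σU2 γU0 νη νU μ :=
    { ση_nonneg := hση
      σU_nonneg := hσU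
      levyη := hνη.isFVLevy hFVη
      levyU := hνU.isFVLevy hFVU
      conc := hconc
      inv := fun f hf hc => by
        obtain ⟨C, hC⟩ := IsTame.of_hasCompactSupport hf hc
        rw [← hinv f hf hc]
        exact integral_congr_ae (ae_of_all _ fun x => (levyGen_eq_fvGen (hνη.isFVLevy hFVη)
          (hνU.isFVLevy hFVU) hconc hγη0 hγU0 hC x).symm) }
  obtain ⟨f, hf⟩ := h.exists_isStatDensity hσ
  have h0 : (0 < ση2 ∨ (0 < σU2 ∧ ση2 = 0 ∧
      (νU {(-1 : ℝ)} = 0 ∨ γη0 ≠ 0 ∨ νη Set.univ = ⊤))) → μ {0} = 0 := by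
    rintro (hpos | ⟨-, rfl, hadd⟩)
    · exact h.measure_zero_of_pos hpos
    · refine hf.measure_zero (fun hz => hnz ⟨rfl, hz.1, ?_⟩) hadd
      rw [hz.2, hz.1] at hγη0
      simpa using hγη0.symm
  refine ⟨f, fun hp => ?_, fun hp => ?_, fun hp z hz => ?_, fun _ => ?_⟩
  · exact ⟨hf.eq_withDensity (h0 (.inl hp)), hf.contDiffOn (h0 (.inl hp))⟩
  · exact ⟨hf.eq_withDensity (h0 (.inr hp)), hf.contDiffOn (h0 (.inr hp))⟩
  · exact hf.densEq hz (hf.hasDerivAt_of_measure_zero (h0 hp) hz) (.inr (h0 hp)) (.inr (h0 hp))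
  · exact ⟨hf.restrict_eq, hf.ae_hasDerivAt.mono fun z hz => hz.differentiableAt, hf.ae_densEq⟩

end
end

section
/- Let (σ_η², ν_η, γ_η) and (σ_Ũ², ν_Ũ, γ_Ũ) be Lévy triplets with ν_Ũ concentrated on [−1,∞), and let μ be an invariant probability measure for the generator A with finite second moment, ∫ x² μ(dx) < ∞. Let φ(u) = ∫ e^{iux} μ(dx) be the characteristic function of μ and ψ_η(u) = i γ_η u − (σ_η²/2) u² + ∫_ℝ (e^{iuy} − 1 − iuy 1_{|y|≤1}) ν_η(dy). Then φ is twice continuously differentiable and for all u ∈ ℝ: ψ_η(u) φ(u) = −γ_Ũ u φ'(u) − (σ_Ũ²/2) u² φ''(u) − ∫_{[−1,∞)} ( φ(u + uy) − φ(u) − uy φ'(u) 1_{|y|≤1} ) ν_Ũ(dy). -/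
open MeasureTheory Set Filter

noncomputable section

open KEF



/-- the characteristic function of `μ` -/
def charFn (μ : Measure ℝ) (u : ℝ) : ℂ := ∫ x, Complex.exp (Complex.I * u * x) ∂μ

/-- the characteristic exponent of the Lévy process `η` -/
def psiEta (σ2 γ : ℝ) (ν : Measure ℝ) (u : ℝ) : ℂ :=
  Complex.I * (γ : ℂ) * (u : ℂ) - (σ2 : ℂ) / 2 * (u : ℂ) ^ 2
    + ∫ y, (Complex.exp (Complex.I * u * y) - 1
        - (if |y| ≤ 1 then Complex.I * (u : ℂ) * (y : ℂ) else 0)) ∂ν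

open scoped Topology ContDiff

section Generator

variable {E : Type*} [NormedAddCommGroup E] [NormedSpace ℝ E]

theorem ContDiff.contDiff_one_deriv {f : ℝ → E} (hf : ContDiff ℝ 2 f) :
    ContDiff ℝ 1 (deriv f) := by
  have h : ContDiff ℝ (1 + 1) f := by simpa [one_add_one_eq_two] using hf
  exact (contDiff_succ_iff_deriv.1 h).2.2

/-- `f` is twice continuously differentiable and bounded by `C` with its first two derivatives. -/
structure BoundedC2 (f : ℝ → E) (C : ℝ) : Prop where
  contDiff : ContDiff ℝ 2 f
  norm_le : ∀ x, ‖f x‖ ≤ C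
  norm_deriv_le : ∀ x, ‖deriv f x‖ ≤ C
  norm_deriv_deriv_le : ∀ x, ‖deriv (deriv f) x‖ ≤ C

/-- The compensated increment of `f` at `x` for a jump `y` scaled by `a`. -/
def jump (f : ℝ → E) (x a y : ℝ) : E :=
  f (x + a * y) - f x - (if |y| ≤ 1 then (a * y) • deriv f x else 0)

/-- The generator `A`, acting on vector-valued functions. -/
def vecGen (ση2 γη σU2 γU : ℝ) (νη νU : Measure ℝ) (f : ℝ → E) (x : ℝ) : E :=
  γη • deriv f x + (ση2 / 2) • deriv (deriv f) x + (∫ y, jump f x 1 y ∂νη)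
    + (γU * x) • deriv f x + (σU2 / 2 * x ^ 2) • deriv (deriv f) x
    + ∫ y in Ici (-1 : ℝ), jump f x x y ∂νU

theorem levyGen_eq_vecGen (ση2 γη σU2 γU : ℝ) (νη νU : Measure ℝ) (f : ℝ → ℝ) (x : ℝ) :
    levyGen ση2 γη σU2 γU νη νU f x = vecGen ση2 γη σU2 γU νη νU f x := by
  simp only [levyGen, vecGen, jump, smul_eq_mul, one_mul, mul_assoc]

namespace BoundedC2

variable {f : ℝ → E} {C : ℝ}

theorem nonneg (hf : BoundedC2 f C) : 0 ≤ C := (norm_nonneg _).trans (hf.norm_le 0)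

theorem differentiable (hf : BoundedC2 f C) : Differentiable ℝ f :=
  hf.contDiff.differentiable (by norm_num)

theorem contDiff_deriv (hf : BoundedC2 f C) : ContDiff ℝ 1 (deriv f) :=
  hf.contDiff.contDiff_one_deriv

theorem continuous_deriv_deriv (hf : BoundedC2 f C) : Continuous (deriv (deriv f)) :=
  hf.contDiff_deriv.continuous_deriv le_rfl

theorem norm_taylor_le (hf : BoundedC2 f C) (x h : ℝ) :
    ‖f (x + h) - f x - h • deriv f x‖ ≤ C * h ^ 2 := by
  have hd : ∀ t, HasDerivAt (fun t => f (x + t) - t • deriv f x)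
      (deriv f (x + t) - deriv f x) t := fun t => by
    have h1 : HasDerivAt (fun t => f (x + t)) (deriv f (x + t)) t :=
      (hf.differentiable (x + t)).hasDerivAt.comp_const_add x t
    have h2 : HasDerivAt (fun t : ℝ => t • deriv f x) ((1 : ℝ) • deriv f x) t :=
      (hasDerivAt_id t).smul_const _
    simpa using! h1.fun_sub h2
  have hb : ∀ t ∈ uIcc 0 h, ‖deriv f (x + t) - deriv f x‖ ≤ C * |h| := fun t ht => by
    have := convex_univ.norm_image_sub_le_of_norm_deriv_le (f := deriv f) (C := C)
      (fun z _ => hf.contDiff_deriv.differentiable (by norm_num) z)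
      (fun z _ => hf.norm_deriv_deriv_le z) (mem_univ x) (mem_univ (x + t))
    refine this.trans (mul_le_mul_of_nonneg_left ?_ hf.nonneg)
    have := abs_sub_left_of_mem_uIcc ht
    simpa using this
  have := (convex_uIcc (0 : ℝ) h).norm_image_sub_le_of_norm_hasDerivWithin_le
    (fun t _ => (hd t).hasDerivWithinAt) hb left_mem_uIcc right_mem_uIcc
  calc ‖f (x + h) - f x - h • deriv f x‖
      = ‖f (x + h) - h • deriv f x - (f (x + 0) - (0 : ℝ) • deriv f x)‖ := by
        congr 1; simp; abel
    _ ≤ C * |h| * ‖h - 0‖ := this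
    _ = C * h ^ 2 := by rw [sub_zero, Real.norm_eq_abs, mul_assoc, ← sq, sq_abs]

theorem norm_jump_le (hf : BoundedC2 f C) (x a y : ℝ) :
    ‖jump f x a y‖ ≤ 2 * C * (1 + a ^ 2) * min 1 (y ^ 2) := by
  have hC := hf.nonneg
  unfold jump
  split_ifs with hy
  · have hy2 : y ^ 2 ≤ 1 := (sq_le_one_iff_abs_le_one y).2 hy
    rw [min_eq_right hy2]
    refine (hf.norm_taylor_le x (a * y)).trans ?_
    have h1 : 0 ≤ C * y ^ 2 := by positivity
    have h2 : 0 ≤ C * y ^ 2 * a ^ 2 := by positivity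
    nlinarith
  · have hy2 : 1 ≤ y ^ 2 := by
      rw [← sq_abs]; nlinarith [not_le.1 hy]
    rw [min_eq_left hy2, sub_zero]
    refine (norm_sub_le _ _).trans ?_
    have := hf.norm_le (x + a * y)
    have := hf.norm_le x
    have h2 : 0 ≤ C * a ^ 2 := by positivity
    nlinarith

theorem stronglyMeasurable_jump (hf : BoundedC2 f C) {a : ℝ × ℝ → ℝ} (ha : Measurable a) :
    StronglyMeasurable fun p : ℝ × ℝ => jump f p.1 (a p) p.2 := by
  have hm : StronglyMeasurable fun p : ℝ × ℝ => a p * p.2 :=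
    (ha.mul measurable_snd).stronglyMeasurable
  refine ((hf.contDiff.continuous.comp_stronglyMeasurable
    (measurable_fst.stronglyMeasurable.add hm)).sub
    (hf.contDiff.continuous.comp_stronglyMeasurable measurable_fst.stronglyMeasurable)).sub ?_
  refine StronglyMeasurable.ite (measurableSet_le (by fun_prop) measurable_const) ?_
    stronglyMeasurable_const
  exact hm.smul (hf.contDiff_deriv.continuous.comp_stronglyMeasurable
    measurable_fst.stronglyMeasurable)

end BoundedC2

section LevyMeasure

variable {ν : Measure ℝ}

theorem KEF.IsLevyMeasure.integrable_min (hν : IsLevyMeasure ν) :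
    Integrable (fun y : ℝ => min 1 (y ^ 2)) ν := by
  refine ⟨by fun_prop, ?_⟩
  rw [hasFiniteIntegral_iff_ofReal (ae_of_all _ fun y => by positivity)]
  exact hν.2

theorem KEF.IsLevyMeasure.sFinite (hν : IsLevyMeasure ν) : SFinite ν := by
  have hfin : IsFiniteMeasure (ν.withDensity fun y => ENNReal.ofReal (min 1 (y ^ 2))) :=
    isFiniteMeasure_withDensity hν.2.ne
  rw [← withDensity_inv_same (μ := ν) (f := fun y => ENNReal.ofReal (min 1 (y ^ 2)))
    (by fun_prop) ?_ (ae_of_all _ fun _ => ENNReal.ofReal_ne_top)]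
  · infer_instance
  · have h0 : ∀ᵐ y ∂ν, y ≠ 0 := by simpa [ae_iff] using hν.1
    filter_upwards [h0] with y hy
    simpa using hy

theorem KEF.IsLevyMeasure.restrict (hν : IsLevyMeasure ν) (s : Set ℝ) :
    IsLevyMeasure (ν.restrict s) :=
  ⟨le_antisymm ((Measure.restrict_apply_le s _).trans_eq hν.1) zero_le,
    (lintegral_mono' Measure.restrict_le_self le_rfl).trans_lt hν.2⟩

variable {f : ℝ → E} {C : ℝ}

theorem BoundedC2.aestronglyMeasurable_jump (hf : BoundedC2 f C) (x a : ℝ) :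
    AEStronglyMeasurable (jump f x a) ν :=
  ((hf.stronglyMeasurable_jump (a := fun _ => a) measurable_const).comp_measurable
    (measurable_prodMk_left (x := x))).aestronglyMeasurable

theorem BoundedC2.integrable_jump (hf : BoundedC2 f C) (hν : IsLevyMeasure ν) (x a : ℝ) :
    Integrable (jump f x a) ν :=
  (hν.integrable_min.const_mul (2 * C * (1 + a ^ 2))).mono' (hf.aestronglyMeasurable_jump x a)
    (ae_of_all _ fun y => hf.norm_jump_le x a y)

theorem BoundedC2.norm_integral_jump_le (hf : BoundedC2 f C) (hν : IsLevyMeasure ν) (x a : ℝ) :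
    ‖∫ y, jump f x a y ∂ν‖ ≤ 2 * C * (1 + a ^ 2) * ∫ y, min 1 (y ^ 2) ∂ν := by
  rw [← integral_const_mul]
  exact norm_integral_le_of_norm_le (hν.integrable_min.const_mul _)
    (ae_of_all _ fun y => hf.norm_jump_le x a y)

theorem BoundedC2.stronglyMeasurable_integral_jump (hf : BoundedC2 f C) (hν : IsLevyMeasure ν)
    {a : ℝ → ℝ} (ha : Measurable a) : StronglyMeasurable fun x => ∫ y, jump f x (a x) y ∂ν := by
  have := hν.sFinite
  exact (hf.stronglyMeasurable_jump (a := fun p => a p.1)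
    (ha.comp measurable_fst)).integral_prod_right'

theorem BoundedC2.integrable_prod_jump {μ : Measure ℝ} [IsFiniteMeasure μ] (hf : BoundedC2 f C)
    (hν : IsLevyMeasure ν) (hmom : Integrable (fun x => x ^ 2) μ) :
    Integrable (fun p : ℝ × ℝ => jump f p.1 p.1 p.2) (μ.prod ν) := by
  have := hν.sFinite
  exact ((((integrable_const 1).add hmom).const_mul (2 * C)).mul_prod hν.integrable_min).mono'
    (hf.stronglyMeasurable_jump measurable_fst).aestronglyMeasurable
    (ae_of_all _ fun p => hf.norm_jump_le p.1 p.1 p.2)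

theorem tendsto_integral_jump {F : ℕ → ℝ → E} (hν : IsLevyMeasure ν)
    (hF : ∀ n, BoundedC2 (F n) C) (hlim : ∀ x, ∀ᶠ n in atTop, F n =ᶠ[𝓝 x] f) (x a : ℝ) :
    Tendsto (fun n => ∫ y, jump (F n) x a y ∂ν) atTop (𝓝 (∫ y, jump f x a y ∂ν)) := by
  refine tendsto_integral_of_dominated_convergence
    (fun y => 2 * C * (1 + a ^ 2) * min 1 (y ^ 2))
    (fun n => (hF n).aestronglyMeasurable_jump x a) (hν.integrable_min.const_mul _)
    (fun n => ae_of_all _ fun y => (hF n).norm_jump_le x a y) (ae_of_all _ fun y => ?_)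
  refine tendsto_const_nhds.congr' ?_
  filter_upwards [hlim x, hlim (x + a * y)] with n h1 h2
  simp only [jump, h1.eq_of_nhds, h2.eq_of_nhds, h1.deriv_eq]

end LevyMeasure

section VecGen

variable {ση2 γη σU2 γU : ℝ} {νη νU μ : Measure ℝ} {f : ℝ → E} {C : ℝ}

theorem BoundedC2.norm_vecGen_le (hf : BoundedC2 f C) (hνη : IsLevyMeasure νη)
    (hνU : IsLevyMeasure νU) (x : ℝ) :
    ‖vecGen ση2 γη σU2 γU νη νU f x‖ ≤ C * (|γη| + |ση2 / 2| + 4 * (∫ y, min 1 (y ^ 2) ∂νη)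
      + |γU| + |σU2 / 2| + 2 * ∫ y in Ici (-1 : ℝ), min 1 (y ^ 2) ∂νU) * (1 + x ^ 2) := by
  have hC := hf.nonneg
  have hIη : 0 ≤ ∫ y, min 1 (y ^ 2) ∂νη := integral_nonneg fun y => by positivity
  have h1 := hf.norm_integral_jump_le hνη x 1
  have h2 := hf.norm_integral_jump_le (hνU.restrict (Ici (-1))) x x
  have hx : |x| ≤ 1 + x ^ 2 := by rw [← sq_abs x]; nlinarith [sq_nonneg (|x| - 1)]
  have hx1 : 1 ≤ 1 + x ^ 2 := by nlinarith
  have hx2 : x ^ 2 ≤ 1 + x ^ 2 := by linarith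
  have h3 : ‖γη • deriv f x‖ ≤ C * |γη| * (1 + x ^ 2) := by
    rw [norm_smul, Real.norm_eq_abs, mul_comm C]
    exact (mul_le_mul_of_nonneg_left (hf.norm_deriv_le x) (abs_nonneg _)).trans
      (le_mul_of_one_le_right (by positivity) hx1)
  have h4 : ‖(ση2 / 2) • deriv (deriv f) x‖ ≤ C * |ση2 / 2| * (1 + x ^ 2) := by
    rw [norm_smul, Real.norm_eq_abs, mul_comm C]
    exact (mul_le_mul_of_nonneg_left (hf.norm_deriv_deriv_le x) (abs_nonneg _)).trans
      (le_mul_of_one_le_right (by positivity) hx1)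
  have h5 : ‖(γU * x) • deriv f x‖ ≤ C * |γU| * (1 + x ^ 2) := by
    rw [norm_smul, Real.norm_eq_abs, abs_mul]
    calc |γU| * |x| * ‖deriv f x‖ ≤ |γU| * (1 + x ^ 2) * C := by
          gcongr; exact hf.norm_deriv_le x
      _ = _ := by ring
  have h6 : ‖(σU2 / 2 * x ^ 2) • deriv (deriv f) x‖ ≤ C * |σU2 / 2| * (1 + x ^ 2) := by
    rw [norm_smul, Real.norm_eq_abs, abs_mul, abs_of_nonneg (sq_nonneg x)]
    calc |σU2 / 2| * x ^ 2 * ‖deriv (deriv f) x‖ ≤ |σU2 / 2| * (1 + x ^ 2) * C := by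
          gcongr; exact hf.norm_deriv_deriv_le x
      _ = _ := by ring
  have h7 : 2 * C * (1 + 1 ^ 2) * (∫ y, min 1 (y ^ 2) ∂νη)
      ≤ C * (4 * ∫ y, min 1 (y ^ 2) ∂νη) * (1 + x ^ 2) :=
    (le_of_eq (by ring)).trans (le_mul_of_one_le_right (by positivity) hx1)
  unfold vecGen
  refine (norm_add_le_of_le (norm_add_le_of_le (norm_add_le_of_le (norm_add_le_of_le
    (norm_add_le_of_le h3 h4) (h1.trans h7)) h5) h6) h2).trans (le_of_eq (by ring))

theorem BoundedC2.aestronglyMeasurable_vecGen (hf : BoundedC2 f C) (hνη : IsLevyMeasure νη)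
    (hνU : IsLevyMeasure νU) :
    AEStronglyMeasurable (vecGen ση2 γη σU2 γU νη νU f) μ := by
  have hd := hf.contDiff_deriv.continuous
  have hdd := hf.continuous_deriv_deriv
  refine (StronglyMeasurable.add (.add (.add (.add ?_
    (hf.stronglyMeasurable_integral_jump hνη measurable_const)) ?_) ?_)
    (hf.stronglyMeasurable_integral_jump (hνU.restrict (Ici (-1)))
      measurable_id)).aestronglyMeasurable
  all_goals exact Continuous.stronglyMeasurable (by fun_prop)

theorem BoundedC2.integrable_vecGen [IsFiniteMeasure μ] (hf : BoundedC2 f C)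
    (hνη : IsLevyMeasure νη) (hνU : IsLevyMeasure νU) (hmom : Integrable (fun x => x ^ 2) μ) :
    Integrable (vecGen ση2 γη σU2 γU νη νU f) μ :=
  (((integrable_const 1).add hmom).const_mul _).mono' (hf.aestronglyMeasurable_vecGen hνη hνU)
    (ae_of_all _ fun x => hf.norm_vecGen_le hνη hνU x)

theorem tendsto_integral_vecGen [IsFiniteMeasure μ] {F : ℕ → ℝ → E} (hνη : IsLevyMeasure νη)
    (hνU : IsLevyMeasure νU) (hmom : Integrable (fun x => x ^ 2) μ)
    (hF : ∀ n, BoundedC2 (F n) C) (hlim : ∀ x, ∀ᶠ n in atTop, F n =ᶠ[𝓝 x] f) :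
    Tendsto (fun n => ∫ x, vecGen ση2 γη σU2 γU νη νU (F n) x ∂μ) atTop
      (𝓝 (∫ x, vecGen ση2 γη σU2 γU νη νU f x ∂μ)) := by
  refine tendsto_integral_of_dominated_convergence _
    (fun n => (hF n).aestronglyMeasurable_vecGen hνη hνU)
    (((integrable_const 1).add hmom).const_mul _)
    (fun n => ae_of_all _ fun x => (hF n).norm_vecGen_le hνη hνU x) (ae_of_all _ fun x => ?_)
  have hd : Tendsto (fun n => deriv (F n) x) atTop (𝓝 (deriv f x)) :=
    tendsto_const_nhds.congr' ((hlim x).mono fun n h => h.deriv_eq.symm)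
  have hdd : Tendsto (fun n => deriv (deriv (F n)) x) atTop (𝓝 (deriv (deriv f) x)) :=
    tendsto_const_nhds.congr' ((hlim x).mono fun n h => h.deriv.deriv_eq.symm)
  exact ((((((hd.const_smul _).add (hdd.const_smul _)).add
    (tendsto_integral_jump hνη hF hlim x 1)).add (hd.const_smul _)).add (hdd.const_smul _)).add
    (tendsto_integral_jump (hνU.restrict _) hF hlim x x))

theorem ContinuousLinearMap.deriv_comp_fun {F : Type*} [NormedAddCommGroup F] [NormedSpace ℝ F]
    (L : E →L[ℝ] F) {f : ℝ → E} (hf : Differentiable ℝ f) :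
    deriv (fun x => L (f x)) = fun x => L (deriv f x) :=
  funext fun x => (L.hasFDerivAt.comp_hasDerivAt x (hf x).hasDerivAt).deriv

theorem vecGen_clm_comp {f : ℝ → ℂ} (L : ℂ →L[ℝ] ℝ) (hf : BoundedC2 f C)
    (hνη : IsLevyMeasure νη) (hνU : IsLevyMeasure νU) (x : ℝ) :
    vecGen ση2 γη σU2 γU νη νU (fun x => L (f x)) x = L (vecGen ση2 γη σU2 γU νη νU f x) := by
  have hd := L.deriv_comp_fun hf.differentiable
  have hdd := L.deriv_comp_fun (hf.contDiff_deriv.differentiable one_ne_zero)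
  have hj : ∀ a y, jump (fun x => L (f x)) x a y = L (jump f x a y) := fun a y => by
    simp only [jump, hd]
    split_ifs <;> simp only [map_sub, map_smul, map_zero]
  simp only [vecGen, hj, hd, hdd, map_add, map_smul,
    L.integral_comp_comm (hf.integrable_jump hνη x 1),
    L.integral_comp_comm (hf.integrable_jump (hνU.restrict (Ici (-1))) x x)]

end VecGen

end Generator

section Cutoff

theorem BoundedC2.comp_mul_left {f : ℝ → ℝ} {C c : ℝ} (hf : BoundedC2 f C) (hc : |c| ≤ 1) :
    BoundedC2 (fun x => f (c * x)) C := by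
  have hd : deriv (fun x => f (c * x)) = fun x => c * deriv f (c * x) :=
    funext fun x => deriv_comp_mul_left c f x
  have hdd : deriv (fun x => c * deriv f (c * x)) = fun x => c * (c * deriv (deriv f) (c * x)) := by
    funext x
    rw [deriv_const_mul_field]
    exact congrArg (c * ·) (deriv_comp_mul_left c (deriv f) x)
  have hle : ∀ z, ‖z‖ ≤ C → ‖c * z‖ ≤ C := fun z hz => by
    rw [norm_mul]
    exact (mul_le_of_le_one_left (norm_nonneg z) hc).trans hz
  refine ⟨hf.contDiff.comp (contDiff_const.mul contDiff_id), fun x => hf.norm_le _,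
    fun x => ?_, fun x => ?_⟩
  · rw [hd]
    exact hle _ (hf.norm_deriv_le _)
  · rw [hd, hdd]
    exact hle _ (hle _ (hf.norm_deriv_deriv_le _))

theorem BoundedC2.mul {f g : ℝ → ℝ} {C K : ℝ} (hf : BoundedC2 f C) (hg : BoundedC2 g K) :
    BoundedC2 (fun x => f x * g x) (4 * (C * K)) := by
  have hd : deriv (fun x => f x * g x) = fun x => deriv f x * g x + f x * deriv g x :=
    funext fun x => deriv_fun_mul (hf.differentiable x) (hg.differentiable x)
  have hf' := hf.contDiff_deriv.differentiable one_ne_zero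
  have hg' := hg.contDiff_deriv.differentiable one_ne_zero
  have hdd : deriv (fun x => deriv f x * g x + f x * deriv g x) = fun x =>
      deriv (deriv f) x * g x + deriv f x * deriv g x
        + (deriv f x * deriv g x + f x * deriv (deriv g) x) := by
    funext x
    rw [deriv_fun_add ((hf' x).fun_mul (hg.differentiable x)) ((hf.differentiable x).fun_mul (hg' x)),
      deriv_fun_mul (hf' x) (hg.differentiable x), deriv_fun_mul (hf.differentiable x) (hg' x)]
  have hle : ∀ {a b : ℝ}, ‖a‖ ≤ C → ‖b‖ ≤ K → ‖a * b‖ ≤ C * K := fun {a b} ha hb =>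
    norm_mul_le_of_le ha hb
  have hCK : 0 ≤ C * K := mul_nonneg hf.nonneg hg.nonneg
  refine ⟨hf.contDiff.mul hg.contDiff, fun x => ?_, fun x => ?_, fun x => ?_⟩
  · exact (hle (hf.norm_le x) (hg.norm_le x)).trans (by linarith)
  · rw [hd]
    exact (norm_add_le_of_le (hle (hf.norm_deriv_le x) (hg.norm_le x))
      (hle (hf.norm_le x) (hg.norm_deriv_le x))).trans (by linarith)
  · rw [hd, hdd]
    exact (norm_add_le_of_le
      (norm_add_le_of_le (hle (hf.norm_deriv_deriv_le x) (hg.norm_le x))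
        (hle (hf.norm_deriv_le x) (hg.norm_deriv_le x)))
      (norm_add_le_of_le (hle (hf.norm_deriv_le x) (hg.norm_deriv_le x))
        (hle (hf.norm_le x) (hg.norm_deriv_deriv_le x)))).trans (by linarith)

theorem HasCompactSupport.exists_boundedC2 {χ : ℝ → ℝ} (hχ : ContDiff ℝ 2 χ)
    (hs : HasCompactSupport χ) : ∃ K, BoundedC2 χ K := by
  have h' := hχ.contDiff_one_deriv
  obtain ⟨K₀, h₀⟩ := hs.exists_bound_of_continuous hχ.continuous
  obtain ⟨K₁, h₁⟩ := hs.deriv.exists_bound_of_continuous h'.continuous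
  obtain ⟨K₂, h₂⟩ := hs.deriv.deriv.exists_bound_of_continuous (h'.continuous_deriv le_rfl)
  exact ⟨max K₀ (max K₁ K₂), hχ, fun x => (h₀ x).trans (by simp),
    fun x => (h₁ x).trans (by simp), fun x => (h₂ x).trans (by simp)⟩

/-- A bounded smooth function is the local limit of test functions with uniformly bounded
derivatives. -/
theorem exists_testFunction_approx {f : ℝ → ℝ} {C : ℝ} (hsm : ContDiff ℝ (⊤ : ℕ∞) f)
    (hf : BoundedC2 f C) : ∃ (K : ℝ) (F : ℕ → ℝ → ℝ),
      (∀ n, ContDiff ℝ (⊤ : ℕ∞) (F n) ∧ HasCompactSupport (F n) ∧ BoundedC2 (F n) K) ∧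
      ∀ x, ∀ᶠ n in atTop, F n =ᶠ[𝓝 x] f := by
  let χ : ContDiffBump (0 : ℝ) := ⟨1, 2, one_pos, one_lt_two⟩
  obtain ⟨K, hK⟩ := χ.hasCompactSupport.exists_boundedC2 χ.contDiff
  have hc : ∀ n : ℕ, (0 : ℝ) < ((n : ℝ) + 1)⁻¹ := fun n => by positivity
  have hc1 : ∀ n : ℕ, |((n : ℝ) + 1)⁻¹| ≤ 1 := fun n => by
    rw [abs_of_pos (hc n)]
    exact inv_le_one_of_one_le₀ (by simp)
  refine ⟨4 * (C * K), fun n x => f x * χ (((n : ℝ) + 1)⁻¹ * x), fun n => ⟨?_, ?_, ?_⟩,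
    fun x => ?_⟩
  · exact hsm.mul (χ.contDiff.comp (contDiff_const.mul contDiff_id))
  · exact HasCompactSupport.mul_left
      (χ.hasCompactSupport.comp_homeomorph (Homeomorph.mulLeft₀ _ (hc n).ne'))
  · exact hf.mul (hK.comp_mul_left (hc1 n))
  · filter_upwards [eventually_gt_atTop ⌈|x|⌉₊] with n hn
    have hx : |x| < (n : ℝ) + 1 := by
      have := (Nat.le_ceil |x|).trans (Nat.cast_le.2 hn.le)
      linarith
    filter_upwards [(continuous_abs.tendsto x).eventually (gt_mem_nhds hx)] with z hz
    have h1 : χ (((n : ℝ) + 1)⁻¹ * z) = 1 := χ.one_of_mem_closedBall <| by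
      rw [mem_closedBall_zero_iff, Real.norm_eq_abs, abs_mul, abs_of_pos (hc n)]
      change _ ≤ (1 : ℝ)
      rw [inv_mul_le_iff₀ (by positivity)]
      linarith
    rw [h1, mul_one]

end Cutoff

section CharacteristicFunction

variable {ση2 γη σU2 γU : ℝ} {νη νU μ : Measure ℝ}

theorem integral_vecGen_eq_zero [IsFiniteMeasure μ] {f : ℝ → ℝ} {C : ℝ}
    (hνη : IsLevyMeasure νη) (hνU : IsLevyMeasure νU)
    (hinv : Invariant ση2 γη σU2 γU νη νU μ) (hmom : Integrable (fun x => x ^ 2) μ)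
    (hsm : ContDiff ℝ (⊤ : ℕ∞) f) (hf : BoundedC2 f C) :
    ∫ x, vecGen ση2 γη σU2 γU νη νU f x ∂μ = 0 := by
  obtain ⟨K, F, hF, hlim⟩ := exists_testFunction_approx hsm hf
  refine tendsto_nhds_unique (tendsto_integral_vecGen hνη hνU hmom (fun n => (hF n).2.2) hlim)
    (tendsto_const_nhds.congr fun n => ?_)
  simp only [← levyGen_eq_vecGen]
  exact (hinv (F n) (hF n).1 (hF n).2.1).symm

/-- The character `x ↦ e^{iux}`. -/
def character (u x : ℝ) : ℂ := Complex.exp (Complex.I * u * x)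

theorem norm_character (u x : ℝ) : ‖character u x‖ = 1 := by
  have h : Complex.I * (u : ℂ) * (x : ℂ) = ((u * x : ℝ) : ℂ) * Complex.I := by push_cast; ring
  rw [character, h, Complex.norm_exp_ofReal_mul_I]

theorem contDiff_character {n : WithTop ℕ∞} (u : ℝ) : ContDiff ℝ n (character u) :=
  (contDiff_const.mul Complex.ofRealCLM.contDiff).cexp

theorem deriv_character (u : ℝ) :
    deriv (character u) = fun x => Complex.I * u * character u x := by
  funext x
  have h : HasDerivAt (fun x : ℝ => Complex.I * (u : ℂ) * (x : ℂ)) (Complex.I * u * 1) x :=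
    (Complex.ofRealCLM.hasDerivAt (x := x)).const_mul (Complex.I * (u : ℂ))
  exact h.cexp.deriv.trans (by rw [mul_one, mul_comm, character])

theorem deriv_deriv_character (u : ℝ) :
    deriv (deriv (character u)) = fun x => -(u : ℂ) ^ 2 * character u x := by
  funext x
  rw [deriv_character, deriv_const_mul_field, deriv_character, ← mul_assoc]
  congr 1
  linear_combination (u : ℂ) ^ 2 * Complex.I_sq

theorem boundedC2_character (u : ℝ) : BoundedC2 (character u) (1 + |u| + u ^ 2) := by
  have h := abs_nonneg u
  have h2 := sq_nonneg u
  refine ⟨contDiff_character u, fun x => ?_, fun x => ?_, fun x => ?_⟩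
  · rw [norm_character]; linarith
  · simp only [deriv_character, norm_mul, norm_character, Complex.norm_I, Complex.norm_real,
      Real.norm_eq_abs]
    linarith
  · simp only [deriv_deriv_character, norm_mul, norm_neg, norm_pow, norm_character,
      Complex.norm_real, Real.norm_eq_abs, sq_abs]
    linarith

theorem BoundedC2.clm_comp {f : ℝ → ℂ} {C : ℝ} (hf : BoundedC2 f C) (L : ℂ →L[ℝ] ℝ) :
    BoundedC2 (fun x => L (f x)) (‖L‖ * C) := by
  have hd := L.deriv_comp_fun hf.differentiable
  have hdd := L.deriv_comp_fun (hf.contDiff_deriv.differentiable one_ne_zero)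
  refine ⟨L.contDiff.comp hf.contDiff, fun x => L.le_opNorm_of_le (hf.norm_le x), ?_, ?_⟩
  · rw [hd]; exact fun x => L.le_opNorm_of_le (hf.norm_deriv_le x)
  · rw [hd, hdd]; exact fun x => L.le_opNorm_of_le (hf.norm_deriv_deriv_le x)

theorem integral_vecGen_character_eq_zero [IsFiniteMeasure μ]
    (hνη : IsLevyMeasure νη) (hνU : IsLevyMeasure νU)
    (hinv : Invariant ση2 γη σU2 γU νη νU μ) (hmom : Integrable (fun x => x ^ 2) μ) (u : ℝ) :
    ∫ x, vecGen ση2 γη σU2 γU νη νU (character u) x ∂μ = 0 := by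
  have hb := boundedC2_character u
  have key : ∀ L : ℂ →L[ℝ] ℝ, L (∫ x, vecGen ση2 γη σU2 γU νη νU (character u) x ∂μ) = 0 :=
    fun L => by
      rw [← L.integral_comp_comm (hb.integrable_vecGen hνη hνU hmom)]
      simp only [← vecGen_clm_comp L hb hνη hνU]
      exact integral_vecGen_eq_zero hνη hνU hinv hmom
        (L.contDiff.comp (contDiff_character u)) (hb.clm_comp L)
  exact Complex.ext (key Complex.reCLM) (key Complex.imCLM)

theorem charFn_eq_charFun (μ : Measure ℝ) : charFn μ = charFun μ := by
  funext u
  rw [charFn, charFun_apply_real]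
  congr 1 with x
  ring_nf

theorem memLp_id_two (hmom : Integrable (fun x : ℝ => x ^ 2) μ) : MemLp id 2 μ :=
  (memLp_two_iff_integrable_sq aestronglyMeasurable_id).2 hmom

theorem deriv_charFn [IsFiniteMeasure μ] (hmom : Integrable (fun x : ℝ => x ^ 2) μ) (u : ℝ) :
    deriv (charFn μ) u = ∫ x, Complex.I * x * character u x ∂μ := by
  have h : MemLp id ((1 : ℕ) : ENNReal) μ := (memLp_id_two hmom).mono_exponent (by norm_num)
  rw [charFn_eq_charFun, ← iteratedDeriv_one, iteratedDeriv_charFun h, ← integral_const_mul]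
  congr 1 with x
  rw [character, pow_one, pow_one, mul_assoc]
  ring_nf

theorem deriv_deriv_charFn [IsFiniteMeasure μ] (hmom : Integrable (fun x : ℝ => x ^ 2) μ)
    (u : ℝ) : deriv (deriv (charFn μ)) u = ∫ x, -(x : ℂ) ^ 2 * character u x ∂μ := by
  have h : MemLp id ((2 : ℕ) : ENNReal) μ := by exact_mod_cast memLp_id_two hmom
  have h2 : deriv (deriv (charFn μ)) = iteratedDeriv 2 (charFn μ) := by
    rw [iteratedDeriv_succ, iteratedDeriv_one]
  rw [h2, charFn_eq_charFun, iteratedDeriv_charFun h, ← integral_const_mul]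
  congr 1 with x
  rw [character, Complex.I_sq, neg_one_mul, neg_mul]
  ring_nf

theorem integrable_mul_character {g : ℝ → ℂ} (hg : Integrable g μ) (u : ℝ) :
    Integrable (fun x => g x * character u x) μ :=
  hg.mul_bdd (c := 1) (contDiff_character (n := 0) u).continuous.aestronglyMeasurable
    (ae_of_all _ fun x => (norm_character u x).le)

theorem integrable_character [IsFiniteMeasure μ] (u : ℝ) : Integrable (character u) μ := by
  simpa using integrable_mul_character (integrable_const (μ := μ) (1 : ℂ)) u

theorem integrable_id_mul_character [IsFiniteMeasure μ]
    (hmom : Integrable (fun x : ℝ => x ^ 2) μ) (u : ℝ) :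
    Integrable (fun x : ℝ => Complex.I * (x : ℂ) * character u x) μ :=
  integrable_mul_character ((((memLp_id_two hmom).integrable one_le_two).ofReal).const_mul _) u

theorem jump_character_one (u x y : ℝ) : jump (character u) x 1 y = character u x *
    (Complex.exp (Complex.I * u * y) - 1
      - (if |y| ≤ 1 then Complex.I * (u : ℂ) * (y : ℂ) else 0)) := by
  have h : character u (x + 1 * y) = character u x * Complex.exp (Complex.I * u * y) := by
    rw [character, character, ← Complex.exp_add]
    push_cast
    ring_nf
  rw [jump, h, deriv_character]
  split_ifs
  · rw [Complex.real_smul]; push_cast; ring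
  · ring

theorem vecGen_character (u x : ℝ) : vecGen ση2 γη σU2 γU νη νU (character u) x =
    psiEta ση2 γη νη u * character u x + γU * u * (Complex.I * x * character u x)
      + σU2 / 2 * u ^ 2 * (-(x : ℂ) ^ 2 * character u x)
      + ∫ y in Ici (-1 : ℝ), jump (character u) x x y ∂νU := by
  simp only [vecGen, jump_character_one, integral_const_mul, deriv_deriv_character]
  simp only [deriv_character, Complex.real_smul, psiEta]
  push_cast
  ring

theorem integral_jump_character [IsFiniteMeasure μ] (hmom : Integrable (fun x : ℝ => x ^ 2) μ)
    (u y : ℝ) : ∫ x, jump (character u) x x y ∂μ = charFn μ (u + u * y) - charFn μ u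
      - (if |y| ≤ 1 then (u : ℂ) * (y : ℂ) * deriv (charFn μ) u else 0) := by
  have hint : ∀ v, Integrable (character v) μ := integrable_character
  have hI := integrable_id_mul_character hmom u
  have hj : ∀ x, jump (character u) x x y = character (u + u * y) x - character u x
      - (if |y| ≤ 1 then (u : ℂ) * y else 0) * (Complex.I * x * character u x) := fun x => by
    have h : character u (x + x * y) = character (u + u * y) x := by
      simp only [character]
      push_cast
      ring_nf
    rw [jump, h, deriv_character]
    split_ifs
    · rw [Complex.real_smul]; push_cast; ring
    · ring
  simp only [hj]
  have hsub : Integrable (fun x => character (u + u * y) x - character u x) μ :=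
    (hint _).sub (hint _)
  rw [integral_sub hsub (hI.const_mul _), integral_sub (hint _) (hint _),
    integral_const_mul, ← deriv_charFn hmom, ite_mul, zero_mul]
  rfl

end CharacteristicFunction

theorem stmt11 (ση2 γη σU2 γU : ℝ) (νη νU : Measure ℝ)
    (hση : 0 ≤ ση2) (hσU : 0 ≤ σU2)
    (hνη : IsLevyMeasure νη) (hνU : IsLevyMeasure νU)
    (hconc : νU (Iio (-1 : ℝ)) = 0)
    (μ : Measure ℝ) [IsProbabilityMeasure μ]
    (hinv : Invariant ση2 γη σU2 γU νη νU μ)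
    (hmom : MeasureTheory.Integrable (fun x => x ^ 2) μ) :
    ContDiff ℝ 2 (charFn μ) ∧
    ∀ u : ℝ,
      psiEta ση2 γη νη u * charFn μ u =
        -(γU : ℂ) * (u : ℂ) * deriv (charFn μ) u
          - (σU2 : ℂ) / 2 * (u : ℂ) ^ 2 * deriv (deriv (charFn μ)) u
          - ∫ y in Ici (-1 : ℝ),
              (charFn μ (u + u * y) - charFn μ u
                - (if |y| ≤ 1 then (u : ℂ) * (y : ℂ) * deriv (charFn μ) u else 0)) ∂νU := by
  refine ⟨?_, fun u => ?_⟩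
  · rw [charFn_eq_charFun]
    exact contDiff_charFun (n := 2) (by exact_mod_cast memLp_id_two hmom)
  have := hνU.sFinite
  have h0 := integrable_character (μ := μ) u
  have h1 := integrable_id_mul_character hmom u
  have hx2 : Integrable (fun x : ℝ => -(x : ℂ) ^ 2) μ := by
    simpa using hmom.neg.ofReal (𝕜 := ℂ)
  have h2 := integrable_mul_character hx2 u
  have h3 := (boundedC2_character u).integrable_prod_jump (hνU.restrict (Ici (-1))) hmom
  have hzero := integral_vecGen_character_eq_zero hνη hνU hinv hmom u
  simp only [vecGen_character] at hzero
  rw [integral_add (((h0.const_mul _).fun_add (h1.const_mul _)).fun_add (h2.const_mul _))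
      h3.integral_prod_left,
    integral_add ((h0.const_mul _).fun_add (h1.const_mul _)) (h2.const_mul _),
    integral_add (h0.const_mul _) (h1.const_mul _), integral_const_mul, integral_const_mul,
    integral_const_mul, ← deriv_charFn hmom, ← deriv_deriv_charFn hmom,
    integral_integral_swap h3] at hzero
  simp only [integral_jump_character hmom] at hzero
  have hφ : ∫ x, character u x ∂μ = charFn μ u := rfl
  rw [hφ] at hzero
  linear_combination hzero

end
end
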